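/- Let G be a Carnot group of step r and Ω ⊂ G an open, bounded set. If u ∈ S^{1,2}_{loc}(Ω; ℝ^N) is a weak solution of the constant-coefficient system (1.1) and the data f^α, f_i^α are smooth functions on Ω, then u is smooth (C^∞) in Ω. -/

import Mathlib

open MeasureTheory ENNReal

noncomputable section

/-- The underlying space of a Carnot group in exponential coordinates. -/
abbrev CSpace (n : ℕ) := EuclideanSpace ℝ (Fin n)

/-- The Lie bracket of two vector fields on `CSpace n`. -/
def vbracket {n : ℕ} (F H : CSpace n → CSpace n) : CSpace n → CSpace n :=
  fun p => fderiv ℝ H p (F p) - fderiv ℝ F p (H p)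

/-- Differentiation of a function along a vector field `Z`. -/
def Dvf {n : ℕ} (Z : CSpace n → CSpace n) (f : CSpace n → ℝ) : CSpace n → ℝ :=
  fun p => fderiv ℝ f p (Z p)

/-- A Carnot group of step `r`, realized in exponential coordinates on `ℝⁿ`.
The layers `V^k` of the stratification of the Lie algebra are indexed by
`k = 1, …, r`; `m k` is the dimension of `V^k` (with `m k = 0` for `k = 0` and
`k > r`), and `X k i`, `1 ≤ i ≤ m k`, is a left-invariant basis of `V^k`
(a left-invariant vector field being recorded through its coefficient map
`CSpace n → CSpace n`). -/
structure CarnotGroup (r n : ℕ) : Type where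
  hr : 0 < r
  /-- dimension of the `k`-th layer -/
  m : ℕ → ℕ
  m_zero : ∀ k, k = 0 ∨ r < k → m k = 0
  dim_eq : ∑ k ∈ Finset.range (r + 1), m k = n
  /-- the (smooth) group multiplication -/
  mul : CSpace n → CSpace n → CSpace n
  one : CSpace n
  inv : CSpace n → CSpace n
  smooth_mul : ContDiff ℝ (⊤ : ℕ∞) fun p : CSpace n × CSpace n => mul p.1 p.2
  smooth_inv : ContDiff ℝ (⊤ : ℕ∞) inv
  mul_assoc' : ∀ a b c, mul (mul a b) c = mul a (mul b c)
  one_mul' : ∀ a, mul one a = a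
  mul_one' : ∀ a, mul a one = a
  inv_mul' : ∀ a, mul (inv a) a = one
  /-- the left-invariant basis of the `k`-th layer -/
  X : (k : ℕ) → Fin (m k) → CSpace n → CSpace n
  smooth_X : ∀ k i, ContDiff ℝ (⊤ : ℕ∞) (X k i)
  left_invariant_X : ∀ k i g p, X k i (mul g p) = fderiv ℝ (mul g) p (X k i p)
  /-- all the basis fields together form a basis of the Lie algebra -/
  indep_X : LinearIndependent ℝ fun z : Σ k : Fin (r + 1), Fin (m k.1) => X z.1 z.2 one
  /-- stratification: `[V¹, Vᵏ] ⊆ V^{k+1}` for `1 ≤ k < r` -/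
  bracket_mem : ∀ k, 1 ≤ k → k < r → ∀ (i : Fin (m 1)) (j : Fin (m k)),
    vbracket (X 1 i) (X k j) ∈ Submodule.span ℝ (Set.range (X (k + 1)))
  /-- stratification: `V^{k+1} ⊆ [V¹, Vᵏ]` for `1 ≤ k < r` -/
  bracket_span : ∀ k, 1 ≤ k → k < r →
    Submodule.span ℝ (Set.range (X (k + 1))) ≤
      Submodule.span ℝ (Set.range fun z : Fin (m 1) × Fin (m k) =>
        vbracket (X 1 z.1) (X k z.2))
  /-- `[V¹, Vʳ] = 0`: the last layer is central -/
  bracket_top : ∀ (i : Fin (m 1)) (j : Fin (m r)), vbracket (X 1 i) (X r j) = 0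
  /-- the one-parameter subgroup `t ↦ exp (t X_{k,i})` -/
  expMap : (k : ℕ) → Fin (m k) → ℝ → CSpace n
  expMap_zero : ∀ k i, expMap k i 0 = one
  expMap_flow : ∀ k i p t,
    HasDerivAt (fun s => mul p (expMap k i s)) (X k i (mul p (expMap k i t))) t
  /-- the homogeneous gauge pseudo-distance -/
  gauge : CSpace n → CSpace n → ℝ
  gauge_nonneg : ∀ p q, 0 ≤ gauge p q
  gauge_eq_zero : ∀ p q, gauge p q = 0 ↔ p = q

/-- The `L²` norm (valued in `ℝ≥0∞`) of a function over a set `s`. -/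
def L2 {n : ℕ} (s : Set (CSpace n)) (f : CSpace n → ℝ) : ℝ≥0∞ :=
  eLpNorm f 2 (volume.restrict s)

/-- A test function on `Ω`: smooth with compact support contained in `Ω`. -/
def IsTest {n : ℕ} (Ω : Set (CSpace n)) (φ : CSpace n → ℝ) : Prop :=
  ContDiff ℝ (⊤ : ℕ∞) φ ∧ HasCompactSupport φ ∧ tsupport φ ⊆ Ω

/-- `g` is the weak derivative of `f` along the vector field `Z` on `Ω`
(left-invariant vector fields on a Carnot group are divergence free, so no
divergence term appears in the integration by parts). -/
def IsWeakDerivVF {n : ℕ} (Ω : Set (CSpace n)) (Z : CSpace n → CSpace n)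
    (f g : CSpace n → ℝ) : Prop :=
  ∀ φ, IsTest Ω φ → ∫ p in Ω, g p * φ p = -∫ p in Ω, f p * Dvf Z φ p

/-- `f ∈ L^p_{loc}(Ω)`. -/
def MemLploc {n : ℕ} (p : ℝ≥0∞) (Ω : Set (CSpace n)) (f : CSpace n → ℝ) : Prop :=
  ∀ K, K ⊆ Ω → IsCompact K →
    AEStronglyMeasurable f (volume.restrict K) ∧ eLpNorm f p (volume.restrict K) < ⊤

/-- `f ∈ L²_{loc}(Ω)`. -/
def MemL2loc {n : ℕ} (Ω : Set (CSpace n)) (f : CSpace n → ℝ) : Prop :=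
  MemLploc 2 Ω f

namespace CarnotGroup

variable {r n N : ℕ} (G : CarnotGroup r n)

/-- Differentiation along the left-invariant vector field `X_{k,i}`. -/
def D (k : ℕ) (i : Fin (G.m k)) (f : CSpace n → ℝ) : CSpace n → ℝ :=
  fun p => fderiv ℝ f p (G.X k i p)

/-- Iterated differentiation within the single layer `V^k`; the list records
the directions in order of application (head applied first, i.e. innermost). -/
def Dlayer (k : ℕ) (L : List (Fin (G.m k))) (f : CSpace n → ℝ) : CSpace n → ℝ :=
  L.foldl (fun g i => G.D k i g) f

/-- `X^{I_k} X^{I_{k+1}} ⋯ X^{I_r}`: iterated differentiation along layers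
`k, …, r` (the layer-`r` block acting first, the layer-`k` block outermost). -/
def DIfrom (I : (k : ℕ) → List (Fin (G.m k))) (k : ℕ) (f : CSpace n → ℝ) :
    CSpace n → ℝ :=
  (List.range' k (r + 1 - k)).foldr (fun j g => G.Dlayer j (I j) g) f

/-- Iterated differentiation along an arbitrary finite string of
(layer, index) pairs, in order of application. -/
def Dlist (L : List ((k : Fin (r + 1)) × Fin (G.m k.1))) (f : CSpace n → ℝ) :
    CSpace n → ℝ :=
  L.foldl (fun g z => G.D z.1 z.2 g) f

/-- The gauge pseudo-ball. -/
def ball (p₀ : CSpace n) (R : ℝ) : Set (CSpace n) := {p | G.gauge p₀ p < R}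

/-- The homogeneous dimension `Q = ∑ k · m_k`. -/
def homDim : ℕ := ∑ k ∈ Finset.range (r + 1), k * G.m k

/-- `S^{1,2}` norm over `s` of `u`, computed with (weak) horizontal Jacobian `Du`. -/
def S12 (s : Set (CSpace n)) (u : Fin N → CSpace n → ℝ)
    (Du : Fin N → Fin (G.m 1) → CSpace n → ℝ) : ℝ≥0∞ :=
  (∑ β, L2 s (u β)) + ∑ β, ∑ i, L2 s (Du β i)

/-- `S^{1,2}` norm over `s` of a pointwise differentiable function, computed
with classical horizontal derivatives. -/
def S12s (s : Set (CSpace n)) (v : Fin N → CSpace n → ℝ) : ℝ≥0∞ :=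
  (∑ β, L2 s (v β)) + ∑ β, ∑ i, L2 s (G.D 1 i (v β))

/-- `u ∈ S^{1,2}_{loc}(Ω; ℝ^N)`, with weak horizontal Jacobian `Du`. -/
def MemS12loc (Ω : Set (CSpace n)) (u : Fin N → CSpace n → ℝ)
    (Du : Fin N → Fin (G.m 1) → CSpace n → ℝ) : Prop :=
  (∀ β, MemL2loc Ω (u β)) ∧
  (∀ β i, IsWeakDerivVF Ω (G.X 1 i) (u β) (Du β i)) ∧
  (∀ β i, MemL2loc Ω (Du β i))

/-- Coercivity (strong ellipticity along the horizontal directions) of the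
constant coefficients `A` with ellipticity constant `lam`. -/
def Coercive (lam : ℝ) (A : Fin N → Fin N → Fin (G.m 1) → Fin (G.m 1) → ℝ) : Prop :=
  ∀ ξ : Fin N → Fin (G.m 1) → ℝ,
    lam * ∑ α, ∑ i, (ξ α i) ^ 2 ≤ ∑ α, ∑ β, ∑ i, ∑ j, A α β i j * ξ α i * ξ β j

/-- `u` (with weak horizontal Jacobian `Du`) is a weak solution on `Ω` of the
constant coefficient system (1.1):
`∑_β ∑_{i,j} X_i (A_{ij}^{αβ} X_j u^β + f_i^α) = f^α`, `α = 1, …, N`. -/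
def IsWeakSolution (Ω : Set (CSpace n))
    (A : Fin N → Fin N → Fin (G.m 1) → Fin (G.m 1) → ℝ)
    (u : Fin N → CSpace n → ℝ) (Du : Fin N → Fin (G.m 1) → CSpace n → ℝ)
    (f : Fin N → CSpace n → ℝ) (fi : Fin N → Fin (G.m 1) → CSpace n → ℝ) : Prop :=
  ∀ α, ∀ φ, IsTest Ω φ →
    ∑ β, ∑ i, ∑ j, ∫ p in Ω, (A α β i j * Du β j p + fi α i p) * G.D 1 i φ p
      = ∫ p in Ω, f α p * φ p

/-- The sum of the `L²(s)` norms of all iterated derivatives of `f` of order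
at most `M`, along every layer (used to formalize the "collections of higher
order derivatives of the data" `f̃`, `f̃_i`). -/
def dataSum (M : ℕ) (s : Set (CSpace n)) (f : CSpace n → ℝ) : ℝ≥0∞ :=
  ∑ c : Fin M → Option ((k : Fin (r + 1)) × Fin (G.m k.1)),
    L2 s (G.Dlist ((List.finRange M).filterMap c) f)

end CarnotGroup

namespace Hypoelliptic

open Filter Topology Asymptotics

/-! ### The `L²` seminorm -/

/-- The real-valued `L²` seminorm. -/
def nrm {n : ℕ} (μ : Measure (CSpace n)) (f : CSpace n → ℝ) : ℝ := (eLpNorm f 2 μ).toReal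

section Nrm

variable {n : ℕ} {μ : Measure (CSpace n)} {f g : CSpace n → ℝ}

lemma nrm_nonneg : 0 ≤ nrm μ f := toReal_nonneg

lemma nrm_add_le (hf : MemLp f 2 μ) (hg : MemLp g 2 μ) :
    nrm μ (fun x => f x + g x) ≤ nrm μ f + nrm μ g := by
  unfold nrm
  rw [← toReal_add hf.eLpNorm_ne_top hg.eLpNorm_ne_top]
  exact toReal_mono (add_ne_top.2 ⟨hf.eLpNorm_ne_top, hg.eLpNorm_ne_top⟩)
    (eLpNorm_add_le hf.1 hg.1 (by norm_num))

lemma nrm_sub_le (hf : MemLp f 2 μ) (hg : MemLp g 2 μ) :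
    nrm μ (fun x => f x - g x) ≤ nrm μ f + nrm μ g := by
  unfold nrm
  rw [← toReal_add hf.eLpNorm_ne_top hg.eLpNorm_ne_top]
  exact toReal_mono (add_ne_top.2 ⟨hf.eLpNorm_ne_top, hg.eLpNorm_ne_top⟩)
    (eLpNorm_sub_le hf.1 hg.1 (by norm_num))

lemma nrm_le_mul {c : ℝ} (hg : MemLp g 2 μ) (hc : 0 ≤ c)
    (h : ∀ᵐ x ∂μ, |f x| ≤ c * |g x|) : nrm μ f ≤ c * nrm μ g := by
  have := eLpNorm_le_mul_eLpNorm_of_ae_le_mul (f := f) (g := g) (c := c) h 2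
  unfold nrm
  refine (toReal_mono (mul_ne_top ofReal_ne_top hg.eLpNorm_ne_top) this).trans ?_
  rw [toReal_mul, toReal_ofReal hc]

lemma nrm_mono (hg : MemLp g 2 μ) (h : ∀ᵐ x ∂μ, |f x| ≤ |g x|) : nrm μ f ≤ nrm μ g := by
  simpa using nrm_le_mul hg zero_le_one (by simpa using h)

lemma nrm_const_mul (c : ℝ) : nrm μ (fun x => c * f x) = |c| * nrm μ f := by
  unfold nrm
  have := eLpNorm_const_smul c f 2 μ
  rw [show (fun x => c * f x) = c • f from rfl, this, toReal_mul]
  simp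

lemma nrm_sq (hf : MemLp f 2 μ) : nrm μ f ^ 2 = ∫ x, f x ^ 2 ∂μ := by
  have h1 := hf.eLpNorm_eq_integral_rpow_norm (by norm_num) (by norm_num)
  unfold nrm
  rw [h1, toReal_ofReal (by positivity), ← Real.rpow_natCast, ← Real.rpow_mul (by positivity)]
  simp

lemma abs_integral_mul_le (hf : MemLp f 2 μ) (hg : MemLp g 2 μ) :
    |∫ x, f x * g x ∂μ| ≤ nrm μ f * nrm μ g := by
  have h1 : ∀ a b : ℝ, 2 * a * b * ∫ x, f x * g x ∂μ ≤
      a ^ 2 * nrm μ f ^ 2 + b ^ 2 * nrm μ g ^ 2 := by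
    intro a b
    have hfg : Integrable (fun x => f x * g x) μ := hf.integrable_mul hg
    have h2 : 0 ≤ ∫ x, (a * f x - b * g x) ^ 2 ∂μ := integral_nonneg fun x => sq_nonneg _
    have h3 : ∫ x, (a * f x - b * g x) ^ 2 ∂μ =
        a ^ 2 * (∫ x, f x ^ 2 ∂μ) - 2 * a * b * (∫ x, f x * g x ∂μ)
          + b ^ 2 * ∫ x, g x ^ 2 ∂μ := by
      rw [← integral_const_mul, ← integral_const_mul, ← integral_const_mul, ← integral_sub,
        ← integral_add]
      · congr 1; ext x; ring
      · exact (hf.integrable_sq.const_mul _).sub (hfg.const_mul _)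
      · exact hg.integrable_sq.const_mul _
      · exact hf.integrable_sq.const_mul _
      · exact hfg.const_mul _
    rw [nrm_sq hf, nrm_sq hg]
    linarith
  set F := nrm μ f
  set H := nrm μ g
  have hF : 0 ≤ F := nrm_nonneg
  have hH : 0 ≤ H := nrm_nonneg
  set I := ∫ x, f x * g x ∂μ
  rcases hF.eq_or_lt with h0 | h0
  · rw [← h0]
    have hI : I = 0 := by
      by_contra hne
      have := h1 ((H ^ 2 + 1) / I) 1
      have e : 2 * ((H ^ 2 + 1) / I) * 1 * I = 2 * (H ^ 2 + 1) := by field_simp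
      rw [← h0, e] at this
      nlinarith
    simp [hI]
  rcases hH.eq_or_lt with h0' | h0'
  · rw [← h0']
    have hI : I = 0 := by
      by_contra hne
      have := h1 1 ((F ^ 2 + 1) / I)
      have e : 2 * 1 * ((F ^ 2 + 1) / I) * I = 2 * (F ^ 2 + 1) := by field_simp
      rw [← h0', e] at this
      nlinarith
    simp [hI]
  rw [abs_le]
  have hp : 0 < F * H := mul_pos h0 h0'
  constructor
  · have := h1 H (-F)
    have h4 : 2 * (F * H) * (-(F * H)) ≤ 2 * (F * H) * I := by nlinarith
    exact le_of_mul_le_mul_left h4 (by linarith)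
  · have := h1 H F
    have h4 : 2 * (F * H) * I ≤ 2 * (F * H) * (F * H) := by nlinarith
    exact le_of_mul_le_mul_left h4 (by linarith)

end Nrm

/-! ### Test functions supported in balls centred at the origin -/

/-- Smooth functions supported in the closed ball of radius `ρ` about the origin. -/
def TF {n : ℕ} (ρ : ℝ) (f : CSpace n → ℝ) : Prop :=
  ContDiff ℝ (⊤ : ℕ∞) f ∧ ∀ x, f x ≠ 0 → ‖x‖ ≤ ρ

section TF

variable {n : ℕ} {ρ : ℝ} {f g : CSpace n → ℝ}

lemma contDiff_dvf {Z : CSpace n → CSpace n} (hZ : ContDiff ℝ (⊤ : ℕ∞) Z)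
    (hf : ContDiff ℝ (⊤ : ℕ∞) f) : ContDiff ℝ (⊤ : ℕ∞) (Dvf Z f) := by
  unfold Dvf
  exact (hf.fderiv_right (m := (⊤ : ℕ∞)) (by simp)).clm_apply hZ

lemma TF.tsupport_subset (hf : TF ρ f) : tsupport f ⊆ Metric.closedBall 0 ρ :=
  closure_minimal (fun x hx => by simpa using hf.2 x hx) Metric.isClosed_closedBall

lemma TF.hasCompactSupport (hf : TF ρ f) : HasCompactSupport f :=
  (isCompact_closedBall (0 : CSpace n) ρ).of_isClosed_subset (isClosed_tsupport f)
    hf.tsupport_subset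

lemma TF.memLp (hf : TF ρ f) {p : ℝ≥0∞} : MemLp f p volume :=
  hf.1.continuous.memLp_of_hasCompactSupport hf.hasCompactSupport

lemma TF.integrable (hf : TF ρ f) : Integrable f :=
  hf.1.continuous.integrable_of_hasCompactSupport hf.hasCompactSupport

lemma TF.mono {ρ' : ℝ} (hf : TF ρ f) (h : ρ ≤ ρ') : TF ρ' f :=
  ⟨hf.1, fun x hx => (hf.2 x hx).trans h⟩

lemma TF.add (hf : TF ρ f) (hg : TF ρ g) : TF ρ (fun x => f x + g x) := by
  refine ⟨hf.1.add hg.1, fun x hx => ?_⟩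
  by_cases h : f x = 0
  · exact hg.2 x (by simpa [h] using hx)
  · exact hf.2 x h

lemma TF.mul_left (hf : TF ρ f) (hg : ContDiff ℝ (⊤ : ℕ∞) g) : TF ρ (fun x => g x * f x) :=
  ⟨hg.mul hf.1, fun x hx => hf.2 x (right_ne_zero_of_mul hx)⟩

lemma TF.const_mul (hf : TF ρ f) (c : ℝ) : TF ρ (fun x => c * f x) :=
  hf.mul_left contDiff_const

lemma TF.sub (hf : TF ρ f) (hg : TF ρ g) : TF ρ (fun x => f x - g x) := by
  have := hf.add (hg.const_mul (-1))
  simpa [sub_eq_add_neg] using this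

lemma TF.dvf (hf : TF ρ f) {Z : CSpace n → CSpace n} (hZ : ContDiff ℝ (⊤ : ℕ∞) Z) :
    TF ρ (Dvf Z f) := by
  refine ⟨contDiff_dvf hZ hf.1, fun x hx => ?_⟩
  have : x ∈ tsupport f := by
    by_contra h
    apply hx
    have h2 : fderiv ℝ f x = 0 := by
      by_contra h3
      exact h (support_fderiv_subset ℝ h3)
    simp [Dvf, h2]
  simpa using hf.tsupport_subset this

end TF

/-! ### Vector fields -/

section VF

variable {n : ℕ} {ρ : ℝ} {f g : CSpace n → ℝ} {Z Y : CSpace n → CSpace n}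

/-- The divergence of a vector field. -/
def dvg (Z : CSpace n → CSpace n) : CSpace n → ℝ :=
  fun p => ∑ k, fderiv ℝ (fun q => Z q k) p (EuclideanSpace.single k 1)

lemma contDiff_coord (hZ : ContDiff ℝ (⊤ : ℕ∞) Z) (k : Fin n) :
    ContDiff ℝ (⊤ : ℕ∞) (fun q => Z q k) := by
  fun_prop

lemma contDiff_dvg (hZ : ContDiff ℝ (⊤ : ℕ∞) Z) : ContDiff ℝ (⊤ : ℕ∞) (dvg Z) := by
  unfold dvg
  refine ContDiff.sum fun k _ => ?_
  exact ((contDiff_coord hZ k).fderiv_right (m := (⊤ : ℕ∞)) (by simp)).clm_apply contDiff_const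

lemma clm_eq_sum (T : CSpace n →L[ℝ] ℝ) (v : CSpace n) :
    T v = ∑ k, v k * T (EuclideanSpace.single k 1) := by
  conv_lhs => rw [← (EuclideanSpace.basisFun (Fin n) ℝ).sum_repr v]
  simp

lemma dvf_mul (hf : DifferentiableAt ℝ f x) (hg : DifferentiableAt ℝ g x) :
    Dvf Z (fun x => f x * g x) x = Dvf Z f x * g x + f x * Dvf Z g x := by
  simp only [Dvf]
  rw [fderiv_fun_mul hf hg]
  simp; ring

lemma dvf_add (hf : DifferentiableAt ℝ f x) (hg : DifferentiableAt ℝ g x) :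
    Dvf Z (fun x => f x + g x) x = Dvf Z f x + Dvf Z g x := by
  simp only [Dvf]
  rw [fderiv_fun_add hf hg]
  simp

lemma dvf_sum {ι : Type*} (s : Finset ι) {F : ι → CSpace n → ℝ} {x : CSpace n}
    (hF : ∀ i ∈ s, DifferentiableAt ℝ (F i) x) :
    Dvf Z (fun x => ∑ i ∈ s, F i x) x = ∑ i ∈ s, Dvf Z (F i) x := by
  simp only [Dvf]
  rw [fderiv_fun_sum hF]
  simp

/-- Integration by parts along a vector field. -/
lemma integral_mul_dvf (hZ : ContDiff ℝ (⊤ : ℕ∞) Z) (hf : ContDiff ℝ (⊤ : ℕ∞) f)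
    (hg : ContDiff ℝ (⊤ : ℕ∞) g) (hc : HasCompactSupport g) :
    ∫ x, f x * Dvf Z g x = -∫ x, (Dvf Z f x + dvg Z x * f x) * g x := by
  have hne : ((⊤ : ℕ∞) : WithTop ℕ∞) ≠ 0 := by simp
  have hd : ∀ {h : CSpace n → ℝ}, ContDiff ℝ (⊤ : ℕ∞) h → ∀ x, DifferentiableAt ℝ h x :=
    fun hh x => (hh.differentiable hne) x
  have hder : ∀ {h : CSpace n → ℝ} (e : CSpace n), ContDiff ℝ (⊤ : ℕ∞) h →
      ContDiff ℝ (⊤ : ℕ∞) (fun x => fderiv ℝ h x e) := fun e hh =>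
    (hh.fderiv_right (m := (⊤ : ℕ∞)) (by simp)).clm_apply contDiff_const
  have key : ∀ k : Fin n, ∫ x, (f x * Z x k) * fderiv ℝ g x (EuclideanSpace.single k 1) =
      -∫ x, fderiv ℝ (fun y => f y * Z y k) x (EuclideanSpace.single k 1) * g x := by
    intro k
    have hfz : ContDiff ℝ (⊤ : ℕ∞) (fun y => f y * Z y k) := hf.mul (contDiff_coord hZ k)
    apply integral_mul_fderiv_eq_neg_fderiv_mul_of_integrable
    · exact ((hder _ hfz).continuous.mul hg.continuous).integrable_of_hasCompactSupport
        hc.mul_left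
    · refine (hfz.continuous.mul (hder _ hg).continuous).integrable_of_hasCompactSupport ?_
      exact (hc.fderiv_apply ℝ (EuclideanSpace.single k 1)).mul_left
    · exact (hfz.continuous.mul hg.continuous).integrable_of_hasCompactSupport hc.mul_left
    · exact fun x _ => hd hfz x
    · exact fun x _ => hd hg x
  have e1 : ∀ x, f x * Dvf Z g x =
      ∑ k, (f x * Z x k) * fderiv ℝ g x (EuclideanSpace.single k 1) := by
    intro x
    simp only [Dvf]
    rw [clm_eq_sum, Finset.mul_sum]
    exact Finset.sum_congr rfl fun k _ => by ring
  have e2 : ∀ x, (Dvf Z f x + dvg Z x * f x) * g x =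
      ∑ k, fderiv ℝ (fun y => f y * Z y k) x (EuclideanSpace.single k 1) * g x := by
    intro x
    simp only [Dvf, dvg]
    rw [clm_eq_sum, ← Finset.sum_mul]
    congr 1
    rw [Finset.sum_mul, ← Finset.sum_add_distrib]
    refine Finset.sum_congr rfl fun k _ => ?_
    rw [fderiv_fun_mul (hd hf x) (hd (contDiff_coord hZ k) x)]
    simp; ring
  simp_rw [e1, e2]
  rw [integral_finsetSum, integral_finsetSum, ← Finset.sum_neg_distrib]
  · exact Finset.sum_congr rfl fun k _ => key k
  · intro k _
    have hfz : ContDiff ℝ (⊤ : ℕ∞) (fun y => f y * Z y k) := hf.mul (contDiff_coord hZ k)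
    exact ((hder _ hfz).continuous.mul hg.continuous).integrable_of_hasCompactSupport
        hc.mul_left
  · intro k _
    have hfz : ContDiff ℝ (⊤ : ℕ∞) (fun y => f y * Z y k) := hf.mul (contDiff_coord hZ k)
    refine (hfz.continuous.mul (hder _ hg).continuous).integrable_of_hasCompactSupport ?_
    exact (hc.fderiv_apply ℝ (EuclideanSpace.single k 1)).mul_left

lemma dvf_dvf (hY : ContDiff ℝ (⊤ : ℕ∞) Y) (hf : ContDiff ℝ (⊤ : ℕ∞) f) (x : CSpace n) :
    Dvf Z (Dvf Y f) x = fderiv ℝ (fderiv ℝ f) x (Z x) (Y x) + fderiv ℝ f x (fderiv ℝ Y x (Z x)) := by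
  have hne : ((⊤ : ℕ∞) : WithTop ℕ∞) ≠ 0 := by simp
  have h1 : DifferentiableAt ℝ (fderiv ℝ f) x :=
    (hf.fderiv_right (m := (⊤ : ℕ∞)) (by simp)).differentiable hne x
  have h2 := h1.hasFDerivAt.clm_apply ((hY.differentiable hne) x).hasFDerivAt
  unfold Dvf
  rw [h2.fderiv]
  simp [add_comm]

/-- The commutator of the derivations along two vector fields. -/
lemma dvf_vbracket (hZ : ContDiff ℝ (⊤ : ℕ∞) Z) (hY : ContDiff ℝ (⊤ : ℕ∞) Y)
    (hf : ContDiff ℝ (⊤ : ℕ∞) f) (x : CSpace n) :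
    Dvf (vbracket Z Y) f x = Dvf Z (Dvf Y f) x - Dvf Y (Dvf Z f) x := by
  rw [dvf_dvf hY hf, dvf_dvf hZ hf]
  have hs : IsSymmSndFDerivAt ℝ f x :=
    (hf.of_le (m := 2) (WithTop.coe_le_coe.2 le_top)).contDiffAt.isSymmSndFDerivAt (by simp)
  rw [hs.eq (Z x) (Y x)]
  simp [Dvf, vbracket]

end VF

/-! ### Uniform bounds on balls -/

lemma exists_bound_closedBall {E F : Type*} [NormedAddCommGroup E] [ProperSpace E]
    [NormedAddCommGroup F] {f : E → F} (hf : Continuous f) (c : E) (ρ : ℝ) :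
    ∃ C : ℝ, 0 < C ∧ ∀ x, ‖x - c‖ ≤ ρ → ‖f x‖ ≤ C := by
  obtain ⟨C, hC⟩ := (isCompact_closedBall c ρ).exists_bound_of_continuousOn hf.continuousOn
  exact ⟨max C 1, by positivity, fun x hx =>
    (hC x (by simpa [dist_eq_norm] using hx)).trans (le_max_left _ _)⟩

lemma exists_lipschitz_fst {E E' F : Type*} [NormedAddCommGroup E] [NormedSpace ℝ E]
    [ProperSpace E] [NormedAddCommGroup E'] [NormedSpace ℝ E'] [ProperSpace E']
    [NormedAddCommGroup F] [NormedSpace ℝ F] {f : E × E' → F} (hf : ContDiff ℝ (⊤ : ℕ∞) f)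
    (c : E) (a ρ : ℝ) : ∃ C : ℝ, 0 < C ∧ ∀ x y, ‖x - c‖ ≤ a → ‖y‖ ≤ ρ →
      ‖f (x, y) - f (c, y)‖ ≤ C * ‖x - c‖ := by
  have hne : ((⊤ : ℕ∞) : WithTop ℕ∞) ≠ 0 := by simp
  have hcont : Continuous (fderiv ℝ f) :=
    (hf.fderiv_right (m := (⊤ : ℕ∞)) (by simp)).continuous
  obtain ⟨C, hC⟩ := ((isCompact_closedBall c a).prod
    (isCompact_closedBall (0 : E') ρ)).exists_bound_of_continuousOn hcont.continuousOn
  refine ⟨max C 1, by positivity, fun x y hx hy => ?_⟩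
  have := (convex_closedBall c a).prod (convex_closedBall (0 : E') ρ) |>.norm_image_sub_le_of_norm_fderiv_le
    (f := f) (𝕜 := ℝ) (C := max C 1) (x := (c, y)) (y := (x, y))
    (fun z _ => hf.differentiable hne z) (fun z hz => (hC z hz).trans (le_max_left _ _))
    ⟨by simpa using (norm_nonneg _).trans hx, by simpa using hy⟩
    ⟨by simpa [dist_eq_norm] using hx, by simpa using hy⟩
  simpa using this

/-! ### Group structure and translations -/

section Group

variable {r n : ℕ} (G : CarnotGroup r n)

lemma mul_inv' (a : CSpace n) : G.mul a (G.inv a) = G.one := by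
  have h : G.mul (G.inv (G.inv a)) (G.mul (G.inv a) (G.mul a (G.inv a))) = G.one := by
    rw [← G.mul_assoc' (G.inv a), G.inv_mul', G.one_mul', G.inv_mul']
  rwa [← G.mul_assoc', G.inv_mul', G.one_mul'] at h

lemma inv_mul_cancel_left' (a b : CSpace n) : G.mul (G.inv a) (G.mul a b) = b := by
  rw [← G.mul_assoc', G.inv_mul', G.one_mul']

lemma mul_inv_cancel_left' (a b : CSpace n) : G.mul a (G.mul (G.inv a) b) = b := by
  rw [← G.mul_assoc', mul_inv', G.one_mul']

lemma inv_mul_cancel_right' (a b : CSpace n) : G.mul (G.mul a (G.inv b)) b = a := by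
  rw [G.mul_assoc', G.inv_mul', G.mul_one']

lemma mul_inv_cancel_right' (a b : CSpace n) : G.mul (G.mul a b) (G.inv b) = a := by
  rw [G.mul_assoc', mul_inv', G.mul_one']

lemma inv_one' : G.inv G.one = G.one := by
  rw [← G.mul_one' (G.inv G.one), G.inv_mul']

lemma contDiff_mul {F : Type*} [NormedAddCommGroup F] [NormedSpace ℝ F] {f g : F → CSpace n}
    (hf : ContDiff ℝ (⊤ : ℕ∞) f) (hg : ContDiff ℝ (⊤ : ℕ∞) g) :
    ContDiff ℝ (⊤ : ℕ∞) (fun x => G.mul (f x) (g x)) :=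
  G.smooth_mul.comp (hf.prodMk hg)

lemma contDiff_inv {F : Type*} [NormedAddCommGroup F] [NormedSpace ℝ F] {f : F → CSpace n}
    (hf : ContDiff ℝ (⊤ : ℕ∞) f) : ContDiff ℝ (⊤ : ℕ∞) (fun x => G.inv (f x)) :=
  G.smooth_inv.comp hf

lemma top_ne_zero : ((⊤ : ℕ∞) : WithTop ℕ∞) ≠ 0 := by simp

lemma contDiff_det {F : Type*} [NormedAddCommGroup F] [NormedSpace ℝ F]
    {A : F → CSpace n →L[ℝ] CSpace n} (hA : ContDiff ℝ (⊤ : ℕ∞) A) :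
    ContDiff ℝ (⊤ : ℕ∞) (fun x => (A x).det) := by
  let b := (EuclideanSpace.basisFun (Fin n) ℝ).toBasis
  have h : ∀ x, (A x).det = ∑ σ : Equiv.Perm (Fin n), (Equiv.Perm.sign σ : ℤ) *
      ∏ i, (A x (EuclideanSpace.single i 1)) (σ i) := by
    intro x
    have h1 : (A x).det = LinearMap.det (A x : CSpace n →ₗ[ℝ] CSpace n) := rfl
    rw [h1, ← LinearMap.det_toMatrix b, Matrix.det_apply']
    refine Finset.sum_congr rfl fun σ _ => ?_
    congr 1
  simp_rw [h]
  refine ContDiff.sum fun σ _ => contDiff_const.mul (contDiff_prod fun i _ => ?_)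
  exact contDiff_euclidean.1 (hA.clm_apply contDiff_const) (σ i)

/-- Change of variables under a diffeomorphism of the whole space. -/
lemma integral_comp_diffeo {φ ψ : CSpace n → CSpace n} (hφ : ContDiff ℝ (⊤ : ℕ∞) φ)
    (h1 : ∀ x, ψ (φ x) = x) (h2 : ∀ x, φ (ψ x) = x) (H : CSpace n → ℝ) :
    ∫ x, H x = ∫ x, |(fderiv ℝ φ x).det| * H (φ x) := by
  have := integral_image_eq_integral_abs_det_fderiv_smul (μ := volume) (s := Set.univ)
    (f := φ) (f' := fun x => fderiv ℝ φ x) MeasurableSet.univ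
    (fun x _ => (hφ.differentiable top_ne_zero x).hasFDerivAt.hasFDerivWithinAt)
    (fun x _ y _ h => by rw [← h1 x, ← h1 y, h]) H
  rw [Set.image_univ_of_surjective fun x => ⟨ψ x, h2 x⟩] at this
  simpa using this

/-- The Jacobian determinant of a right translation. -/
lemma contDiff_fderiv_right : ContDiff ℝ (⊤ : ℕ∞)
    (fun z : CSpace n × CSpace n => fderiv ℝ (fun q => G.mul q z.1) z.2) := by
  have h : ContDiff ℝ (⊤ : ℕ∞)
      (Function.uncurry fun (z : CSpace n × CSpace n) q => G.mul q z.1) :=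
    contDiff_mul G contDiff_snd (contDiff_fst.comp contDiff_fst)
  exact h.fderiv contDiff_snd (m := (⊤ : ℕ∞)) (by simp)

lemma contDiff_fderiv_left : ContDiff ℝ (⊤ : ℕ∞)
    (fun z : CSpace n × CSpace n => fderiv ℝ (fun q => G.mul z.1 q) z.2) := by
  have h : ContDiff ℝ (⊤ : ℕ∞)
      (Function.uncurry fun (z : CSpace n × CSpace n) q => G.mul z.1 q) :=
    contDiff_mul G (contDiff_fst.comp contDiff_fst) contDiff_snd
  exact h.fderiv contDiff_snd (m := (⊤ : ℕ∞)) (by simp)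

/-- If a diffeomorphism has Jacobian at most `4` where `w` lives, composition with the inverse
costs at most a factor `2` in `L²`. -/
lemma nrm_comp_le {ρ ρ' : ℝ} {φ ψ w : CSpace n → _} (hφ : ContDiff ℝ (⊤ : ℕ∞) φ)
    (h1 : ∀ x, ψ (φ x) = x) (h2 : ∀ x, φ (ψ x) = x) (hw : TF ρ w)
    (hw' : TF ρ' (fun x => w (ψ x)))
    (hJ : ∀ x, ‖x‖ ≤ ρ → |(fderiv ℝ φ x).det| ≤ 4) :
    nrm volume (fun x => w (ψ x)) ≤ 2 * nrm volume w := by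
  have h : nrm volume (fun x => w (ψ x)) ^ 2 ≤ (2 * nrm volume w) ^ 2 := by
    rw [nrm_sq hw'.memLp, mul_pow, nrm_sq hw.memLp,
      integral_comp_diffeo hφ h1 h2 (fun x => w (ψ x) ^ 2), ← integral_const_mul]
    simp_rw [h1]
    refine integral_mono_of_nonneg (Filter.Eventually.of_forall fun x => by positivity) ?_ ?_
    · exact (hw.memLp.integrable_sq).const_mul _
    · refine Filter.Eventually.of_forall fun x => ?_
      by_cases hx : w x = 0
      · simp [hx]
      · have := hJ x (hw.2 x hx)
        have h4 : (2 : ℝ) ^ 2 = 4 := by norm_num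
        simp only [h4]
        gcongr
  exact (pow_le_pow_iff_left₀ nrm_nonneg (by have := nrm_nonneg (μ := volume) (f := w); positivity) two_ne_zero).1 h

end Group

/-- Minkowski's integral inequality in `L²`, in the form needed for averages. -/
lemma nrm_integral_le {n : ℕ} {Y : Type*} [MeasurableSpace Y] {ν : Measure Y} [SFinite ν]
    {k : Y → ℝ} {w : Y → CSpace n → ℝ} {P : CSpace n → ℝ} {M : ℝ} (hk : Integrable k ν)
    (hP : MemLp P 2 volume) (hPw : ∀ x, P x = ∫ y, k y * w y x ∂ν)
    (hInt : Integrable (fun z : Y × CSpace n => k z.1 * w z.1 z.2 * P z.2) (ν.prod volume))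
    (hw : ∀ᵐ y ∂ν, k y ≠ 0 → MemLp (w y) 2 volume ∧ nrm volume (w y) ≤ M) (hM : 0 ≤ M) :
    nrm volume P ≤ (∫ y, |k y| ∂ν) * M := by
  have hM0 : 0 ≤ (∫ y, |k y| ∂ν) * M := by
    positivity
  have h1 : nrm volume P ^ 2 ≤ ((∫ y, |k y| ∂ν) * M) * nrm volume P := by
    have e1 : nrm volume P ^ 2 = ∫ y, (∫ x, k y * w y x * P x) ∂ν := by
      rw [nrm_sq hP, integral_integral_swap hInt]
      refine integral_congr_ae (Eventually.of_forall fun x => ?_)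
      simp only [sq]
      rw [integral_mul_const, ← hPw]
    rw [e1, mul_assoc, ← integral_mul_const]
    refine integral_mono_ae hInt.integral_prod_left (hk.abs.mul_const _) ?_
    filter_upwards [hw] with y hwy
    by_cases hy : k y = 0
    · simp [hy]
    have h2 := abs_integral_mul_le (hwy hy).1 hP
    have h3 : ∫ x, k y * w y x * P x = k y * ∫ x, w y x * P x := by
      rw [← integral_const_mul]
      congr 1; ext x; ring
    simp only [h3]
    refine (le_abs_self _).trans ?_
    rw [abs_mul]
    gcongr
    refine h2.trans ?_
    gcongr
    · exact nrm_nonneg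
    · exact (hwy hy).2
  by_contra! hlt
  have h0 := hM0.trans_lt hlt
  nlinarith

section Translation

variable {r n : ℕ} (G : CarnotGroup r n)

/-- Right translations near the identity almost preserve supports and `L²` norms. -/
lemma exists_translation_bound (ρ : ℝ) : ∃ a : ℝ, 0 < a ∧ a ≤ 1 ∧ ∀ g, ‖g - G.one‖ ≤ a →
    ∀ w, TF ρ w → TF (ρ + 1) (fun p => w (G.mul p g)) ∧
      nrm volume (fun p => w (G.mul p g)) ≤ 2 * nrm volume w := by
  obtain ⟨C1, hC1, h1⟩ := exists_lipschitz_fst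
    (f := fun z : CSpace n × CSpace n => G.mul z.2 (G.inv z.1))
    (contDiff_mul G contDiff_snd (contDiff_inv G contDiff_fst)) G.one 1 ρ
  have hdet : ContDiff ℝ (⊤ : ℕ∞) (fun z : CSpace n × CSpace n =>
      (fderiv ℝ (fun q => G.mul q (G.inv z.1)) z.2).det) :=
    contDiff_det ((contDiff_fderiv_right G).comp
      ((contDiff_inv G contDiff_fst).prodMk contDiff_snd))
  obtain ⟨C2, hC2, h2⟩ := exists_lipschitz_fst hdet G.one 1 ρ
  refine ⟨min 1 (min (1 / C1) (1 / C2)), by positivity, min_le_left _ _, ?_⟩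
  intro g hg w hw
  have hg1 : ‖g - G.one‖ ≤ 1 := hg.trans (min_le_left _ _)
  have hg2 : C1 * ‖g - G.one‖ ≤ 1 := by
    have := hg.trans ((min_le_right _ _).trans (min_le_left _ _))
    rw [le_div_iff₀ hC1] at this; linarith
  have hg3 : C2 * ‖g - G.one‖ ≤ 1 := by
    have := hg.trans ((min_le_right _ _).trans (min_le_right _ _))
    rw [le_div_iff₀ hC2] at this; linarith
  have hT : TF (ρ + 1) (fun p => w (G.mul p g)) := by
    refine ⟨hw.1.comp (contDiff_mul G contDiff_id contDiff_const), fun p hp => ?_⟩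
    have h3 := hw.2 _ hp
    have h4 := h1 g (G.mul p g) hg1 h3
    simp only [mul_inv_cancel_right', inv_one', G.mul_one'] at h4
    have h5 : ‖p‖ ≤ ‖p - G.mul p g‖ + ‖G.mul p g‖ := by
      simpa using norm_add_le (p - G.mul p g) (G.mul p g)
    linarith
  refine ⟨hT, ?_⟩
  refine nrm_comp_le (φ := fun q => G.mul q (G.inv g)) (ψ := fun p => G.mul p g)
    (contDiff_mul G contDiff_id contDiff_const) (fun x => inv_mul_cancel_right' G _ _)
    (fun x => mul_inv_cancel_right' G _ _) hw hT fun x hx => ?_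
  have h3 := h2 g x hg1 hx
  have h4 : (fderiv ℝ (fun q => G.mul q (G.inv G.one)) x).det = 1 := by
    simp only [inv_one', G.mul_one', fderiv_fun_id]
    exact LinearMap.det_id
  rw [h4, Real.norm_eq_abs] at h3
  have h5 := abs_le.1 (h3.trans hg3)
  rw [abs_le]
  constructor <;> linarith [h5.1, h5.2]

/-- The `L²` size of the increment of `v` under right translation by `g`. -/
def tdiff (v : CSpace n → ℝ) (g : CSpace n) : ℝ :=
  nrm volume (fun p => v (G.mul p g) - v p)

/-- The horizontal Sobolev norm. -/
def hnorm (v : CSpace n → ℝ) : ℝ := nrm volume v + ∑ i, nrm volume (G.D 1 i v)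

lemma hnorm_nonneg (v : CSpace n → ℝ) : 0 ≤ hnorm G v :=
  add_nonneg nrm_nonneg (Finset.sum_nonneg fun _ _ => nrm_nonneg)

lemma tdiff_one (v : CSpace n → ℝ) : tdiff G v G.one = 0 := by
  simp [tdiff, G.mul_one', nrm]

/-- Quasi-subadditivity of the translation increments on a small neighbourhood of the identity. -/
lemma exists_tdiff_bound (R : ℝ) : ∃ a : ℝ, 0 < a ∧ a ≤ 1 ∧
    (∀ g, ‖g - G.one‖ ≤ a → ∀ v, TF R v → TF (R + 1) (fun p => v (G.mul p g))) ∧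
    (∀ g, ‖g - G.one‖ ≤ a → ∀ v, TF R v →
      nrm volume (fun p => v (G.mul p g)) ≤ 2 * nrm volume v) ∧
    (∀ g h, ‖g - G.one‖ ≤ a → ‖h - G.one‖ ≤ a → ∀ v, TF R v →
      tdiff G v (G.mul g h) ≤ tdiff G v g + 2 * tdiff G v h) ∧
    (∀ g, ‖g - G.one‖ ≤ a → ‖G.inv g - G.one‖ ≤ a → ∀ v, TF R v →
      tdiff G v (G.inv g) ≤ 2 * tdiff G v g) := by
  obtain ⟨a1, h1, h1', H1⟩ := exists_translation_bound G R
  obtain ⟨a2, h2, h2', H2⟩ := exists_translation_bound G (R + 1)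
  have hT : ∀ g, ‖g - G.one‖ ≤ min a1 a2 → ∀ v, TF R v →
      TF (R + 1) (fun p => v (G.mul p g) - v p) := fun g hg v hv =>
    (H1 g (hg.trans (min_le_left _ _)) v hv).1.sub (hv.mono (by linarith))
  refine ⟨min a1 a2, by positivity, (min_le_left _ _).trans h1',
    fun g hg v hv => (H1 g (hg.trans (min_le_left _ _)) v hv).1,
    fun g hg v hv => (H1 g (hg.trans (min_le_left _ _)) v hv).2, ?_, ?_⟩
  · intro g h hg hh v hv
    have hA := H2 g (hg.trans (min_le_right _ _)) _ (hT h hh v hv)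
    have := nrm_add_le (hT g hg v hv).memLp hA.1.memLp
    refine le_trans (le_of_eq ?_) (this.trans (by unfold tdiff; linarith [hA.2]))
    unfold tdiff
    congr 1
    ext p
    rw [← G.mul_assoc']; ring
  · intro g hg hg' v hv
    have hA := H2 (G.inv g) (hg'.trans (min_le_right _ _)) _ (hT g hg v hv)
    refine le_trans (le_of_eq ?_) hA.2
    unfold tdiff
    have := nrm_const_mul (μ := volume) (-1)
      (f := fun p => v (G.mul (G.mul p (G.inv g)) g) - v (G.mul p (G.inv g)))
    simp only [abs_neg, abs_one, one_mul] at this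
    rw [← this]
    congr 1
    ext p
    rw [inv_mul_cancel_right']; ring

lemma exists_tdiff_lipschitz (R : ℝ) {v : CSpace n → ℝ} (hv : TF R v) :
    ∃ a C : ℝ, 0 < a ∧ 0 ≤ C ∧ ∀ g, ‖g - G.one‖ ≤ a → tdiff G v g ≤ C * ‖g - G.one‖ := by
  obtain ⟨a1, h1, h1', H1⟩ := exists_translation_bound G R
  obtain ⟨C, hC, H⟩ := exists_lipschitz_fst
    (f := fun z : CSpace n × CSpace n => v (G.mul z.2 z.1))
    (hv.1.comp (contDiff_mul G contDiff_snd contDiff_fst)) G.one a1 (R + 1)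
  have hI : MemLp ((Metric.closedBall (0 : CSpace n) (R + 1)).indicator fun _ => (1 : ℝ))
      2 volume :=
    memLp_indicator_const 2 Metric.isClosed_closedBall.measurableSet 1
      (Or.inr measure_closedBall_lt_top.ne)
  refine ⟨a1, C * nrm volume ((Metric.closedBall (0 : CSpace n) (R + 1)).indicator
    fun _ => (1 : ℝ)), h1, mul_nonneg hC.le nrm_nonneg, fun g hg => ?_⟩
  rw [mul_right_comm]
  refine nrm_le_mul hI (by positivity) (Eventually.of_forall fun p => ?_)
  by_cases hp : ‖p‖ ≤ R + 1
  · have := H g p hg hp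
    simp only [G.mul_one', Real.norm_eq_abs] at this
    rw [Set.indicator_of_mem (by simpa using hp)]
    simpa using this
  · have e1 : v p = 0 := by
      by_contra h
      exact hp ((hv.2 p h).trans (by linarith))
    have e2 : v (G.mul p g) = 0 := by
      by_contra h
      exact hp ((H1 g hg v hv).1.2 p h)
    rw [e1, e2]
    simp only [sub_zero, abs_zero]
    positivity

end Translation

section Flow

variable {r n : ℕ} (G : CarnotGroup r n)

lemma TF.D {ρ : ℝ} {f : CSpace n → ℝ} (hf : TF ρ f) {k : ℕ} (i : Fin (G.m k)) :
    TF ρ (G.D k i f) :=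
  hf.dvf (G.smooth_X k i)

lemma hasDerivAt_expMap {k : ℕ} (i : Fin (G.m k)) (t : ℝ) :
    HasDerivAt (G.expMap k i) (G.X k i (G.expMap k i t)) t := by
  have := G.expMap_flow k i G.one t
  simpa [G.one_mul'] using this

lemma continuous_expMap {k : ℕ} (i : Fin (G.m k)) : Continuous (G.expMap k i) :=
  continuous_iff_continuousAt.2 fun t => (hasDerivAt_expMap G i t).continuousAt

/-- Right translation along a one-parameter subgroup is controlled by the derivative along it. -/
lemma exists_tdiff_expMap (R : ℝ) (i : Fin (G.m 1)) : ∀ᶠ t in 𝓝[>] (0 : ℝ), ∀ v, TF R v →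
    tdiff G v (G.expMap 1 i t) ≤ 2 * t * nrm volume (G.D 1 i v) := by
  obtain ⟨a, ha, ha', H1, H2, -, -⟩ := exists_tdiff_bound G R
  have hc := continuous_expMap G i
  have h0 : ∀ᶠ t in 𝓝 (0 : ℝ), ‖G.expMap 1 i t - G.one‖ < a := by
    have : Tendsto (fun t => ‖G.expMap 1 i t - G.one‖) (𝓝 0) (𝓝 0) := by
      have h := (hc.sub (continuous_const (y := G.one))).norm.tendsto 0
      simpa [G.expMap_zero] using h
    exact this.eventually (gt_mem_nhds ha)
  obtain ⟨t0, ht0, ht0'⟩ := Metric.eventually_nhds_iff.1 h0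
  filter_upwards [Ioo_mem_nhdsGT ht0] with t ht v hv
  have hsmall : ∀ s ∈ Set.Icc 0 t, ‖G.expMap 1 i s - G.one‖ ≤ a := fun s hs =>
    (ht0' (by rw [Real.dist_eq, sub_zero, abs_of_nonneg hs.1]; linarith [hs.2, ht.2])).le
  have hDv := hv.D G i
  have hT : TF (R + 1) (fun p => v (G.mul p (G.expMap 1 i t)) - v p) :=
    (H1 _ (hsmall t ⟨ht.1.le, le_rfl⟩) v hv).sub (hv.mono (by linarith))
  have hcw : Continuous (fun z : ℝ × CSpace n => G.D 1 i v (G.mul z.2 (G.expMap 1 i z.1))) :=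
    hDv.1.continuous.comp (G.smooth_mul.continuous.comp
      (continuous_snd.prodMk (hc.comp continuous_fst)))
  have hftc : ∀ p, v (G.mul p (G.expMap 1 i t)) - v p =
      ∫ s in Set.Ioc 0 t, 1 * G.D 1 i v (G.mul p (G.expMap 1 i s)) := by
    intro p
    have hd : ∀ s, HasDerivAt (fun s => v (G.mul p (G.expMap 1 i s)))
        (G.D 1 i v (G.mul p (G.expMap 1 i s))) s := fun s =>
      (hv.1.differentiable top_ne_zero _).hasFDerivAt.comp_hasDerivAt s (G.expMap_flow 1 i p s)
    have hcont : Continuous (fun s => G.D 1 i v (G.mul p (G.expMap 1 i s))) :=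
      hcw.comp (continuous_id.prodMk continuous_const)
    have := intervalIntegral.integral_eq_sub_of_hasDerivAt (fun s _ => hd s)
      (hcont.intervalIntegrable 0 t)
    rw [intervalIntegral.integral_of_le ht.1.le] at this
    simp only [one_mul, this, G.expMap_zero, G.mul_one']
  have := nrm_integral_le (ν := volume.restrict (Set.Ioc 0 t)) (k := fun _ => (1 : ℝ))
    (w := fun s p => G.D 1 i v (G.mul p (G.expMap 1 i s)))
    (P := fun p => v (G.mul p (G.expMap 1 i t)) - v p) (M := 2 * nrm volume (G.D 1 i v))
    (integrable_const _) hT.memLp hftc ?_ ?_ (mul_nonneg zero_le_two nrm_nonneg)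
  · refine this.trans (le_of_eq ?_)
    simp [ht.1.le]
    ring
  · have hF : Continuous (fun z : ℝ × CSpace n =>
        (1 : ℝ) * G.D 1 i v (G.mul z.2 (G.expMap 1 i z.1)) *
          (v (G.mul z.2 (G.expMap 1 i t)) - v z.2)) :=
      (continuous_const.mul hcw).mul (hT.1.continuous.comp continuous_snd)
    have h1 : IntegrableOn (fun z : ℝ × CSpace n =>
        (1 : ℝ) * G.D 1 i v (G.mul z.2 (G.expMap 1 i z.1)) *
          (v (G.mul z.2 (G.expMap 1 i t)) - v z.2))
        (Set.Icc 0 t ×ˢ Metric.closedBall 0 (R + 1)) (volume.prod volume) :=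
      hF.continuousOn.integrableOn_compact (isCompact_Icc.prod (isCompact_closedBall _ _))
    have h2 := h1.of_forall_sdiff_eq_zero (t := Set.Icc 0 t ×ˢ Set.univ)
      (measurableSet_Icc.prod MeasurableSet.univ) (fun z hz => ?_)
    · have h3 := h2.mono_set (s := Set.Ioc 0 t ×ˢ Set.univ)
        (Set.prod_mono Set.Ioc_subset_Icc_self subset_rfl)
      rwa [IntegrableOn, ← Measure.prod_restrict, Measure.restrict_univ] at h3
    · have h4 : ¬ ‖z.2‖ ≤ R + 1 := by
        intro h
        exact hz.2 ⟨hz.1.1, by simpa using h⟩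
      have h5 : v (G.mul z.2 (G.expMap 1 i t)) - v z.2 = 0 := by
        by_contra h
        exact h4 (hT.2 _ h)
      rw [h5, mul_zero]
  · filter_upwards [ae_restrict_mem measurableSet_Ioc] with s hs _
    have h1 := hsmall s ⟨hs.1.le, hs.2⟩
    exact ⟨(H1 _ h1 _ hDv).memLp, H2 _ h1 _ hDv⟩

end Flow

section Calculus

variable {r n : ℕ} (G : CarnotGroup r n)

lemma hasStrictFDerivAt_mul_one : HasStrictFDerivAt (fun z : CSpace n × CSpace n => G.mul z.1 z.2)
    (ContinuousLinearMap.fst ℝ (CSpace n) (CSpace n) +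
      ContinuousLinearMap.snd ℝ (CSpace n) (CSpace n)) (G.one, G.one) := by
  have h : HasStrictFDerivAt (fun z : CSpace n × CSpace n => G.mul z.1 z.2)
      (fderiv ℝ (fun z : CSpace n × CSpace n => G.mul z.1 z.2) (G.one, G.one))
      (G.one, G.one) := G.smooth_mul.contDiffAt.hasStrictFDerivAt top_ne_zero
  have h1 := HasFDerivAt.comp (f := fun x => (x, G.one)) G.one h.hasFDerivAt
    (hasFDerivAt_prodMk_left G.one G.one)
  have h2 := HasFDerivAt.comp (f := fun x => (G.one, x)) G.one h.hasFDerivAt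
    (hasFDerivAt_prodMk_right G.one G.one)
  simp only [Function.comp_def, G.mul_one', G.one_mul'] at h1 h2
  have e1 := h1.unique (hasFDerivAt_id G.one)
  have e2 := h2.unique (hasFDerivAt_id G.one)
  have e : fderiv ℝ (fun z : CSpace n × CSpace n => G.mul z.1 z.2) (G.one, G.one) =
      ContinuousLinearMap.fst ℝ (CSpace n) (CSpace n) +
        ContinuousLinearMap.snd ℝ (CSpace n) (CSpace n) := by
    refine ContinuousLinearMap.ext fun z => ?_
    have h3 := DFunLike.congr_fun e1 z.1
    have h4 := DFunLike.congr_fun e2 z.2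
    simp only [ContinuousLinearMap.comp_apply, ContinuousLinearMap.inl_apply,
      ContinuousLinearMap.inr_apply, ContinuousLinearMap.id_apply] at h3 h4
    have h5 : z = (z.1, 0) + (0, z.2) := by simp
    rw [h5, map_add, h3, h4]
    simp
  rwa [e] at h

lemma hasStrictFDerivAt_inv_one :
    HasStrictFDerivAt G.inv (-ContinuousLinearMap.id ℝ (CSpace n)) G.one := by
  have h : HasStrictFDerivAt G.inv (fderiv ℝ G.inv G.one) G.one :=
    G.smooth_inv.contDiffAt.hasStrictFDerivAt top_ne_zero
  have h1 : HasFDerivAt (fun z : CSpace n × CSpace n => G.mul z.1 z.2)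
      (ContinuousLinearMap.fst ℝ (CSpace n) (CSpace n) +
        ContinuousLinearMap.snd ℝ (CSpace n) (CSpace n)) (G.inv G.one, G.one) := by
    rw [inv_one']; exact (hasStrictFDerivAt_mul_one G).hasFDerivAt
  have h2 := HasFDerivAt.comp (f := fun x => (G.inv x, x)) G.one h1
    (h.hasFDerivAt.prodMk (hasFDerivAt_id G.one))
  simp only [Function.comp_def, G.inv_mul'] at h2
  have e := h2.unique (hasFDerivAt_const G.one G.one)
  have e' : fderiv ℝ G.inv G.one = -ContinuousLinearMap.id ℝ (CSpace n) := by
    refine ContinuousLinearMap.ext fun z => ?_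
    have h3 := DFunLike.congr_fun e z
    simp at h3
    simp [eq_neg_of_add_eq_zero_left h3]
  rwa [e'] at h

lemma hasStrictFDerivAt_mul_inv_one :
    HasStrictFDerivAt (fun z : CSpace n × CSpace n => G.mul z.1 (G.inv z.2))
    (ContinuousLinearMap.fst ℝ (CSpace n) (CSpace n) -
      ContinuousLinearMap.snd ℝ (CSpace n) (CSpace n)) (G.one, G.one) := by
  have h1 : HasStrictFDerivAt (fun z : CSpace n × CSpace n => G.mul z.1 z.2)
    (ContinuousLinearMap.fst ℝ (CSpace n) (CSpace n) +
      ContinuousLinearMap.snd ℝ (CSpace n) (CSpace n)) (G.one, G.inv G.one) := by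
    rw [inv_one']; exact hasStrictFDerivAt_mul_one G
  have h2 := (hasStrictFDerivAt_fst (𝕜 := ℝ) (p := (G.one, G.one))).prodMk
      ((hasStrictFDerivAt_inv_one G).comp (G.one, G.one) hasStrictFDerivAt_snd)
  have h3 := HasStrictFDerivAt.comp (f := fun z : CSpace n × CSpace n => (z.1, G.inv z.2))
    (G.one, G.one) h1 h2
  refine h3.congr_fderiv (ContinuousLinearMap.ext fun z => ?_)
  simp [sub_eq_add_neg]

lemma hasStrictFDerivAt_inv_mul_one :
    HasStrictFDerivAt (fun z : CSpace n × CSpace n => G.mul (G.inv z.1) z.2)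
    (ContinuousLinearMap.snd ℝ (CSpace n) (CSpace n) -
      ContinuousLinearMap.fst ℝ (CSpace n) (CSpace n)) (G.one, G.one) := by
  have h1 : HasStrictFDerivAt (fun z : CSpace n × CSpace n => G.mul z.1 z.2)
    (ContinuousLinearMap.fst ℝ (CSpace n) (CSpace n) +
      ContinuousLinearMap.snd ℝ (CSpace n) (CSpace n)) (G.inv G.one, G.one) := by
    rw [inv_one']; exact hasStrictFDerivAt_mul_one G
  have h2 := ((hasStrictFDerivAt_inv_one G).comp (G.one, G.one)
      hasStrictFDerivAt_fst).prodMk (hasStrictFDerivAt_snd (𝕜 := ℝ) (p := (G.one, G.one)))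
  have h3 := HasStrictFDerivAt.comp (f := fun z : CSpace n × CSpace n => (G.inv z.1, z.2))
    (G.one, G.one) h1 h2
  refine h3.congr_fderiv (ContinuousLinearMap.ext fun z => ?_)
  simp [sub_eq_neg_add]

/-- Second order expansion of a function vanishing on both coordinate axes. -/
lemma mixed_expansion {E F : Type*} [NormedAddCommGroup E] [NormedSpace ℝ E]
    [NormedAddCommGroup F] [NormedSpace ℝ F] {f : E × E → F} (hf : ContDiff ℝ (⊤ : ℕ∞) f)
    (h1 : ∀ x, f (x, 0) = 0) (h2 : ∀ y, f (0, y) = 0) {β : E →L[ℝ] E →L[ℝ] F}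
    (hβ : HasFDerivAt (fun x => (fderiv ℝ f (x, 0)).comp (ContinuousLinearMap.inr ℝ E E)) β 0) :
    (fun z : E × E => f z - β z.1 z.2) =o[𝓝 0] fun z => ‖z.1‖ * ‖z.2‖ := by
  let H : E × E → E →L[ℝ] F := fun z => (fderiv ℝ f z).comp (ContinuousLinearMap.inr ℝ E E)
  have hH : ContDiff ℝ (⊤ : ℕ∞) H :=
    (hf.fderiv_right (m := (⊤ : ℕ∞)) (by simp)).clm_comp contDiff_const
  let K : E × E → E →L[ℝ] E →L[ℝ] F := fun z =>
    (fderiv ℝ H z).comp (ContinuousLinearMap.inl ℝ E E)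
  have hK : Continuous K :=
    ((hH.fderiv_right (m := (⊤ : ℕ∞)) (by simp)).clm_comp contDiff_const).continuous
  have hHx : ∀ x y, HasFDerivAt (fun x => H (x, y)) (K (x, y)) x := fun x y =>
    HasFDerivAt.comp (f := fun x => (x, y)) x
      (hH.differentiable top_ne_zero (x, y)).hasFDerivAt (hasFDerivAt_prodMk_left x y)
  have hfy : ∀ x y, HasFDerivAt (fun y => f (x, y)) (H (x, y)) y := fun x y =>
    HasFDerivAt.comp (f := fun y => (x, y)) y
      (hf.differentiable top_ne_zero (x, y)).hasFDerivAt (hasFDerivAt_prodMk_right x y)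
  have hK0 : K 0 = β := (hHx 0 0).unique hβ
  have hH0 : ∀ y, H (0, y) = 0 := by
    intro y
    have := hfy 0 y
    simp only [h2] at this
    exact this.unique (hasFDerivAt_const _ _)
  rw [Asymptotics.isLittleO_iff]
  intro c hc
  have hev : ∀ᶠ z in 𝓝 (0 : E × E), ‖K z - β‖ < c := by
    have := (Metric.tendsto_nhds (α := E →L[ℝ] E →L[ℝ] F)).1 (hK.tendsto 0) c hc
    filter_upwards [this] with z hz
    rw [hK0] at hz
    exact (dist_eq_norm (K z) β).symm.trans_lt hz
  obtain ⟨δ, hδ, hb⟩ := Metric.eventually_nhds_iff.1 hev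
  filter_upwards [Metric.ball_mem_nhds (0 : E × E) hδ] with z hz
  obtain ⟨x, y⟩ := z
  have hxy : ‖x‖ < δ ∧ ‖y‖ < δ := by simpa [Prod.norm_def] using hz
  have hHb : ∀ η, ‖η‖ < δ → ‖H (x, η) - β x‖ ≤ c * ‖x‖ := by
    intro η hη
    have := (convex_ball (0 : E) δ).norm_image_sub_le_of_norm_hasFDerivWithin_le
      (f := fun x => H (x, η) - β x) (f' := fun ξ => K (ξ, η) - β) (C := c) (x := 0) (y := x)
      (fun ξ _ => ((hHx ξ η).sub β.hasFDerivAt).hasFDerivWithinAt)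
      (fun ξ hξ => (hb (by simpa [Prod.norm_def] using ⟨by simpa using hξ, hη⟩)).le)
      (by simpa using hδ) (by simpa using hxy.1)
    simpa [hH0] using this
  have := (convex_ball (0 : E) δ).norm_image_sub_le_of_norm_hasFDerivWithin_le
      (f := fun y => f (x, y) - β x y) (f' := fun η => H (x, η) - β x) (C := c * ‖x‖)
      (x := 0) (y := y)
      (fun η _ => ((hfy x η).sub (β x).hasFDerivAt).hasFDerivWithinAt)
      (fun η hη => hHb η (by simpa using hη))
      (by simpa using hδ) (by simpa using hxy.2)
  simpa [h1, mul_assoc] using this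

end Calculus

section Reach

variable {r n : ℕ} (G : CarnotGroup r n)

/-- `Z` is reachable at order `k`: there is a curve starting at the identity with velocity `Z`
such that the right translation increments along it are controlled with exponent `1 / k`. -/
def Reach (R : ℝ) (k : ℕ) (Z : CSpace n) : Prop :=
  ∃ (c : ℝ → CSpace n) (C : ℝ), 0 ≤ C ∧ c 0 = G.one ∧ HasDerivWithinAt c Z (Set.Ioi 0) 0 ∧
    ∀ᶠ τ in 𝓝[>] (0 : ℝ), ∀ v, TF R v → tdiff G v (c τ) ≤ C * τ ^ ((1 : ℝ) / k) * hnorm G v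

variable {G}

lemma curve_tendsto {c : ℝ → CSpace n} {Z : CSpace n} (h0 : c 0 = G.one)
    (hc : HasDerivWithinAt c Z (Set.Ioi 0) 0) : Tendsto c (𝓝[>] 0) (𝓝 G.one) := by
  have := hc.continuousWithinAt.tendsto
  rwa [h0] at this

lemma eventually_close {F : Filter ℝ} {c : ℝ → CSpace n} {a : ℝ} (ha : 0 < a)
    (hc : Tendsto c F (𝓝 G.one)) : ∀ᶠ τ in F, ‖c τ - G.one‖ ≤ a := by
  filter_upwards [Metric.tendsto_nhds.1 hc a ha] with τ h
  rw [dist_eq_norm] at h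
  exact h.le

lemma tendsto_mul_one {F : Filter ℝ} {c d : ℝ → CSpace n}
    (hc : Tendsto c F (𝓝 G.one)) (hd : Tendsto d F (𝓝 G.one)) :
    Tendsto (fun t => G.mul (c t) (d t)) F (𝓝 G.one) := by
  have := (G.smooth_mul.continuous.tendsto (G.one, G.one)).comp (hc.prodMk_nhds hd)
  simpa [G.one_mul', Function.comp_def] using this

lemma tendsto_inv_one {F : Filter ℝ} {c : ℝ → CSpace n}
    (hc : Tendsto c F (𝓝 G.one)) : Tendsto (fun t => G.inv (c t)) F (𝓝 G.one) := by
  have := (G.smooth_inv.continuous.tendsto G.one).comp hc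
  simpa [inv_one', Function.comp_def] using this

variable {R : ℝ} {k : ℕ} {Z W : CSpace n}

lemma Reach.zero : Reach G R k 0 :=
  ⟨fun _ => G.one, 0, le_rfl, rfl, hasDerivWithinAt_const _ _ _,
    Eventually.of_forall fun τ v _ => by simp [tdiff_one]⟩

lemma Reach.add (hZ : Reach G R k Z) (hW : Reach G R k W) : Reach G R k (Z + W) := by
  obtain ⟨c, C, hC, c0, hc, H⟩ := hZ
  obtain ⟨d, D, hD, d0, hd, K⟩ := hW
  obtain ⟨a, ha, -, -, -, H1, -⟩ := exists_tdiff_bound G R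
  refine ⟨fun τ => G.mul (c τ) (d τ), C + 2 * D, by positivity, by simp [c0, d0, G.one_mul'],
    ?_, ?_⟩
  · have h1 : HasFDerivAt (fun z : CSpace n × CSpace n => G.mul z.1 z.2)
      (ContinuousLinearMap.fst ℝ (CSpace n) (CSpace n) +
        ContinuousLinearMap.snd ℝ (CSpace n) (CSpace n)) (c 0, d 0) := by
      rw [c0, d0]; exact (hasStrictFDerivAt_mul_one G).hasFDerivAt
    exact (HasFDerivAt.comp_hasDerivWithinAt (f := fun τ => (c τ, d τ)) 0 h1
      (hc.prodMk hd)).congr_deriv (by simp)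
  · filter_upwards [H, K, eventually_close ha (curve_tendsto c0 hc),
      eventually_close ha (curve_tendsto d0 hd)] with τ h1 h2 h3 h4 v hv
    have := H1 _ _ h3 h4 v hv
    have := h1 v hv
    have := h2 v hv
    linarith

lemma Reach.neg (hZ : Reach G R k Z) : Reach G R k (-Z) := by
  obtain ⟨c, C, hC, c0, hc, H⟩ := hZ
  obtain ⟨a, ha, -, -, -, -, H1⟩ := exists_tdiff_bound G R
  refine ⟨fun τ => G.inv (c τ), 2 * C, by positivity, by simp [c0, inv_one'], ?_, ?_⟩
  · have h1 : HasFDerivAt G.inv (-ContinuousLinearMap.id ℝ (CSpace n)) (c 0) := by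
      rw [c0]; exact (hasStrictFDerivAt_inv_one G).hasFDerivAt
    exact (HasFDerivAt.comp_hasDerivWithinAt 0 h1 hc).congr_deriv (by simp)
  · have h0 := curve_tendsto c0 hc
    filter_upwards [H, eventually_close ha h0, eventually_close ha (tendsto_inv_one h0)]
      with τ h1 h2 h3 v hv
    have := H1 _ h2 h3 v hv
    have := h1 v hv
    linarith

lemma Reach.smul_pos {l : ℝ} (hl : 0 < l) (hZ : Reach G R k Z) : Reach G R k (l • Z) := by
  obtain ⟨c, C, hC, c0, hc, H⟩ := hZ
  have hmap : Set.MapsTo (fun τ : ℝ => l * τ) (Set.Ioi 0) (Set.Ioi 0) := fun τ hτ =>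
    mul_pos hl hτ
  have ht : Tendsto (fun τ : ℝ => l * τ) (𝓝[>] 0) (𝓝[>] 0) := by
    have h1 : ContinuousWithinAt (fun τ : ℝ => l * τ) (Set.Ioi 0) 0 := by fun_prop
    have := h1.tendsto_nhdsWithin hmap
    simpa using this
  refine ⟨fun τ => c (l * τ), C * l ^ ((1 : ℝ) / k), by positivity, by simp [c0], ?_, ?_⟩
  · have h1 : HasDerivWithinAt (fun τ : ℝ => l * τ) l (Set.Ioi 0) 0 := by
      simpa using (hasDerivWithinAt_id (0 : ℝ) (Set.Ioi 0)).const_mul l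
    have h2 : HasDerivWithinAt c Z (Set.Ioi 0) (l * 0) := by simpa using hc
    exact HasDerivWithinAt.scomp 0 h2 h1 hmap
  · filter_upwards [ht.eventually H, self_mem_nhdsWithin] with τ h1 h2 v hv
    have := h1 v hv
    rwa [Real.mul_rpow hl.le (le_of_lt h2), ← mul_assoc] at this

lemma Reach.smul (l : ℝ) (hZ : Reach G R k Z) : Reach G R k (l • Z) := by
  rcases lt_trichotomy l 0 with h | h | h
  · have := (hZ.smul_pos (neg_pos.2 h)).neg
    simpa using this
  · simpa [h] using Reach.zero
  · exact hZ.smul_pos h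

lemma Reach.mono {k' : ℕ} (hk : 1 ≤ k) (hkk : k ≤ k') (hZ : Reach G R k Z) :
    Reach G R k' Z := by
  obtain ⟨c, C, hC, c0, hc, H⟩ := hZ
  refine ⟨c, C, hC, c0, hc, ?_⟩
  filter_upwards [H, Ioo_mem_nhdsGT one_pos] with τ h1 h2 v hv
  refine (h1 v hv).trans ?_
  have h0 := hnorm_nonneg G v
  gcongr ?_ * ?_ * _
  refine Real.rpow_le_rpow_of_exponent_ge h2.1 h2.2.le ?_
  have : (1 : ℝ) ≤ k := by exact_mod_cast hk
  gcongr

lemma Reach.one (i : Fin (G.m 1)) : Reach G R 1 (G.X 1 i G.one) := by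
  refine ⟨G.expMap 1 i, 2, zero_le_two, G.expMap_zero 1 i, ?_, ?_⟩
  · have := (hasDerivAt_expMap G i 0).hasDerivWithinAt (s := Set.Ioi 0)
    rwa [G.expMap_zero] at this
  · filter_upwards [exists_tdiff_expMap G R i, self_mem_nhdsWithin] with τ h1 h2 v hv
    refine (h1 v hv).trans ?_
    have h3 : nrm volume (G.D 1 i v) ≤ hnorm G v := by
      unfold hnorm
      have := Finset.single_le_sum (f := fun i => nrm volume (G.D 1 i v))
        (fun i _ => nrm_nonneg) (Finset.mem_univ i)
      have h4 := nrm_nonneg (μ := volume) (f := v)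
      linarith
    have h2' : (0 : ℝ) < τ := h2
    simp only [Nat.cast_one, div_one, Real.rpow_one]
    gcongr

lemma Reach.span {S : Set (CSpace n)} (hS : ∀ Z ∈ S, Reach G R k Z)
    (hZ : Z ∈ Submodule.span ℝ S) : Reach G R k Z := by
  induction hZ using Submodule.span_induction with
  | mem x h => exact hS x h
  | zero => exact Reach.zero
  | add x y _ _ hx hy => exact hx.add hy
  | smul a x _ hx => exact hx.smul a

/-- The second order part of the group law computes brackets of left-invariant fields. -/
lemma exists_mixed_mul (G : CarnotGroup r n) : ∃ β : CSpace n →L[ℝ] CSpace n →L[ℝ] CSpace n,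
    (fun z : CSpace n × CSpace n => (G.mul (G.one + z.1) (G.one + z.2) - z.1 - z.2 - G.one)
      - β z.1 z.2) =o[𝓝 0] (fun z => ‖z.1‖ * ‖z.2‖) ∧
    ∀ k i x, fderiv ℝ (G.X k i) G.one x = β x (G.X k i G.one) := by
  let f : CSpace n × CSpace n → CSpace n :=
    fun z => G.mul (G.one + z.1) (G.one + z.2) - z.1 - z.2 - G.one
  have hf : ContDiff ℝ (⊤ : ℕ∞) f :=
    (((contDiff_mul G (contDiff_const.add contDiff_fst) (contDiff_const.add contDiff_snd)).sub
      contDiff_fst).sub contDiff_snd).sub contDiff_const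
  let H : CSpace n → CSpace n →L[ℝ] CSpace n := fun x =>
    (fderiv ℝ f (x, 0)).comp (ContinuousLinearMap.inr ℝ (CSpace n) (CSpace n))
  have hH : ContDiff ℝ (⊤ : ℕ∞) H :=
    ((hf.fderiv_right (m := (⊤ : ℕ∞)) (by simp)).comp
      (contDiff_id.prodMk contDiff_const)).clm_comp contDiff_const
  have hH' : HasFDerivAt H (fderiv ℝ H 0) 0 := (hH.differentiable top_ne_zero 0).hasFDerivAt
  refine ⟨fderiv ℝ H 0, mixed_expansion hf (fun x => by simp [f, G.mul_one'])
    (fun y => by simp [f, G.one_mul']) hH', fun k i x => ?_⟩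
  have h1 : ∀ x, H x (G.X k i G.one) = G.X k i (G.one + x) - G.X k i G.one := by
    intro x
    have h2 := HasFDerivAt.comp (f := fun y => (x, y)) 0
      (hf.differentiable top_ne_zero (x, 0)).hasFDerivAt (hasFDerivAt_prodMk_right x 0)
    have h3 : HasFDerivAt (fun y => G.mul (G.one + x) (G.one + y) - x - y - G.one)
        (fderiv ℝ (G.mul (G.one + x)) G.one - ContinuousLinearMap.id ℝ (CSpace n)) 0 := by
      have h4 : HasFDerivAt (G.mul (G.one + x)) (fderiv ℝ (G.mul (G.one + x)) (G.one + 0))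
          (G.one + 0) :=
        ((contDiff_mul G contDiff_const contDiff_id).differentiable top_ne_zero _).hasFDerivAt
      have h5 := h4.comp (0 : CSpace n) ((hasFDerivAt_id (0 : CSpace n)).const_add G.one)
      simp only [add_zero, ContinuousLinearMap.comp_id] at h5
      exact ((h5.sub_const x).sub (hasFDerivAt_id 0)).sub_const G.one
    have h6 := DFunLike.congr_fun (h2.unique h3) (G.X k i G.one)
    have h7 := G.left_invariant_X k i (G.one + x) G.one
    rw [G.mul_one'] at h7
    rw [h7]
    simpa [H] using h6
  have h2 : HasFDerivAt (fun x => H x (G.X k i G.one))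
      ((fderiv ℝ (G.X k i) G.one)) 0 := by
    simp_rw [h1]
    have h4 : HasFDerivAt (G.X k i) (fderiv ℝ (G.X k i) (G.one + 0)) (G.one + 0) :=
      ((G.smooth_X k i).differentiable top_ne_zero _).hasFDerivAt
    have h5 := h4.comp (0 : CSpace n) ((hasFDerivAt_id (0 : CSpace n)).const_add G.one)
    simp only [add_zero, ContinuousLinearMap.comp_id] at h5
    exact h5.sub_const _
  have h3 := hH'.clm_apply (hasFDerivAt_const (G.X k i G.one) 0)
  have := DFunLike.congr_fun (h2.unique h3) x
  simpa using this

end Reach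

section Bracket

variable {r n : ℕ} {G : CarnotGroup r n}

lemma clm_apply_isBigO {E : Type*} [NormedAddCommGroup E] [NormedSpace ℝ E]
    (β : E →L[ℝ] E →L[ℝ] E) {l : Filter ℝ} (x y : ℝ → E) :
    (fun t => β (x t) (y t)) =O[l] fun t => ‖x t‖ * ‖y t‖ :=
  IsBigO.of_bound ‖β‖ (Eventually.of_forall fun t => by
    simpa [mul_assoc] using β.le_opNorm₂ (x t) (y t))

lemma clm_apply_expansion {E : Type*} [NormedAddCommGroup E] [NormedSpace ℝ E]
    (β : E →L[ℝ] E →L[ℝ] E) {l : Filter ℝ} {x y : ℝ → E} {x₀ y₀ : E} {α γ : ℝ → ℝ}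
    (hx : (fun t => x t - α t • x₀) =o[l] α) (hy : (fun t => y t - γ t • y₀) =o[l] γ) :
    (fun t => β (x t) (y t) - (α t * γ t) • β x₀ y₀) =o[l] fun t => α t * γ t := by
  have hα : (fun t => α t • x₀) =O[l] α :=
    IsBigO.of_bound ‖x₀‖ (Eventually.of_forall fun t => by simp [norm_smul, mul_comm])
  have hγ : (fun t => γ t • y₀) =O[l] γ :=
    IsBigO.of_bound ‖y₀‖ (Eventually.of_forall fun t => by simp [norm_smul, mul_comm])
  have hyO : y =O[l] γ := by simpa using hy.isBigO.add hγ
  have h1 : (fun t => β (x t - α t • x₀) (y t)) =o[l] fun t => α t * γ t :=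
    (clm_apply_isBigO β _ _).trans_isLittleO (hx.norm_left.mul_isBigO hyO.norm_left)
  have h2 : (fun t => β (α t • x₀) (y t - γ t • y₀)) =o[l] fun t => α t * γ t :=
    (clm_apply_isBigO β _ _).trans_isLittleO (hα.norm_left.mul_isLittleO hy.norm_left)
  refine (h1.add h2).congr_left fun t => ?_
  simp only [map_sub, map_smul, sub_apply, smul_apply, smul_smul]
  rw [mul_comm (γ t)]
  module

lemma tendsto_rpow_nhdsGT {q : ℝ} (hq : 0 < q) :
    Tendsto (fun τ : ℝ => τ ^ q) (𝓝[>] 0) (𝓝[>] 0) := by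
  have h1 : ContinuousWithinAt (fun τ : ℝ => τ ^ q) (Set.Ioi 0) 0 :=
    (Real.continuousAt_rpow_const 0 q (Or.inr hq.le)).continuousWithinAt
  have := h1.tendsto_nhdsWithin (t := Set.Ioi 0) fun τ hτ => Real.rpow_pos_of_pos hτ q
  simpa [Real.zero_rpow hq.ne'] using this

lemma curve_expansion {c : ℝ → CSpace n} {Z : CSpace n} (h0 : c 0 = G.one)
    (hc : HasDerivWithinAt c Z (Set.Ioi 0) 0) {q : ℝ} (hq : 0 < q) :
    (fun τ : ℝ => (c (τ ^ q) - G.one) - (τ ^ q) • Z) =o[𝓝[>] 0] fun τ : ℝ => τ ^ q := by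
  have h1 := hasDerivWithinAt_iff_isLittleO.1 hc
  have h2 := h1.comp_tendsto (tendsto_rpow_nhdsGT hq)
  simpa [h0, Function.comp_def] using h2

variable {R : ℝ} {k : ℕ} {Z W : CSpace n}

lemma Reach.commutator (hk : 1 ≤ k) (hZ : Reach G R 1 Z) (hW : Reach G R k W)
    {β : CSpace n →L[ℝ] CSpace n →L[ℝ] CSpace n}
    (hβ : (fun z : CSpace n × CSpace n => (G.mul (G.one + z.1) (G.one + z.2) - z.1 - z.2 - G.one)
      - β z.1 z.2) =o[𝓝 0] (fun z => ‖z.1‖ * ‖z.2‖)) :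
    Reach G R (k + 1) (β Z W - β W Z) := by
  obtain ⟨c, C, hC, c0, hc, H⟩ := hZ
  obtain ⟨d, D, hD, d0, hd, K⟩ := hW
  obtain ⟨a, ha, -, -, -, H1, H2⟩ := exists_tdiff_bound G R
  have hk0 : (0 : ℝ) < k := by exact_mod_cast hk
  set p : ℝ := 1 / ((k : ℝ) + 1) with hp
  set q : ℝ := k / ((k : ℝ) + 1) with hq
  have hp0 : 0 < p := by positivity
  have hq0 : 0 < q := by positivity
  have hpq : p + q = 1 := by rw [hp, hq]; field_simp; ring
  have tp := tendsto_rpow_nhdsGT hp0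
  have tq := tendsto_rpow_nhdsGT hq0
  set g : ℝ → CSpace n := fun τ => c (τ ^ p) with hg
  set h : ℝ → CSpace n := fun τ => d (τ ^ q) with hh
  have g1 : Tendsto g (𝓝[>] 0) (𝓝 G.one) := (curve_tendsto c0 hc).comp tp
  have h1 : Tendsto h (𝓝[>] 0) (𝓝 G.one) := (curve_tendsto d0 hd).comp tq
  have gh1 := tendsto_mul_one g1 h1
  have hg1 := tendsto_mul_one h1 g1
  have eg := curve_expansion c0 hc hp0
  have eh := curve_expansion d0 hd hq0
  refine ⟨fun τ => G.mul (G.mul (g τ) (h τ)) (G.inv (G.mul (h τ) (g τ))), 9 * C + 6 * D,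
    by positivity, ?_, ?_, ?_⟩
  · simp [hg, hh, Real.zero_rpow hp0.ne', Real.zero_rpow hq0.ne', c0, d0, G.one_mul', inv_one']
  · rw [hasDerivWithinAt_iff_isLittleO]
    have h0 : G.mul (G.mul (g 0) (h 0)) (G.inv (G.mul (h 0) (g 0))) = G.one := by
      simp [hg, hh, Real.zero_rpow hp0.ne', Real.zero_rpow hq0.ne', c0, d0, G.one_mul', inv_one']
    simp only [h0, sub_zero]
    have hτ : ∀ᶠ τ : ℝ in 𝓝[>] 0, τ ^ p * τ ^ q = τ := by
      filter_upwards [self_mem_nhdsWithin] with τ h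
      rw [← Real.rpow_add h, hpq, Real.rpow_one]
    have xO : (fun τ => g τ - G.one) =O[𝓝[>] 0] fun τ : ℝ => τ ^ p := by
      have := eg.isBigO.add (IsBigO.of_bound (g := fun τ : ℝ => τ ^ p) (f := fun τ => (τ ^ p) • Z)
        ‖Z‖ (Eventually.of_forall fun t => by simp [norm_smul, mul_comm]))
      simpa using this
    have yO : (fun τ => h τ - G.one) =O[𝓝[>] 0] fun τ : ℝ => τ ^ q := by
      have := eh.isBigO.add (IsBigO.of_bound (g := fun τ : ℝ => τ ^ q) (f := fun τ => (τ ^ q) • W)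
        ‖W‖ (Eventually.of_forall fun t => by simp [norm_smul, mul_comm]))
      simpa using this
    have gz : Tendsto (fun τ => g τ - G.one) (𝓝[>] 0) (𝓝 0) := by
      simpa using g1.sub_const G.one
    have hz : Tendsto (fun τ => h τ - G.one) (𝓝[>] 0) (𝓝 0) := by
      simpa using h1.sub_const G.one
    have b1 := (hβ.comp_tendsto (gz.prodMk_nhds hz)).trans_isBigO (xO.norm_left.mul yO.norm_left)
    have b2 := (hβ.comp_tendsto (hz.prodMk_nhds gz)).trans_isBigO (yO.norm_left.mul xO.norm_left)
    have b3 := clm_apply_expansion β eg eh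
    have b4 := clm_apply_expansion β eh eg
    have b5 : (fun τ => (G.mul (g τ) (h τ) - G.mul (h τ) (g τ)) - τ • (β Z W - β W Z))
        =o[𝓝[>] 0] fun τ : ℝ => τ := by
      have e1 := (b1.add b3).sub ((b2.add b4).congr_right fun t => mul_comm _ _)
      refine e1.congr' ?_ hτ
      filter_upwards [hτ] with τ ht
      simp only [Function.comp_apply, add_sub_cancel, ht, mul_comm (τ ^ q) (τ ^ p)]
      module
    have b6 : (fun τ => (G.mul (g τ) (h τ) - G.mul (h τ) (g τ))) =O[𝓝[>] 0] fun τ : ℝ => τ := by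
      have := b5.isBigO.add (IsBigO.of_bound (g := fun τ : ℝ => τ)
        (f := fun τ : ℝ => τ • (β Z W - β W Z))
        ‖β Z W - β W Z‖ (Eventually.of_forall fun t => by simp [norm_smul, mul_comm]))
      simpa using this
    have b7 := (hasStrictFDerivAt_mul_inv_one G).isLittleO.comp_tendsto
      ((gh1.prodMk_nhds hg1).prodMk_nhds (hg1.prodMk_nhds hg1))
    have b8 : (fun τ => G.mul (G.mul (g τ) (h τ)) (G.inv (G.mul (h τ) (g τ))) - G.one
        - (G.mul (g τ) (h τ) - G.mul (h τ) (g τ))) =o[𝓝[>] 0] fun τ : ℝ => τ := by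
      refine IsLittleO.trans_isBigO (b7.congr_left fun τ => ?_) (IsBigO.trans
        (IsBigO.of_bound 1 (Eventually.of_forall fun τ => ?_)) b6)
      · simp [mul_inv']
      · simp [Prod.norm_def]
    refine (b8.add b5).congr_left fun τ => ?_
    module
  · have gh1' := tendsto_inv_one hg1
    filter_upwards [tp.eventually H, tq.eventually K, eventually_close ha g1,
      eventually_close ha h1, eventually_close ha gh1, eventually_close ha hg1,
      eventually_close ha gh1', self_mem_nhdsWithin] with τ k1 k2 e1 e2 e3 e4 e5 hτ v hv
    have hτ0 : (0 : ℝ) < τ := hτ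
    have m1 := H1 _ _ e3 e5 v hv
    have m2 := H1 _ _ e1 e2 v hv
    have m3 := H2 _ e4 e5 v hv
    have m4 := H1 _ _ e2 e1 v hv
    have m5 := k1 v hv
    have m6 := k2 v hv
    have r1 : ((τ : ℝ) ^ p) ^ ((1 : ℝ) / (1 : ℕ)) = τ ^ ((1 : ℝ) / ((k + 1 : ℕ) : ℝ)) := by
      rw [← Real.rpow_mul hτ0.le]; congr 1; push_cast; rw [hp]; ring
    have r2 : ((τ : ℝ) ^ q) ^ ((1 : ℝ) / (k : ℕ)) = τ ^ ((1 : ℝ) / ((k + 1 : ℕ) : ℝ)) := by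
      rw [← Real.rpow_mul hτ0.le]; congr 1; push_cast; rw [hq]; field_simp
    rw [r1] at m5
    rw [r2] at m6
    have : (9 * C + 6 * D) * τ ^ ((1 : ℝ) / ((k + 1 : ℕ) : ℝ)) * hnorm G v
      = 9 * (C * τ ^ ((1 : ℝ) / ((k + 1 : ℕ) : ℝ)) * hnorm G v) +
        6 * (D * τ ^ ((1 : ℝ) / ((k + 1 : ℕ) : ℝ)) * hnorm G v) := by ring
    rw [this]
    linarith

lemma Reach.bracket (hk : 1 ≤ k) (i : Fin (G.m 1)) (j : Fin (G.m k))
    (h : Reach G R k (G.X k j G.one)) :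
    Reach G R (k + 1) (vbracket (G.X 1 i) (G.X k j) G.one) := by
  obtain ⟨β, hβ, H⟩ := exists_mixed_mul G
  have := (Reach.one i).commutator hk h hβ
  rwa [vbracket, H, H]

lemma reach_X (R : ℝ) (hk : 1 ≤ k) (hkr : k ≤ r) (i : Fin (G.m k)) :
    Reach G R k (G.X k i G.one) := by
  induction k, hk using Nat.le_induction with
  | base => exact Reach.one i
  | succ k hk ih =>
    have h1 := G.bracket_span k hk (by omega) (Submodule.subset_span (Set.mem_range_self i))
    have h2 : G.X (k + 1) i G.one ∈ Submodule.span ℝ (Set.range fun z : Fin (G.m 1) × Fin (G.m k) =>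
        vbracket (G.X 1 z.1) (G.X k z.2) G.one) := by
      have := Submodule.apply_mem_span_image_of_mem_span
        (LinearMap.proj (R := ℝ) (φ := fun _ : CSpace n => CSpace n) G.one) h1
      rw [← Set.range_comp] at this
      exact this
    refine Reach.span ?_ h2
    rintro _ ⟨z, rfl⟩
    exact Reach.bracket hk _ _ (ih (by omega) z.2)

lemma span_X (G : CarnotGroup r n) : Submodule.span ℝ
    (Set.range fun z : Σ k : Fin (r + 1), Fin (G.m k.1) => G.X z.1 z.2 G.one) = ⊤ := by
  refine G.indep_X.span_eq_top_of_card_eq_finrank' ?_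
  rw [Fintype.card_sigma, finrank_euclideanSpace_fin]
  refine Eq.trans ?_ G.dim_eq
  rw [Finset.sum_range]
  simp

lemma reach_all (R : ℝ) (Z : CSpace n) : Reach G R r Z := by
  refine Reach.span ?_ (span_X G ▸ Submodule.mem_top : Z ∈ _)
  rintro _ ⟨⟨⟨k, hk⟩, i⟩, rfl⟩
  rcases Nat.eq_zero_or_pos k with h0 | h0
  · have := G.m_zero k (Or.inl h0)
    exact absurd i.2 (by simp only; omega)
  · exact (reach_X R h0 (by omega) i).mono h0 (by omega)

end Bracket

section Uniform

variable {r n : ℕ} (G : CarnotGroup r n)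

/-- One step of the telescoping argument: a translation increment of size `τ` is controlled by
one reachable curve up to an increment of size `4⁻ʳ τ`. -/
lemma exists_tdiff_step (R : ℝ) : ∃ C τ₀ : ℝ, 0 ≤ C ∧ 0 < τ₀ ∧ τ₀ ≤ 1 ∧ ∀ τ, 0 < τ → τ ≤ τ₀ →
    ∀ g, ‖g - G.one‖ ≤ τ → ∃ g', ‖g' - G.one‖ ≤ (1 / 4) ^ r * τ ∧
      ∀ v, TF R v → tdiff G v g ≤ C * τ ^ ((1 : ℝ) / r) * hnorm G v + 2 * tdiff G v g' := by
  set ε : ℝ := (1 / 4) ^ r with hε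
  have hε0 : 0 < ε := by positivity
  have hε1 : ε ≤ 1 := pow_le_one₀ (by norm_num) (by norm_num)
  obtain ⟨a, ha, -, -, -, H1, -⟩ := exists_tdiff_bound G R
  choose c C hC c0 hc Hc using fun Z => reach_all (G := G) R Z
  obtain ⟨T, -, hTf, hT⟩ := (isCompact_closedBall (0 : CSpace n) 1).finite_cover_balls
    (e := ε / 4) (by positivity)
  lift T to Finset (CSpace n) using hTf
  have e1 : ∀ᶠ τ in 𝓝[>] (0 : ℝ), ∀ ζ ∈ T, ∀ v, TF R v →
      tdiff G v (c ζ τ) ≤ C ζ * τ ^ ((1 : ℝ) / r) * hnorm G v :=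
    (T.eventually_all).2 fun ζ _ => Hc ζ
  have e2 : ∀ᶠ τ in 𝓝[>] (0 : ℝ), ∀ ζ ∈ T, ‖c ζ τ - G.one - τ • ζ‖ ≤ ε / 4 * τ := by
    refine (T.eventually_all).2 fun ζ _ => ?_
    have := (hasDerivWithinAt_iff_isLittleO.1 (hc ζ)).def (c := ε / 4) (by positivity)
    filter_upwards [this, self_mem_nhdsWithin] with τ h1 h2
    have h2' : (0 : ℝ) < τ := h2
    simpa [c0, abs_of_pos h2'] using h1
  have e3 : ∀ᶠ τ in 𝓝[>] (0 : ℝ), ∀ ζ ∈ T, ‖c ζ τ - G.one‖ ≤ a :=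
    (T.eventually_all).2 fun ζ _ => eventually_close ha (curve_tendsto (c0 ζ) (hc ζ))
  have hs := (hasStrictFDerivAt_inv_mul_one G).isLittleO.def one_pos
  obtain ⟨b, hb, Hb⟩ := Metric.eventually_nhds_iff.1 hs
  have e4 : ∀ᶠ τ in 𝓝[>] (0 : ℝ), ∀ ζ ∈ T, ‖c ζ τ - G.one‖ ≤ b / 2 :=
    (T.eventually_all).2 fun ζ _ =>
      eventually_close (by positivity) (curve_tendsto (c0 ζ) (hc ζ))
  obtain ⟨t, ht, Ht⟩ := mem_nhdsGT_iff_exists_Ioc_subset.1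
    (((e1.and e2).and e3).and e4)
  have ht' : (0 : ℝ) < t := ht
  refine ⟨∑ ζ ∈ T, C ζ, min (min t 1) (min a (b / 2)), Finset.sum_nonneg fun ζ _ => hC ζ,
    by positivity, (min_le_left _ _).trans (min_le_right _ _), fun τ hτ hτ' g hg => ?_⟩
  have hτa : τ ≤ a := hτ'.trans ((min_le_right _ _).trans (min_le_left _ _))
  have hτb : τ ≤ b / 2 := hτ'.trans ((min_le_right _ _).trans (min_le_right _ _))
  obtain ⟨⟨⟨k1, k2⟩, k3⟩, k4⟩ := Ht ⟨hτ, hτ'.trans ((min_le_left _ _).trans (min_le_left _ _))⟩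
  have hz : τ⁻¹ • (g - G.one) ∈ Metric.closedBall (0 : CSpace n) 1 := by
    rw [mem_closedBall_zero_iff, norm_smul, norm_inv, Real.norm_of_nonneg hτ.le]
    rw [inv_mul_le_iff₀ hτ]; simpa using hg
  obtain ⟨ζ, hζT, hζ⟩ := Set.mem_iUnion₂.1 (hT hz)
  have hζT' : ζ ∈ T := hζT
  rw [Metric.mem_ball, dist_eq_norm] at hζ
  have hgz : ‖g - G.one - τ • ζ‖ ≤ ε / 4 * τ := by
    have : g - G.one - τ • ζ = τ • (τ⁻¹ • (g - G.one) - ζ) := by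
      rw [smul_sub, smul_smul, mul_inv_cancel₀ hτ.ne', one_smul]
    rw [this, norm_smul, Real.norm_of_nonneg hτ.le, mul_comm]
    gcongr
  have hgc : ‖g - c ζ τ‖ ≤ ε / 2 * τ := by
    have : g - c ζ τ = (g - G.one - τ • ζ) - (c ζ τ - G.one - τ • ζ) := by abel
    rw [this]
    refine (norm_sub_le _ _).trans ?_
    linarith [k2 ζ hζT']
  have hg' : ‖G.mul (G.inv (c ζ τ)) g - G.one‖ ≤ ε * τ := by
    have h1 := k4 ζ hζT'
    have h2 := Hb (y := ((c ζ τ, g), (c ζ τ, c ζ τ))) (by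
      simp only [Prod.dist_eq]
      simp only [dist_eq_norm]
      refine max_lt (max_lt ?_ ?_) (max_lt ?_ ?_) <;> linarith)
    simp only [Prod.mk_sub_mk, sub_self, FunLike.coe_sub, Pi.sub_apply,
      ContinuousLinearMap.coe_snd', ContinuousLinearMap.coe_fst', sub_zero, one_mul,
      G.inv_mul', Prod.norm_mk, norm_zero] at h2
    rw [max_eq_right (norm_nonneg _)] at h2
    have h3 := norm_le_norm_sub_add (G.mul (G.inv (c ζ τ)) g - G.one) (g - c ζ τ)
    linarith
  refine ⟨_, hg', fun v hv => ?_⟩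
  have h5 := H1 (c ζ τ) (G.mul (G.inv (c ζ τ)) g) (k3 ζ hζT')
    (hg'.trans ((mul_le_of_le_one_left hτ.le hε1).trans hτa)) v hv
  rw [mul_inv_cancel_left'] at h5
  refine h5.trans ?_
  gcongr
  refine (k1 ζ hζT' v hv).trans ?_
  have := hnorm_nonneg G v
  gcongr
  exact Finset.single_le_sum (fun ζ _ => hC ζ) hζT'

/-- Uniform control of translation increments by the horizontal Sobolev norm. -/
lemma exists_tdiff_le (R : ℝ) : ∃ C τ₀ : ℝ, 0 ≤ C ∧ 0 < τ₀ ∧ τ₀ ≤ 1 ∧ ∀ τ, 0 < τ → τ ≤ τ₀ →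
    ∀ g, ‖g - G.one‖ ≤ τ → ∀ v, TF R v → tdiff G v g ≤ C * τ ^ ((1 : ℝ) / r) * hnorm G v := by
  obtain ⟨C, τ₀, hC, h0, h1, H⟩ := exists_tdiff_step G R
  have hr : (r : ℝ) ≠ 0 := by exact_mod_cast G.hr.ne'
  have hit : ∀ J : ℕ, ∀ τ, 0 < τ → τ ≤ τ₀ → ∀ g, ‖g - G.one‖ ≤ τ →
      ∃ g', ‖g' - G.one‖ ≤ ((1 / 4) ^ r) ^ J * τ ∧ ∀ v, TF R v →
        tdiff G v g ≤ 2 * C * τ ^ ((1 : ℝ) / r) * hnorm G v + 2 ^ J * tdiff G v g' := by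
    intro J
    induction J with
    | zero =>
      intro τ hτ _ g hg
      refine ⟨g, by simpa using hg, fun v _ => ?_⟩
      have := hnorm_nonneg G v
      have : 0 ≤ 2 * C * τ ^ ((1 : ℝ) / r) * hnorm G v := by positivity
      simpa using this
    | succ J ih =>
      intro τ hτ hτ' g hg
      obtain ⟨g1, hg1, k1⟩ := H τ hτ hτ' g hg
      have hle : (1 / 4 : ℝ) ^ r * τ ≤ τ₀ :=
        (mul_le_of_le_one_left hτ.le (pow_le_one₀ (by norm_num) (by norm_num))).trans hτ'
      obtain ⟨g2, hg2, k2⟩ := ih _ (by positivity) hle g1 hg1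
      refine ⟨g2, by rw [pow_succ, mul_assoc]; exact hg2, fun v hv => ?_⟩
      have m1 := k1 v hv
      have m2 := k2 v hv
      have : ((1 / 4 : ℝ) ^ r * τ) ^ ((1 : ℝ) / r) = 1 / 4 * τ ^ ((1 : ℝ) / r) := by
        rw [Real.mul_rpow (by positivity) hτ.le, ← Real.rpow_natCast, ← Real.rpow_mul (by norm_num),
          mul_one_div_cancel hr, Real.rpow_one]
      rw [this] at m2
      rw [pow_succ]
      nlinarith
  refine ⟨2 * C, τ₀, by positivity, h0, h1, fun τ hτ hτ' g hg v hv => ?_⟩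
  obtain ⟨a, L, ha, hL, HL⟩ := exists_tdiff_lipschitz G R hv
  refine le_of_forall_pos_le_add fun δ hδ => ?_
  have t1 : Tendsto (fun J : ℕ => L * τ * (1 / 2 : ℝ) ^ J) atTop (𝓝 0) := by
    simpa using (tendsto_pow_atTop_nhds_zero_of_lt_one (r := (1 / 2 : ℝ)) (by norm_num)
      (by norm_num)).const_mul (L * τ)
  have t2 : Tendsto (fun J : ℕ => τ * (1 / 4 : ℝ) ^ J) atTop (𝓝 0) := by
    simpa using (tendsto_pow_atTop_nhds_zero_of_lt_one (r := (1 / 4 : ℝ)) (by norm_num)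
      (by norm_num)).const_mul τ
  obtain ⟨J, hJ1, hJ2⟩ := ((t1.eventually_lt_const hδ).and (t2.eventually_lt_const ha)).exists
  obtain ⟨g', hg', k⟩ := hit J τ hτ hτ' g hg
  have hpow : ((1 / 4 : ℝ) ^ r) ^ J ≤ (1 / 4) ^ J := by
    rw [← pow_mul]
    exact pow_le_pow_of_le_one (by norm_num) (by norm_num) (Nat.le_mul_of_pos_left _ G.hr)
  have hg'' : ‖g' - G.one‖ ≤ (1 / 4) ^ J * τ := hg'.trans (by gcongr)
  have m1 := HL g' (hg''.trans (by linarith))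
  refine (k v hv).trans ?_
  gcongr
  calc 2 ^ J * tdiff G v g' ≤ 2 ^ J * (L * ((1 / 4) ^ J * τ)) := by gcongr; exact m1.trans (by gcongr)
    _ = L * τ * (1 / 2 : ℝ) ^ J := by
      rw [show (1 / 4 : ℝ) = 1 / 2 * (1 / 2) by norm_num, mul_pow]
      have : (2 : ℝ) ^ J * (1 / 2) ^ J = 1 := by rw [← mul_pow]; norm_num
      linear_combination (L * τ * (1 / 2) ^ J) * this
    _ ≤ δ := hJ1.le

end Uniform

section Average

variable {n : ℕ}

/-- Minkowski's integral inequality for continuous kernels with compact support. -/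
lemma nrm_setIntegral_le {s : Set (CSpace n)} (hs : IsCompact s) {k : CSpace n → ℝ}
    (hk : Continuous k) {w : CSpace n → CSpace n → ℝ} (hw : Continuous (Function.uncurry w))
    {ρ M : ℝ} (hM : 0 ≤ M) (hsupp : ∀ g ∈ s, ∀ p, w g p ≠ 0 → ‖p‖ ≤ ρ)
    (hb : ∀ g ∈ s, k g ≠ 0 → nrm volume (w g) ≤ M) :
    nrm volume (fun p => ∫ g in s, k g * w g p) ≤ (∫ g in s, |k g|) * M := by
  set P : CSpace n → ℝ := fun p => ∫ g in s, k g * w g p with hP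
  have hPc : Continuous P := by
    refine continuous_parametric_integral_of_continuous ?_ hs
    exact (hk.comp continuous_snd).mul (hw.comp (continuous_snd.prodMk continuous_fst))
  have hP0 : ∀ p, P p ≠ 0 → ‖p‖ ≤ ρ := by
    intro p hp
    by_contra h
    refine hp (setIntegral_eq_zero_of_forall_eq_zero fun g hg => ?_)
    have : w g p = 0 := by by_contra h'; exact h (hsupp g hg p h')
    simp [this]
  have hcs : ∀ {f : CSpace n → ℝ}, (∀ p, f p ≠ 0 → ‖p‖ ≤ ρ) → HasCompactSupport f := by
    intro f hf
    refine HasCompactSupport.of_support_subset_isCompact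
      (isCompact_closedBall (0 : CSpace n) ρ) fun p hp => ?_
    simpa using hf p hp
  have hPm : MemLp P 2 volume := hPc.memLp_of_hasCompactSupport (hcs hP0)
  refine nrm_integral_le (hk.continuousOn.integrableOn_compact hs) hPm (fun _ => rfl) ?_ ?_ hM
  · have e : (volume.restrict s).prod (volume : Measure (CSpace n))
        = (volume.prod volume).restrict (s ×ˢ Set.univ) := by
      rw [← Measure.prod_restrict, Measure.restrict_univ]
    rw [e]
    have h1 : Continuous fun z : CSpace n × CSpace n => k z.1 * w z.1 z.2 * P z.2 :=
      ((hk.comp continuous_fst).mul hw).mul (hPc.comp continuous_snd)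
    have h2 : IntegrableOn (fun z : CSpace n × CSpace n => k z.1 * w z.1 z.2 * P z.2)
        (s ×ˢ Metric.closedBall (0 : CSpace n) ρ) (volume.prod volume) :=
      h1.continuousOn.integrableOn_compact (hs.prod (isCompact_closedBall _ _))
    refine h2.of_forall_sdiff_eq_zero (hs.measurableSet.prod MeasurableSet.univ) ?_
    rintro ⟨g, p⟩ ⟨h3, h4⟩
    have h5 : P p = 0 := by
      by_contra h
      exact h4 ⟨h3.1, by simpa using hP0 p h⟩
    simp [h5]
  · refine (ae_restrict_iff' hs.measurableSet).2 (Eventually.of_forall fun g hg hk0 => ?_)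
    refine ⟨?_, hb g hg hk0⟩
    exact (hw.comp (continuous_const.prodMk continuous_id)).memLp_of_hasCompactSupport
      (hcs (hsupp g hg))

lemma exists_mollifier (n : ℕ) : ∃ χ : CSpace n → ℝ, ContDiff ℝ (⊤ : ℕ∞) χ ∧ (∀ x, 0 ≤ χ x) ∧
    (∀ x, χ x ≠ 0 → ‖x‖ ≤ 1) ∧ ∫ x, χ x = 1 := by
  let b : ContDiffBump (0 : CSpace n) := ⟨1 / 2, 1, by norm_num, by norm_num⟩
  refine ⟨b.normed volume, b.contDiff_normed, b.nonneg_normed, fun x hx => ?_,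
    b.integral_normed⟩
  have : x ∈ Function.support (b.normed volume) := hx
  rw [b.support_normed_eq] at this
  exact (by simpa using this : ‖x‖ < 1).le

/-- The rescaled mollifier centred at `c`. -/
def moll (χ : CSpace n → ℝ) (c : CSpace n) (τ : ℝ) (g : CSpace n) : ℝ :=
  τ⁻¹ ^ n * χ (τ⁻¹ • (g - c))

variable {χ : CSpace n → ℝ} {c : CSpace n} {τ : ℝ}

lemma contDiff_moll (hχ : ContDiff ℝ (⊤ : ℕ∞) χ) : ContDiff ℝ (⊤ : ℕ∞) (moll χ c τ) :=
  contDiff_const.mul (hχ.comp ((contDiff_id.sub contDiff_const).const_smul τ⁻¹))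

lemma moll_support (hτ : 0 < τ) (hχ : ∀ x, χ x ≠ 0 → ‖x‖ ≤ 1) {g : CSpace n}
    (hg : moll χ c τ g ≠ 0) : ‖g - c‖ ≤ τ := by
  have := hχ _ (right_ne_zero_of_mul hg)
  rw [norm_smul, norm_inv, Real.norm_of_nonneg hτ.le, inv_mul_le_iff₀ hτ] at this
  simpa using this

lemma integral_moll (hτ : 0 < τ) (h1 : ∫ x, χ x = 1) : ∫ g, moll χ c τ g = 1 := by
  unfold moll
  rw [integral_const_mul, integral_sub_right_eq_self (fun g => χ (τ⁻¹ • g)) c,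
    Measure.integral_comp_smul, finrank_euclideanSpace_fin, h1]
  have : 0 < (τ⁻¹ ^ n)⁻¹ := by positivity
  rw [abs_of_pos this, smul_eq_mul, mul_one]
  exact mul_inv_cancel₀ (by positivity)

lemma exists_moll_bound (hχ : ContDiff ℝ (⊤ : ℕ∞) χ) (hs : ∀ x, χ x ≠ 0 → ‖x‖ ≤ 1) :
    ∃ M, 0 < M ∧ ∀ c τ g, 0 < τ → |moll χ c τ g| ≤ M * τ⁻¹ ^ n ∧
      ‖fderiv ℝ (moll χ c τ) g‖ ≤ M * τ⁻¹ ^ (n + 1) := by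
  have hcs : HasCompactSupport χ := HasCompactSupport.of_support_subset_isCompact
    (isCompact_closedBall (0 : CSpace n) 1) fun p hp => by simpa using hs p hp
  obtain ⟨M1, h1⟩ := hχ.continuous.bounded_above_of_compact_support hcs
  obtain ⟨M2, h2⟩ := (hχ.continuous_fderiv top_ne_zero).bounded_above_of_compact_support
    (hcs.fderiv ℝ)
  refine ⟨max (max M1 M2) 1, by positivity, fun c τ g hτ => ⟨?_, ?_⟩⟩
  · unfold moll
    rw [abs_mul, abs_of_pos (by positivity), mul_comm]
    gcongr
    exact (h1 _).trans ((le_max_left _ _).trans (le_max_left _ _))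
  · have h3 : HasFDerivAt (moll χ c τ)
        (τ⁻¹ ^ n • (fderiv ℝ χ (τ⁻¹ • (g - c))).comp
          (τ⁻¹ • ContinuousLinearMap.id ℝ (CSpace n))) g := by
      have h4 := (hχ.differentiable top_ne_zero (τ⁻¹ • (g - c))).hasFDerivAt
      have h5 : HasFDerivAt (fun g : CSpace n => τ⁻¹ • (g - c))
        (τ⁻¹ • ContinuousLinearMap.id ℝ (CSpace n)) g :=
        ((hasFDerivAt_id g).sub_const c).const_smul τ⁻¹
      exact (h4.comp g h5).const_mul (τ⁻¹ ^ n)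
    rw [h3.fderiv, ContinuousLinearMap.comp_smul, ContinuousLinearMap.comp_id, smul_smul,
      ← pow_succ, norm_smul, Real.norm_of_nonneg (by positivity), mul_comm]
    gcongr
    exact (h2 _).trans ((le_max_right _ _).trans (le_max_left _ _))

end Average

section VectorField

variable {r n : ℕ} (G : CarnotGroup r n)

/-- A vector field pulled back along the left translation by `p`. -/
def pullField (W : CSpace n → CSpace n) (p g : CSpace n) : CSpace n :=
  fderiv ℝ (fun q => G.mul (G.inv p) q) (G.mul p g) (W (G.mul p g))

variable {W : CSpace n → CSpace n}

lemma contDiff_pullField (hW : ContDiff ℝ (⊤ : ℕ∞) W) :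
    ContDiff ℝ (⊤ : ℕ∞) (Function.uncurry (pullField G W)) := by
  have hm : ContDiff ℝ (⊤ : ℕ∞) (fun z : CSpace n × CSpace n => G.mul z.1 z.2) := G.smooth_mul
  exact ((contDiff_fderiv_left G).comp ((contDiff_inv G contDiff_fst).prodMk hm)).clm_apply
    (hW.comp hm)

lemma dvf_pullField {ω : CSpace n → ℝ} (hω : ContDiff ℝ (⊤ : ℕ∞) ω) (p g : CSpace n) :
    Dvf (pullField G W p) (fun q => ω (G.mul p q)) g = Dvf W ω (G.mul p g) := by
  have h1 : HasFDerivAt (fun q => G.mul p q) (fderiv ℝ (fun q => G.mul p q) g) g :=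
    ((contDiff_mul G contDiff_const contDiff_id).differentiable top_ne_zero g).hasFDerivAt
  have h2 : HasFDerivAt (fun q => G.mul (G.inv p) q)
      (fderiv ℝ (fun q => G.mul (G.inv p) q) (G.mul p g)) (G.mul p g) :=
    ((contDiff_mul G contDiff_const contDiff_id).differentiable top_ne_zero _).hasFDerivAt
  have h1' : HasFDerivAt (fun q => G.mul p q) (fderiv ℝ (fun q => G.mul p q) g)
      (G.mul (G.inv p) (G.mul p g)) := by rwa [inv_mul_cancel_left']
  have h3 := h1'.comp (G.mul p g) h2
  have h4 : (fun q => G.mul p q) ∘ (fun q => G.mul (G.inv p) q) = id := by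
    ext1 q; simp [mul_inv_cancel_left']
  rw [h4] at h3
  have h5 := h3.unique (hasFDerivAt_id _)
  have h6 := (hω.differentiable top_ne_zero (G.mul p g)).hasFDerivAt.comp g h1
  have h7 : fderiv ℝ (fun q => ω (G.mul p q)) g = _ := h6.fderiv
  unfold Dvf
  rw [h7]
  simp only [ContinuousLinearMap.comp_apply, pullField]
  congr 1
  exact DFunLike.congr_fun h5 (W (G.mul p g))

lemma contDiff_dvg_pullField (hW : ContDiff ℝ (⊤ : ℕ∞) W) : ContDiff ℝ (⊤ : ℕ∞)
    (fun z : CSpace n × CSpace n => dvg (pullField G W z.1) z.2) := by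
  unfold dvg
  refine ContDiff.sum fun k _ => ?_
  refine ContDiff.clm_apply (ContDiff.fderiv (m := (⊤ : ℕ∞)) (n := (⊤ : ℕ∞))
    (f := fun z : CSpace n × CSpace n => fun q => pullField G W z.1 q k) ?_ contDiff_snd
    (by simp)) contDiff_const
  have := contDiff_pullField G hW
  have h2 : ContDiff ℝ (⊤ : ℕ∞) fun y : (CSpace n × CSpace n) × CSpace n =>
    Function.uncurry (pullField G W) (y.1.1, y.2) :=
    this.comp ((contDiff_fst.comp contDiff_fst).prodMk contDiff_snd)
  exact contDiff_euclidean.1 h2 k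

lemma hasCompactSupport_mul_left {ω : CSpace n → ℝ} {ρ : ℝ} (hω : TF ρ ω) (p : CSpace n) :
    HasCompactSupport (fun q => ω (G.mul p q)) := by
  refine HasCompactSupport.of_support_subset_isCompact
    ((isCompact_closedBall (0 : CSpace n) ρ).image
      (contDiff_mul G (contDiff_const (c := G.inv p)) contDiff_id).continuous) fun q hq => ?_
  exact ⟨G.mul p q, by simpa using hω.2 _ hq, inv_mul_cancel_left' G p q⟩

/-- A function which is a first order derivative of `L²` functions is controlled by its horizontal
Sobolev norm with a small constant. -/
lemma exists_vector_field_bound (R : ℝ) (hW : ContDiff ℝ (⊤ : ℕ∞) W) :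
    ∃ (K : ℕ) (C s₀ : ℝ), 0 ≤ C ∧ 0 < s₀ ∧ s₀ ≤ 1 ∧ ∀ σ, 0 < σ → σ ≤ s₀ → ∀ v ω₀ ω₁,
      TF R v → TF R ω₀ → TF R ω₁ → (∀ p, v p = ω₀ p + Dvf W ω₁ p) →
      nrm volume v ≤ C * σ * hnorm G v + C * σ⁻¹ ^ K * (nrm volume ω₀ + nrm volume ω₁) := by
  obtain ⟨χ, hχ, hχ0, hχs, hχ1⟩ := exists_mollifier n
  obtain ⟨M, hM, HM⟩ := exists_moll_bound hχ hχs
  obtain ⟨a, ha, ha1, Ha⟩ := exists_translation_bound G R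
  obtain ⟨C, τ₀, hC, h0, h1, H⟩ := exists_tdiff_le G R
  obtain ⟨B1, hB1, HB1⟩ := exists_bound_closedBall (contDiff_pullField G hW).continuous
    ((0 : CSpace n), G.one) (max (R + 1) 1)
  obtain ⟨B2, hB2, HB2⟩ := exists_bound_closedBall (contDiff_dvg_pullField G hW).continuous
    ((0 : CSpace n), G.one) (max (R + 1) 1)
  set V1 : ℝ := volume.real (Metric.closedBall G.one 1) with hV1
  have hV : 0 ≤ V1 := measureReal_nonneg
  refine ⟨r * (n + 1), max C (max 2 (V1 * (M * (B1 + B2) * 2))), min (min a τ₀) 1, by positivity,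
    by positivity, min_le_right _ _, fun σ hσ hσ' v ω₀ ω₁ hv h₀ h₁ hvw => ?_⟩
  have hr : (r : ℝ) ≠ 0 := by exact_mod_cast G.hr.ne'
  have hσ1 : σ ≤ 1 := hσ'.trans (min_le_right _ _)
  set τ : ℝ := σ ^ r with hτ
  have hτσ : τ ≤ σ := pow_le_of_le_one hσ.le hσ1 G.hr.ne'
  have hτ0 : 0 < τ := by positivity
  have hτ1 : τ ≤ 1 := hτσ.trans hσ1
  have hτa : τ ≤ a := hτσ.trans (hσ'.trans ((min_le_left _ _).trans (min_le_left _ _)))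
  have hττ : τ ≤ τ₀ := hτσ.trans (hσ'.trans ((min_le_left _ _).trans (min_le_right _ _)))
  have hτr : τ ^ ((1 : ℝ) / r) = σ := by
    rw [hτ, ← Real.rpow_natCast, ← Real.rpow_mul hσ.le, mul_one_div_cancel hr, Real.rpow_one]
  set s : Set (CSpace n) := Metric.closedBall G.one τ with hs
  have hsc : IsCompact s := isCompact_closedBall _ _
  have hsm : ∀ {g}, g ∈ s → ‖g - G.one‖ ≤ τ := fun hg => by
    simpa [hs, dist_eq_norm] using hg
  set m : CSpace n → ℝ := moll χ G.one τ with hm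
  have hmc : ContDiff ℝ (⊤ : ℕ∞) m := contDiff_moll hχ
  have hm0 : ∀ g, 0 ≤ m g := fun g => mul_nonneg (by positivity) (hχ0 _)
  have hms : ∀ g, g ∉ s → m g = 0 := by
    intro g hg
    by_contra h
    exact hg (by simpa [hs, dist_eq_norm] using moll_support hτ0 hχs h)
  have hmi : ∀ F : CSpace n → ℝ, ∫ g in s, m g * F g = ∫ g, m g * F g := fun F =>
    setIntegral_eq_integral_of_forall_compl_eq_zero fun g hg => by simp [hms g hg]
  have hm1 : ∫ g in s, m g = 1 := by
    simpa [hm, integral_moll hτ0 hχ1] using hmi fun _ => 1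
  have hm1' : ∫ g in s, |m g| = 1 := by simpa [abs_of_nonneg (hm0 _)] using hm1
  have hcont : ∀ {w : CSpace n → ℝ}, ContDiff ℝ (⊤ : ℕ∞) w →
      ContDiff ℝ (⊤ : ℕ∞) fun z : CSpace n × CSpace n => w (G.mul z.2 z.1) := fun hw =>
    hw.comp (contDiff_mul G contDiff_snd contDiff_fst)
  have hshift : ∀ {w}, TF R w → ∀ g ∈ s, TF (R + 1) (fun p => w (G.mul p g)) ∧
      nrm volume (fun p => w (G.mul p g)) ≤ 2 * nrm volume w := fun hw g hg =>
    Ha g ((hsm hg).trans hτa) _ hw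
  have hshiftv := hshift hv
  -- the three pieces
  have q1 := nrm_setIntegral_le hsc hmc.continuous (w := fun g p => v (G.mul p g) - v p)
    ((hcont hv.1).sub (hv.1.comp contDiff_snd)).continuous (ρ := R + 1) (M := C * σ * hnorm G v)
    (by have := hnorm_nonneg G v; positivity)
    (fun g hg p hp => ((hshiftv g hg).1.sub (hv.mono (by linarith))).2 p hp)
    (fun g hg _ => by
      have := H τ hτ0 hττ g (hsm hg) v hv
      rwa [hτr] at this)
  have q2 := nrm_setIntegral_le hsc hmc.continuous (w := fun g p => ω₀ (G.mul p g))
    (hcont h₀.1).continuous (ρ := R + 1) (M := 2 * nrm volume ω₀)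
    (mul_nonneg zero_le_two nrm_nonneg)
    (fun g hg p hp => (hshift h₀ g hg).1.2 p hp) (fun g hg _ => (hshift h₀ g hg).2)
  set κ : CSpace n → CSpace n → ℝ := fun g p =>
    Dvf (pullField G W p) m g + dvg (pullField G W p) g * m g with hκ
  have hκc : Continuous (Function.uncurry κ) := by
    have e1 : Continuous fun z : CSpace n × CSpace n => fderiv ℝ m z.1 (pullField G W z.2 z.1) :=
      ((hmc.continuous_fderiv top_ne_zero).comp continuous_fst).clm_apply
        ((contDiff_pullField G hW).continuous.comp (continuous_snd.prodMk continuous_fst))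
    have e2 : Continuous fun z : CSpace n × CSpace n => dvg (pullField G W z.2) z.1 :=
      (contDiff_dvg_pullField G hW).continuous.comp (continuous_snd.prodMk continuous_fst)
    exact e1.add (e2.mul (hmc.continuous.comp continuous_fst))
  have hκb : ∀ g ∈ s, ∀ p, ‖p‖ ≤ R + 1 → |κ g p| ≤ M * (B1 + B2) * τ⁻¹ ^ (n + 1) := by
    intro g hg p hp
    have e0 : ‖((p, g) : CSpace n × CSpace n) - (0, G.one)‖ ≤ max (R + 1) 1 := by
      rw [Prod.mk_sub_mk, sub_zero, Prod.norm_mk]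
      exact max_le_max hp ((hsm hg).trans hτ1)
    obtain ⟨e1, e2⟩ := HM G.one τ g hτ0
    have e3 := HB1 _ e0
    have e4 := HB2 _ e0
    simp only [Function.uncurry_apply_pair, Real.norm_eq_abs] at e3 e4
    have e5 : |Dvf (pullField G W p) m g| ≤ M * τ⁻¹ ^ (n + 1) * B1 := by
      refine ((fderiv ℝ m g).le_opNorm _).trans ?_
      gcongr
    have e6 : |dvg (pullField G W p) g * m g| ≤ B2 * (M * τ⁻¹ ^ (n + 1)) := by
      rw [abs_mul]
      gcongr
      refine e1.trans ?_
      gcongr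
      · exact (one_le_inv₀ hτ0).2 hτ1
      · omega
    refine (abs_add_le _ _).trans ((add_le_add e5 e6).trans (le_of_eq (by ring)))
  have q3 := nrm_setIntegral_le hsc (k := fun _ => 1) continuous_const
    (w := fun g p => κ g p * ω₁ (G.mul p g))
    (hκc.mul (hcont h₁.1).continuous) (ρ := R + 1)
    (M := M * (B1 + B2) * τ⁻¹ ^ (n + 1) * (2 * nrm volume ω₁))
    (by have := nrm_nonneg (μ := volume) (f := ω₁); positivity)
    (fun g hg p hp => (hshift h₁ g hg).1.2 p (right_ne_zero_of_mul hp))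
    (fun g hg _ => by
      have e1 := hshift h₁ g hg
      refine (nrm_le_mul e1.1.memLp (c := M * (B1 + B2) * τ⁻¹ ^ (n + 1)) (by positivity)
        (Eventually.of_forall fun p => ?_)).trans (by have := e1.2; gcongr)
      rw [abs_mul]
      by_cases hp : ‖p‖ ≤ R + 1
      · gcongr
        exact hκb g hg p hp
      · have : ω₁ (G.mul p g) = 0 := by
          by_contra h
          exact hp (e1.1.2 p h)
        simp [this])
  -- decomposition of `v`
  have hdec : ∀ p, v p = (∫ g in s, m g * ω₀ (G.mul p g))
      - (∫ g in s, 1 * (κ g p * ω₁ (G.mul p g))) - ∫ g in s, m g * (v (G.mul p g) - v p) := by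
    intro p
    have hInt : ∀ {F : CSpace n → ℝ}, Continuous F → IntegrableOn F s := fun hF =>
      hF.continuousOn.integrableOn_compact hsc
    have cm := hmc.continuous
    have cshift : ∀ {w : CSpace n → ℝ}, Continuous w → Continuous fun g => w (G.mul p g) :=
      fun hw => hw.comp (contDiff_mul G contDiff_const contDiff_id).continuous
    have t1 : ∫ g in s, m g * (v (G.mul p g) - v p) = (∫ g in s, m g * v (G.mul p g)) - v p := by
      simp_rw [mul_sub]
      have i1 : IntegrableOn (fun g => m g * v (G.mul p g)) s :=
        hInt (cm.mul (cshift hv.1.continuous))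
      have i2 : IntegrableOn (fun g => m g * v p) s := hInt (cm.mul continuous_const)
      rw [integral_sub i1 i2,
        integral_mul_const, hm1, one_mul]
    have cD : Continuous (Dvf W ω₁) := (contDiff_dvf hW h₁.1).continuous
    have t2 : ∫ g in s, m g * v (G.mul p g) = (∫ g in s, m g * ω₀ (G.mul p g))
        + ∫ g in s, m g * Dvf W ω₁ (G.mul p g) := by
      have i1 : IntegrableOn (fun g => m g * ω₀ (G.mul p g)) s :=
        hInt (cm.mul (cshift h₀.1.continuous))
      have i2 : IntegrableOn (fun g => m g * Dvf W ω₁ (G.mul p g)) s := hInt (cm.mul (cshift cD))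
      rw [← integral_add i1 i2]
      simp_rw [hvw, mul_add]
    have hpf : ContDiff ℝ (⊤ : ℕ∞) (pullField G W p) :=
      (contDiff_pullField G hW).comp (contDiff_const.prodMk contDiff_id)
    have t3 : ∫ g in s, m g * Dvf W ω₁ (G.mul p g)
        = - ∫ g in s, 1 * (κ g p * ω₁ (G.mul p g)) := by
      rw [hmi]
      simp_rw [← dvf_pullField G h₁.1]
      have i1 : ContDiff ℝ (⊤ : ℕ∞) (fun q => ω₁ (G.mul p q)) :=
        h₁.1.comp (contDiff_mul G contDiff_const contDiff_id)
      rw [integral_mul_dvf hpf hmc i1 (hasCompactSupport_mul_left G h₁ p)]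
      simp only [one_mul]
      rw [setIntegral_eq_integral_of_forall_compl_eq_zero]
      intro g hg
      have e1 : fderiv ℝ m g = 0 := by
        have : m =ᶠ[𝓝 g] fun _ => 0 := by
          filter_upwards [hsc.isClosed.isOpen_compl.mem_nhds hg] with q hq using hms q hq
        rw [this.fderiv_eq]; simp
      simp [hκ, Dvf, e1, hms g hg]
    rw [t1, t2, t3]; ring
  have hcP : ∀ {w : CSpace n → CSpace n → ℝ} {k : CSpace n → ℝ}, Continuous k →
      Continuous (Function.uncurry w) → (∀ g ∈ s, ∀ p, w g p ≠ 0 → ‖p‖ ≤ R + 1) →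
      MemLp (fun p => ∫ g in s, k g * w g p) 2 volume := by
    intro w k hk hw hsup
    refine Continuous.memLp_of_hasCompactSupport ?_ (HasCompactSupport.of_support_subset_isCompact
      (isCompact_closedBall (0 : CSpace n) (R + 1)) fun p hp => ?_)
    · exact continuous_parametric_integral_of_continuous
        ((hk.comp continuous_snd).mul (hw.comp (continuous_snd.prodMk continuous_fst))) hsc
    · by_contra h
      refine hp (setIntegral_eq_zero_of_forall_eq_zero fun g hg => ?_)
      have : w g p = 0 := by by_contra h'; exact h (by simpa using hsup g hg p h')
      simp [this]
  have m1 : MemLp (fun p => ∫ g in s, m g * (v (G.mul p g) - v p)) 2 volume :=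
    hcP (w := fun g p => v (G.mul p g) - v p) hmc.continuous
      ((hcont hv.1).sub (hv.1.comp contDiff_snd)).continuous
      (fun g hg p hp => ((hshiftv g hg).1.sub (hv.mono (by linarith))).2 p hp)
  have m2 : MemLp (fun p => ∫ g in s, m g * ω₀ (G.mul p g)) 2 volume :=
    hcP (w := fun g p => ω₀ (G.mul p g)) hmc.continuous (hcont h₀.1).continuous
      (fun g hg p hp => (hshift h₀ g hg).1.2 p hp)
  have m3 : MemLp (fun p => ∫ g in s, 1 * (κ g p * ω₁ (G.mul p g))) 2 volume :=
    hcP (w := fun g p => κ g p * ω₁ (G.mul p g)) (k := fun _ => 1) continuous_const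
      (hκc.mul (hcont h₁.1).continuous)
      (fun g hg p hp => (hshift h₁ g hg).1.2 p (right_ne_zero_of_mul hp))
  have hfin : nrm volume v ≤ nrm volume (fun p => ∫ g in s, m g * ω₀ (G.mul p g))
      + nrm volume (fun p => ∫ g in s, 1 * (κ g p * ω₁ (G.mul p g)))
      + nrm volume (fun p => ∫ g in s, m g * (v (G.mul p g) - v p)) := by
    have e1 := nrm_sub_le (m2.sub m3) m1
    have e2 := nrm_sub_le m2 m3
    have e3 : v = fun p => ((fun p => ∫ g in s, m g * ω₀ (G.mul p g))
      - fun p => ∫ g in s, 1 * (κ g p * ω₁ (G.mul p g))) p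
      - ∫ g in s, m g * (v (G.mul p g) - v p) := funext hdec
    refine (le_of_eq (congrArg _ e3)).trans (e1.trans ?_)
    gcongr
    exact e2
  have hτp : τ⁻¹ ^ (n + 1) = σ⁻¹ ^ (r * (n + 1)) := by
    rw [pow_mul, inv_pow σ r]
  have hσK : 1 ≤ σ⁻¹ ^ (r * (n + 1)) := one_le_pow₀ ((one_le_inv₀ hσ).2 hσ1)
  have hvol : ∫ g in s, |(1 : ℝ)| ≤ V1 := by
    simp only [abs_one, setIntegral_const, smul_eq_mul, mul_one]
    exact measureReal_mono (Metric.closedBall_subset_closedBall hτ1)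
      measure_closedBall_lt_top.ne
  rw [hm1', one_mul] at q1 q2
  have n0 := nrm_nonneg (μ := volume) (f := ω₀)
  have n1 := nrm_nonneg (μ := volume) (f := ω₁)
  have nv := hnorm_nonneg G v
  set C' := max C (max 2 (V1 * (M * (B1 + B2) * 2))) with hC'
  have c1 : C ≤ C' := le_max_left _ _
  have c2 : 2 ≤ C' := (le_max_left _ _).trans (le_max_right _ _)
  have c3 : V1 * (M * (B1 + B2) * 2) ≤ C' := (le_max_right _ _).trans (le_max_right _ _)
  have f1 : nrm volume (fun p => ∫ g in s, m g * ω₀ (G.mul p g))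
      ≤ C' * σ⁻¹ ^ (r * (n + 1)) * nrm volume ω₀ := by
    refine q2.trans ?_
    gcongr
    nlinarith
  have f2 : nrm volume (fun p => ∫ g in s, 1 * (κ g p * ω₁ (G.mul p g)))
      ≤ C' * σ⁻¹ ^ (r * (n + 1)) * nrm volume ω₁ := by
    refine q3.trans ?_
    rw [hτp]
    calc _ ≤ V1 * (M * (B1 + B2) * σ⁻¹ ^ (r * (n + 1)) * (2 * nrm volume ω₁)) := by gcongr
      _ = V1 * (M * (B1 + B2) * 2) * σ⁻¹ ^ (r * (n + 1)) * nrm volume ω₁ := by ring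
      _ ≤ _ := by gcongr
  have f3 : C * σ * hnorm G v ≤ C' * σ * hnorm G v := by gcongr
  rw [mul_add]
  linarith

end VectorField

/-! ### Formal adjoints of vector fields -/

section Adj

variable {n : ℕ} {f g : CSpace n → ℝ} {Z Y : CSpace n → CSpace n}

/-- Minus the formal adjoint of the derivation along `Z` with respect to Lebesgue measure. -/
def adj (Z : CSpace n → CSpace n) (w : CSpace n → ℝ) : CSpace n → ℝ :=
  fun p => Dvf Z w p + dvg Z p * w p

lemma contDiff_adj (hZ : ContDiff ℝ (⊤ : ℕ∞) Z) (hf : ContDiff ℝ (⊤ : ℕ∞) f) :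
    ContDiff ℝ (⊤ : ℕ∞) (adj Z f) :=
  (contDiff_dvf hZ hf).add ((contDiff_dvg hZ).mul hf)

lemma differentiableAt_of_smooth {F : Type*} [NormedAddCommGroup F] [NormedSpace ℝ F]
    {E : Type*} [NormedAddCommGroup E] [NormedSpace ℝ E] {h : E → F}
    (hh : ContDiff ℝ (⊤ : ℕ∞) h) (x : E) : DifferentiableAt ℝ h x :=
  (hh.differentiable (by simp)) x

lemma adj_mul (hf : ContDiff ℝ (⊤ : ℕ∞) f) (hg : ContDiff ℝ (⊤ : ℕ∞) g) (x : CSpace n) :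
    adj Z (fun p => f p * g p) x = f x * adj Z g x + Dvf Z f x * g x := by
  simp only [adj]
  rw [dvf_mul (differentiableAt_of_smooth hf x) (differentiableAt_of_smooth hg x)]
  ring

lemma adj_add (hf : ContDiff ℝ (⊤ : ℕ∞) f) (hg : ContDiff ℝ (⊤ : ℕ∞) g) (x : CSpace n) :
    adj Z (fun p => f p + g p) x = adj Z f x + adj Z g x := by
  simp only [adj]
  rw [dvf_add (differentiableAt_of_smooth hf x) (differentiableAt_of_smooth hg x)]
  ring

lemma adj_const_mul (c : ℝ) (hf : ContDiff ℝ (⊤ : ℕ∞) f) (x : CSpace n) :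
    adj Z (fun p => c * f p) x = c * adj Z f x := by
  rw [adj_mul contDiff_const hf]
  simp [Dvf]

lemma adj_sum {ι : Type*} (s : Finset ι) {F : ι → CSpace n → ℝ} (x : CSpace n)
    (hF : ∀ i ∈ s, ContDiff ℝ (⊤ : ℕ∞) (F i)) :
    adj Z (fun x => ∑ i ∈ s, F i x) x = ∑ i ∈ s, adj Z (F i) x := by
  simp only [adj]
  rw [dvf_sum s fun i hi => differentiableAt_of_smooth (hF i hi) x, Finset.sum_add_distrib,
    Finset.mul_sum]

lemma integral_adj (hZ : ContDiff ℝ (⊤ : ℕ∞) Z) (hf : ContDiff ℝ (⊤ : ℕ∞) f)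
    (hg : ContDiff ℝ (⊤ : ℕ∞) g) (hc : HasCompactSupport g) :
    ∫ x, adj Z f x * g x = -∫ x, f x * Dvf Z g x := by
  rw [integral_mul_dvf hZ hf hg hc, neg_neg]
  rfl

lemma hasCompactSupport_dvf (hc : HasCompactSupport g) : HasCompactSupport (Dvf Z g) := by
  refine hc.mono' fun x hx => ?_
  by_contra h
  apply hx
  have h2 : fderiv ℝ g x = 0 := by
    by_contra h3
    exact h (support_fderiv_subset ℝ h3)
  simp [Dvf, h2]

lemma eq_of_integral_mul_eq (hf : Continuous f) (hg : Continuous g)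
    (h : ∀ φ : CSpace n → ℝ, ContDiff ℝ (⊤ : ℕ∞) φ → HasCompactSupport φ →
      ∫ x, f x * φ x = ∫ x, g x * φ x) : f = g := by
  have h1 : ∀ᵐ x, f x - g x = 0 := by
    refine ae_eq_zero_of_integral_contDiff_smul_eq_zero (hf.sub hg).locallyIntegrable
      fun φ hφ hc => ?_
    have i1 : Integrable (fun x => f x * φ x) :=
      (hf.mul hφ.continuous).integrable_of_hasCompactSupport hc.mul_left
    have i2 : Integrable (fun x => g x * φ x) :=
      (hg.mul hφ.continuous).integrable_of_hasCompactSupport hc.mul_left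
    rw [← sub_eq_zero.2 (h φ hφ hc), ← integral_sub i1 i2]
    refine integral_congr_ae (Eventually.of_forall fun x => ?_)
    simp only [smul_eq_mul]
    ring
  have h2 : f =ᵐ[volume] g := h1.mono fun x hx => sub_eq_zero.1 hx
  exact (hf.ae_eq_iff_eq volume hg).1 h2

/-- Adjoints of commuting vector fields commute. -/
lemma adj_comm (hZ : ContDiff ℝ (⊤ : ℕ∞) Z) (hY : ContDiff ℝ (⊤ : ℕ∞) Y)
    (hb : vbracket Z Y = 0) (hf : ContDiff ℝ (⊤ : ℕ∞) f) :
    adj Z (adj Y f) = adj Y (adj Z f) := by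
  refine eq_of_integral_mul_eq (contDiff_adj hZ (contDiff_adj hY hf)).continuous
    (contDiff_adj hY (contDiff_adj hZ hf)).continuous fun φ hφ hc => ?_
  rw [integral_adj hZ (contDiff_adj hY hf) hφ hc, integral_adj hY (contDiff_adj hZ hf) hφ hc,
    integral_adj hY hf (contDiff_dvf hZ hφ) (hasCompactSupport_dvf hc),
    integral_adj hZ hf (contDiff_dvf hY hφ) (hasCompactSupport_dvf hc)]
  have h : ∀ x, Dvf Y (Dvf Z φ) x = Dvf Z (Dvf Y φ) x := by
    intro x
    have := dvf_vbracket hZ hY hφ x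
    rw [hb] at this
    simp only [Dvf, Pi.zero_apply, map_zero] at this ⊢
    linarith
  simp_rw [h]

end Adj

/-! ### Right-invariant vector fields -/

section RightInvariant

variable {r n : ℕ} (G : CarnotGroup r n)

/-- The right-invariant vector field with value `e_b` at the identity. -/
def rfield (b : Fin n) : CSpace n → CSpace n :=
  fun p => fderiv ℝ (fun g => G.mul g p) G.one (EuclideanSpace.single b 1)

lemma contDiff_rfield (b : Fin n) : ContDiff ℝ (⊤ : ℕ∞) (rfield G b) := by
  have h1 := (contDiff_fderiv_right G).comp (contDiff_id.prodMk
    (contDiff_const (c := G.one)) : ContDiff ℝ (⊤ : ℕ∞) fun p : CSpace n => (p, G.one))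
  exact h1.clm_apply contDiff_const

/-- Right-invariant fields commute with left-invariant ones. -/
lemma vbracket_rfield_X (b : Fin n) (k : ℕ) (i : Fin (G.m k)) :
    vbracket (rfield G b) (G.X k i) = 0 := by
  set M : CSpace n × CSpace n → CSpace n := fun z => G.mul z.1 z.2 with hM
  have hMs : ContDiff ℝ (⊤ : ℕ∞) M := G.smooth_mul
  have hM1 : ∀ z, HasFDerivAt M (fderiv ℝ M z) z := fun z =>
    (differentiableAt_of_smooth hMs z).hasFDerivAt
  have hD : ContDiff ℝ (⊤ : ℕ∞) (fderiv ℝ M) := hMs.fderiv_right (by simp)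
  have hM2 : ∀ z, HasFDerivAt (fderiv ℝ M) (fderiv ℝ (fderiv ℝ M) z) z := fun z =>
    (differentiableAt_of_smooth hD z).hasFDerivAt
  have hl : ∀ g p v, fderiv ℝ (G.mul g) p v = fderiv ℝ M (g, p) (0, v) := by
    intro g p v
    have h := (hM1 (g, p)).comp p ((hasFDerivAt_const g p).prodMk (hasFDerivAt_id p))
    have h' : HasFDerivAt (G.mul g) _ p := h
    rw [h'.fderiv]
    simp
  have hr : ∀ g p v, fderiv ℝ (fun g => G.mul g p) g v = fderiv ℝ M (g, p) (v, 0) := by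
    intro g p v
    have h := (hM1 (g, p)).comp (f := fun g => (g, p)) g ((hasFDerivAt_id g).prodMk (hasFDerivAt_const p g))
    have h' : HasFDerivAt (fun g => G.mul g p) _ g := h
    rw [h'.fderiv]
    simp
  funext p
  set e : CSpace n := EuclideanSpace.single b 1
  set v := G.X k i p
  have h1 : fderiv ℝ (G.X k i) p (rfield G b p) =
      fderiv ℝ (fderiv ℝ M) (G.one, p) (e, 0) (0, v) := by
    have e1 : (fun g => G.X k i (G.mul g p)) = fun g => fderiv ℝ M (g, p) (0, v) := by
      funext g
      rw [G.left_invariant_X, hl]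
    have hx : HasFDerivAt (G.X k i) (fderiv ℝ (G.X k i) p) (G.mul G.one p) := by
      rw [G.one_mul']
      exact (differentiableAt_of_smooth (G.smooth_X k i) p).hasFDerivAt
    have hm : HasFDerivAt (fun g => G.mul g p) (fderiv ℝ (fun g => G.mul g p) G.one) G.one :=
      (differentiableAt_of_smooth (contDiff_mul G contDiff_id contDiff_const) G.one).hasFDerivAt
    have d1 := HasFDerivAt.comp (f := fun g => G.mul g p) G.one hx hm
    have d2 := ((hM2 (G.one, p)).comp (f := fun g => (g, p)) G.one
      ((hasFDerivAt_id G.one).prodMk (hasFDerivAt_const p G.one))).clm_apply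
      (hasFDerivAt_const (0, v) G.one)
    have d3 := d1.unique (e1 ▸ d2 : HasFDerivAt (fun g => G.X k i (G.mul g p)) _ G.one)
    have := DFunLike.congr_fun d3 e
    simpa [rfield] using this
  have h2 : fderiv ℝ (rfield G b) p v = fderiv ℝ (fderiv ℝ M) (G.one, p) (0, v) (e, 0) := by
    have e1 : rfield G b = fun q => fderiv ℝ M (G.one, q) (e, 0) := by
      funext q
      exact hr G.one q e
    have d2 := ((hM2 (G.one, p)).comp (f := fun q => (G.one, q)) p
      ((hasFDerivAt_const G.one p).prodMk (hasFDerivAt_id p))).clm_apply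
      (hasFDerivAt_const (e, (0 : CSpace n)) p)
    have d3 : HasFDerivAt (fun q => fderiv ℝ M (G.one, q) (e, 0)) _ p := d2
    rw [e1, d3.fderiv]
    simp
  have hs : IsSymmSndFDerivAt ℝ M (G.one, p) :=
    (hMs.of_le (m := 2) (WithTop.coe_le_coe.2 le_top)).contDiffAt.isSymmSndFDerivAt (by simp)
  simp only [vbracket, Pi.zero_apply]
  rw [h1, h2, hs.eq, sub_self]

end RightInvariant

section Frame

variable {r n N : ℕ} (G : CarnotGroup r n)

/-- The coordinate fields are combinations of right-invariant fields with smooth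
coefficients. -/
lemma exists_frame (k : Fin n) : ∃ c : Fin n → CSpace n → ℝ,
    (∀ b, ContDiff ℝ (⊤ : ℕ∞) (c b)) ∧ ∀ (f : CSpace n → ℝ) p,
      fderiv ℝ f p (EuclideanSpace.single k 1) = ∑ b, c b p * Dvf (rfield G b) f p := by
  refine ⟨fun b p => fderiv ℝ (fun q => G.mul q (G.inv p)) p (EuclideanSpace.single k 1) b,
    fun b => ?_, fun f p => ?_⟩
  · have h1 := (contDiff_fderiv_right G).comp (G.smooth_inv.prodMk contDiff_id :
      ContDiff ℝ (⊤ : ℕ∞) fun p : CSpace n => (G.inv p, p))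
    have h2 := h1.clm_apply (contDiff_const (c := (EuclideanSpace.single k 1 : CSpace n)))
    exact contDiff_coord h2 b
  · set e : CSpace n := EuclideanSpace.single k 1
    set w := fderiv ℝ (fun q => G.mul q (G.inv p)) p e with hw
    have h1 : HasFDerivAt (fun q => G.mul q (G.inv p))
        (fderiv ℝ (fun q => G.mul q (G.inv p)) p) p :=
      (differentiableAt_of_smooth (contDiff_mul G contDiff_id contDiff_const) p).hasFDerivAt
    have h2 : HasFDerivAt (fun g => G.mul g p) (fderiv ℝ (fun g => G.mul g p) G.one)
        (G.mul p (G.inv p)) := by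
      rw [mul_inv' G]
      exact (differentiableAt_of_smooth
        (contDiff_mul G contDiff_id contDiff_const) G.one).hasFDerivAt
    have h3 := HasFDerivAt.comp (f := fun q => G.mul q (G.inv p)) p h2 h1
    have h4 : ((fun g => G.mul g p) ∘ fun q => G.mul q (G.inv p)) = id := by
      funext q
      simp [inv_mul_cancel_right' G]
    rw [h4] at h3
    have h5 := DFunLike.congr_fun (h3.unique (hasFDerivAt_id p)) e
    have h6 : fderiv ℝ (fun g => G.mul g p) G.one w = e := h5
    have h7 := clm_eq_sum ((fderiv ℝ f p).comp (fderiv ℝ (fun g => G.mul g p) G.one)) w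
    simp only [ContinuousLinearMap.comp_apply, h6] at h7
    rw [h7]
    rfl

/-- The second order operator of the system, in divergence form. -/
def Lop (A : Fin N → Fin N → Fin (G.m 1) → Fin (G.m 1) → ℝ) (u : Fin N → CSpace n → ℝ)
    (α : Fin N) : CSpace n → ℝ :=
  fun p => ∑ β, ∑ i, ∑ j, A α β i j * adj (G.X 1 i) (adj (G.X 1 j) (u β)) p

variable {A : Fin N → Fin N → Fin (G.m 1) → Fin (G.m 1) → ℝ} {u : Fin N → CSpace n → ℝ}

lemma contDiff_Lop (hu : ∀ β, ContDiff ℝ (⊤ : ℕ∞) (u β)) (α : Fin N) :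
    ContDiff ℝ (⊤ : ℕ∞) (Lop G A u α) := by
  unfold Lop
  refine ContDiff.sum fun β _ => ContDiff.sum fun i _ => ContDiff.sum fun j _ => ?_
  exact contDiff_const.mul (contDiff_adj (G.smooth_X 1 i) (contDiff_adj (G.smooth_X 1 j) (hu β)))

lemma adj_Lop (hu : ∀ β, ContDiff ℝ (⊤ : ℕ∞) (u β)) (b : Fin n) (α : Fin N) :
    adj (rfield G b) (Lop G A u α) = Lop G A (fun β => adj (rfield G b) (u β)) α := by
  have hs : ∀ β i j, ContDiff ℝ (⊤ : ℕ∞) (adj (G.X 1 i) (adj (G.X 1 j) (u β))) := fun β i j =>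
    contDiff_adj (G.smooth_X 1 i) (contDiff_adj (G.smooth_X 1 j) (hu β))
  funext p
  unfold Lop
  rw [adj_sum _ _ fun β _ => ContDiff.sum fun i _ => ContDiff.sum fun j _ =>
    contDiff_const.mul (hs β i j)]
  refine Finset.sum_congr rfl fun β _ => ?_
  rw [adj_sum _ _ fun i _ => ContDiff.sum fun j _ => contDiff_const.mul (hs β i j)]
  refine Finset.sum_congr rfl fun i _ => ?_
  rw [adj_sum _ _ fun j _ => contDiff_const.mul (hs β i j)]
  refine Finset.sum_congr rfl fun j _ => ?_
  rw [adj_const_mul _ (hs β i j),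
    adj_comm (contDiff_rfield G b) (G.smooth_X 1 i) (vbracket_rfield_X G b 1 i)
      (contDiff_adj (G.smooth_X 1 j) (hu β)),
    adj_comm (contDiff_rfield G b) (G.smooth_X 1 j) (vbracket_rfield_X G b 1 j) (hu β)]

end Frame

/-! ### Cutoff functions -/

/-- Smooth cutoff functions between concentric balls, with a quantitative bound. -/
lemma exists_cutoff {n : ℕ} (x₀ : CSpace n) : ∃ C : ℝ, 0 < C ∧ ∀ ρ s : ℝ, 0 < ρ →
    ρ < s → ∃ ζ : CSpace n → ℝ, ContDiff ℝ (⊤ : ℕ∞) ζ ∧ (∀ x, 0 ≤ ζ x) ∧ (∀ x, ζ x ≤ 1) ∧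
      (∀ x, x ∈ Metric.ball x₀ ρ → ζ x = 1) ∧ (∀ x, ζ x ≠ 0 → x ∈ Metric.ball x₀ s) ∧
      (∀ x, x ∉ Metric.ball x₀ s → fderiv ℝ ζ x = 0) ∧
      ∀ x, ‖fderiv ℝ ζ x‖ ≤ C / (s - ρ) := by
  have hθ : ContDiff ℝ (⊤ : ℕ∞) Real.smoothTransition := Real.smoothTransition.contDiff
  obtain ⟨C, hC0, hC⟩ := exists_bound_closedBall
    (hθ.continuous_deriv (by simp)) 0 1
  refine ⟨2 * C, by positivity, fun ρ s hρ hs => ?_⟩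
  have hd : 0 < s ^ 2 - ρ ^ 2 := by nlinarith
  have hs0 : 0 < s := hρ.trans hs
  set τ : CSpace n → ℝ := fun x => (‖x - x₀‖ ^ 2 - ρ ^ 2) / (s ^ 2 - ρ ^ 2) with hτ
  set ζ : CSpace n → ℝ := fun x => 1 - Real.smoothTransition (τ x) with hζ
  have hin : ContDiff ℝ (⊤ : ℕ∞) (fun x : CSpace n => ‖x - x₀‖ ^ 2) :=
    (contDiff_norm_sq ℝ).comp (contDiff_id.sub contDiff_const)
  have hτs : ContDiff ℝ (⊤ : ℕ∞) τ := (hin.sub contDiff_const).div_const _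
  have hζs : ContDiff ℝ (⊤ : ℕ∞) ζ := contDiff_const.sub (hθ.comp hτs)
  have h0 : ∀ x, 0 ≤ ζ x := fun x => sub_nonneg.2 (Real.smoothTransition.le_one _)
  have hsupp : ∀ x, x ∉ Metric.ball x₀ s → ζ x = 0 := by
    intro x hx
    have hx' : s ≤ ‖x - x₀‖ := by simpa [dist_eq_norm] using hx
    have : 1 ≤ τ x := by
      rw [hτ]
      simp only
      rw [one_le_div hd]
      have : s ^ 2 ≤ ‖x - x₀‖ ^ 2 := by gcongr
      linarith
    simp [hζ, Real.smoothTransition.one_of_one_le this]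
  have hout : ∀ x, x ∉ Metric.ball x₀ s → fderiv ℝ ζ x = 0 := fun x hx =>
    IsLocalMin.fderiv_eq_zero (Eventually.of_forall fun y => by rw [hsupp x hx]; exact h0 y)
  refine ⟨ζ, hζs, h0, fun x => ?_, fun x hx => ?_, fun x hx => ?_, hout, fun x => ?_⟩
  · have := Real.smoothTransition.nonneg (τ x)
    simp only [hζ]
    linarith
  · have hx' : ‖x - x₀‖ < ρ := by simpa [dist_eq_norm] using hx
    have : τ x ≤ 0 := by
      rw [hτ]
      simp only
      refine div_nonpos_of_nonpos_of_nonneg ?_ hd.le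
      have : ‖x - x₀‖ ^ 2 ≤ ρ ^ 2 := by gcongr
      linarith
    simp [hζ, Real.smoothTransition.zero_of_nonpos this]
  · by_contra h
    exact hx (hsupp x h)
  · have hsρ : 0 < s - ρ := sub_pos.2 hs
    by_cases hx : x ∈ Metric.ball x₀ s
    swap
    · rw [hout x hx, norm_zero]
      positivity
    by_cases hx2 : ζ x = 1
    · have : fderiv ℝ ζ x = 0 := IsLocalMax.fderiv_eq_zero (Eventually.of_forall fun y => by
        rw [hx2]
        have := Real.smoothTransition.nonneg (τ y)
        simp only [hζ]
        linarith)
      rw [this, norm_zero]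
      positivity
    have hx' : ‖x - x₀‖ < s := by simpa [dist_eq_norm] using hx
    have ht0 : 0 ≤ τ x := by
      by_contra h
      exact hx2 (by simp [hζ, Real.smoothTransition.zero_of_nonpos (not_le.1 h).le])
    have ht1 : τ x ≤ 1 := by
      rw [hτ]
      simp only
      rw [div_le_one hd]
      have : ‖x - x₀‖ ^ 2 ≤ s ^ 2 := by gcongr
      linarith
    have hb : ‖deriv Real.smoothTransition (τ x)‖ ≤ C :=
      hC _ (by rw [sub_zero, Real.norm_eq_abs, abs_of_nonneg ht0]; exact ht1)
    have hn : HasFDerivAt (fun y : CSpace n => ‖y - x₀‖ ^ 2)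
        (2 • (innerSL ℝ (x - x₀))) x := by
      have h := (hasStrictFDerivAt_norm_sq (x - x₀)).hasFDerivAt.comp
        (f := fun y : CSpace n => y - x₀) x ((hasFDerivAt_id x).sub_const x₀)
      exact h
    have hτd : HasFDerivAt τ ((s ^ 2 - ρ ^ 2)⁻¹ • (2 • (innerSL ℝ (x - x₀)))) x := by
      have h := (hn.sub_const (ρ ^ 2)).const_mul (s ^ 2 - ρ ^ 2)⁻¹
      refine h.congr_of_eventuallyEq (Eventually.of_forall fun y => ?_)
      simp only [hτ]
      ring
    have hζd : HasFDerivAt ζ (-(deriv Real.smoothTransition (τ x) •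
        ((s ^ 2 - ρ ^ 2)⁻¹ • (2 • (innerSL ℝ (x - x₀)))))) x :=
      ((differentiableAt_of_smooth hθ (τ x)).hasDerivAt.comp_hasFDerivAt x hτd).const_sub 1
    rw [hζd.fderiv, norm_neg, norm_smul, norm_smul, ← Nat.cast_smul_eq_nsmul ℝ, norm_smul,
      innerSL_apply_norm, Real.norm_of_nonneg (inv_nonneg.2 hd.le)]
    have e : (s ^ 2 - ρ ^ 2)⁻¹ = (s - ρ)⁻¹ * (s + ρ)⁻¹ := by
      rw [← mul_inv]
      congr 1
      ring
    rw [e]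
    have h3 : (s + ρ)⁻¹ * ‖x - x₀‖ ≤ 1 := by
      rw [inv_mul_le_iff₀ (by linarith)]
      linarith
    have h4 : ‖((2 : ℕ) : ℝ)‖ = 2 := by norm_num
    rw [h4]
    calc ‖deriv Real.smoothTransition (τ x)‖ * ((s - ρ)⁻¹ * (s + ρ)⁻¹ * (2 * ‖x - x₀‖))
        = 2 * ‖deriv Real.smoothTransition (τ x)‖ * (s - ρ)⁻¹ * ((s + ρ)⁻¹ * ‖x - x₀‖) := by ring
      _ ≤ 2 * C * (s - ρ)⁻¹ * 1 := by gcongr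
      _ = 2 * C / (s - ρ) := by rw [mul_one, div_eq_mul_inv]

/-! ### `L²` norms on balls -/

section Ball

variable {n : ℕ} {x₀ : CSpace n} {s : ℝ} {f w : CSpace n → ℝ}

/-- The `L²` norm over a ball. -/
def nB (x₀ : CSpace n) (s : ℝ) (f : CSpace n → ℝ) : ℝ :=
  nrm (volume.restrict (Metric.ball x₀ s)) f

lemma nB_nonneg : 0 ≤ nB x₀ s f := nrm_nonneg

lemma memLp_ball (hw : Continuous w) : MemLp w 2 (volume.restrict (Metric.ball x₀ s)) := by
  obtain ⟨C, -, hC⟩ := exists_bound_closedBall hw x₀ s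
  have : IsFiniteMeasure (volume.restrict (Metric.ball x₀ s)) :=
    ⟨by simpa using measure_ball_lt_top⟩
  refine MemLp.of_bound hw.aestronglyMeasurable C ?_
  refine (ae_restrict_iff' measurableSet_ball).2 (Eventually.of_forall fun x hx => hC x ?_)
  rw [← dist_eq_norm]
  exact (Metric.mem_ball.1 hx).le

lemma nrm_le_nB {c : ℝ} (hc : 0 ≤ c) (hw : Continuous w)
    (h0 : ∀ x, x ∉ Metric.ball x₀ s → f x = 0)
    (h : ∀ x, x ∈ Metric.ball x₀ s → |f x| ≤ c * |w x|) : nrm volume f ≤ c * nB x₀ s w := by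
  have h1 : nrm volume f = nrm (volume.restrict (Metric.ball x₀ s)) f := by
    unfold nrm
    rw [← eLpNorm_indicator_eq_eLpNorm_restrict measurableSet_ball]
    congr 2
    funext x
    by_cases hx : x ∈ Metric.ball x₀ s
    · rw [Set.indicator_of_mem hx]
    · rw [Set.indicator_of_notMem hx, h0 x hx]
  rw [h1]
  exact nrm_le_mul (memLp_ball hw) hc
    ((ae_restrict_iff' measurableSet_ball).2 (Eventually.of_forall h))

lemma nB_le_nrm (hf : MemLp f 2 volume) (h : ∀ x, x ∈ Metric.ball x₀ s → |w x| ≤ |f x|) :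
    nB x₀ s w ≤ nrm volume f := by
  refine (nrm_mono (hf.restrict _)
    ((ae_restrict_iff' measurableSet_ball).2 (Eventually.of_forall h))).trans ?_
  exact toReal_mono hf.eLpNorm_ne_top (eLpNorm_mono_measure _ Measure.restrict_le_self)

lemma nB_mono_radius {s' : ℝ} (hs : s ≤ s') (hw : Continuous w) : nB x₀ s w ≤ nB x₀ s' w :=
  toReal_mono (memLp_ball hw).eLpNorm_ne_top
    (eLpNorm_mono_measure _ (Measure.restrict_mono (Metric.ball_subset_ball hs) le_rfl))

end Ball

/-! ### The Caccioppoli inequality -/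

section Caccioppoli

variable {r n N : ℕ} (G : CarnotGroup r n)

lemma sum_nrm_sq_le_integral {A : Fin N → Fin N → Fin (G.m 1) → Fin (G.m 1) → ℝ} {lam : ℝ}
    (hco : G.Coercive lam A) {F : Fin N → Fin (G.m 1) → CSpace n → ℝ}
    (hF : ∀ α i, MemLp (F α i) 2 volume) :
    lam * ∑ α, ∑ i, nrm volume (F α i) ^ 2 ≤
      ∑ α, ∑ β, ∑ i, ∑ j, A α β i j * ∫ x, F α i x * F β j x := by
  have hi : ∀ α β i j, Integrable (fun x => F α i x * F β j x) := fun α β i j =>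
    (hF α i).integrable_mul (hF β j)
  have h1 : lam * ∑ α, ∑ i, nrm volume (F α i) ^ 2 =
      ∫ x, lam * ∑ α, ∑ i, F α i x ^ 2 := by
    rw [integral_const_mul, integral_finsetSum _ fun α _ => integrable_finsetSum _ fun i _ =>
      (hF α i).integrable_sq]
    congr 1
    refine Finset.sum_congr rfl fun α _ => ?_
    rw [integral_finsetSum _ fun i _ => (hF α i).integrable_sq]
    exact Finset.sum_congr rfl fun i _ => nrm_sq (hF α i)
  have h2 : ∑ α, ∑ β, ∑ i, ∑ j, A α β i j * ∫ x, F α i x * F β j x =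
      ∫ x, ∑ α, ∑ β, ∑ i, ∑ j, A α β i j * F α i x * F β j x := by
    have hi' : ∀ α β i j, Integrable (fun x => A α β i j * F α i x * F β j x) := fun α β i j => by
      simpa only [mul_assoc] using (hi α β i j).const_mul (A α β i j)
    rw [integral_finsetSum _ fun α _ => integrable_finsetSum _ fun β _ =>
      integrable_finsetSum _ fun i _ => integrable_finsetSum _ fun j _ => hi' α β i j]
    refine Finset.sum_congr rfl fun α _ => ?_
    rw [integral_finsetSum _ fun β _ =>
      integrable_finsetSum _ fun i _ => integrable_finsetSum _ fun j _ => hi' α β i j]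
    refine Finset.sum_congr rfl fun β _ => ?_
    rw [integral_finsetSum _ fun i _ => integrable_finsetSum _ fun j _ => hi' α β i j]
    refine Finset.sum_congr rfl fun i _ => ?_
    rw [integral_finsetSum _ fun j _ => hi' α β i j]
    refine Finset.sum_congr rfl fun j _ => ?_
    rw [← integral_const_mul]
    simp only [mul_assoc]
  rw [h1, h2]
  refine integral_mono ?_ ?_ fun x => hco fun α i => F α i x
  · exact (integrable_finsetSum _ fun α _ => integrable_finsetSum _ fun i _ =>
      (hF α i).integrable_sq).const_mul lam
  · refine integrable_finsetSum _ fun α _ => integrable_finsetSum _ fun β _ =>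
      integrable_finsetSum _ fun i _ => integrable_finsetSum _ fun j _ => ?_
    simpa only [mul_assoc] using (hi α β i j).const_mul (A α β i j)

lemma le_mul_of_sq_le {S P a lam M : ℝ} (hlam : 0 < lam) (hM : 0 < M) (ha : 0 ≤ a) (hS : 0 ≤ S)
    (hP : 0 ≤ P) (h : lam * S ^ 2 ≤ M * (a * (P * S + P ^ 2))) :
    S ≤ (M * a / lam * 2 + 1) * P := by
  set q := M * a / lam with hq
  have hq0 : 0 ≤ q := by positivity
  have h1 : S ^ 2 ≤ q * (P * S + P ^ 2) := by
    have : S ^ 2 ≤ M * (a * (P * S + P ^ 2)) / lam := by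
      rw [le_div_iff₀ hlam]
      linarith
    refine this.trans (le_of_eq ?_)
    rw [hq]
    ring
  by_contra hlt
  push Not at hlt
  have h2 : P ≤ S := by nlinarith [mul_nonneg hq0 hP]
  have h3 : q * (P * S + P ^ 2) ≤ q * 2 * P * S := by nlinarith [mul_nonneg hq0 hP]
  have h4 : 0 < S := lt_of_le_of_lt (by positivity) hlt
  nlinarith

set_option maxHeartbeats 2000000 in
/-- The Caccioppoli inequality. -/
lemma exists_caccioppoli {A : Fin N → Fin N → Fin (G.m 1) → Fin (G.m 1) → ℝ} {lam : ℝ}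
    (hlam : 0 < lam) (hco : G.Coercive lam A) (x₀ : CSpace n) (R : ℝ) :
    ∃ C : ℝ, 0 < C ∧ ∀ (s K : ℝ) (ζ : CSpace n → ℝ), s ≤ R → 1 ≤ K → ContDiff ℝ (⊤ : ℕ∞) ζ →
      (∀ x, 0 ≤ ζ x) → (∀ x, ζ x ≤ 1) → (∀ x, ζ x ≠ 0 → x ∈ Metric.ball x₀ s) →
      (∀ x, x ∉ Metric.ball x₀ s → fderiv ℝ ζ x = 0) → (∀ x, ‖fderiv ℝ ζ x‖ ≤ K) →
      ∀ w : Fin N → CSpace n → ℝ, (∀ α, ContDiff ℝ (⊤ : ℕ∞) (w α)) →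
        ∑ α, ∑ i, nrm volume (G.D 1 i fun x => ζ x * w α x) ≤
          C * (K * ∑ β, nB x₀ s (w β) + ∑ β, nB x₀ s (Lop G A w β)) := by
  -- bounds for the coefficients
  have hb : ∀ i : Fin (G.m 1), ∃ C : ℝ, 0 < C ∧ ∀ x, ‖x - x₀‖ ≤ R →
      ‖G.X 1 i x‖ ≤ C ∧ |dvg (G.X 1 i) x| ≤ C := by
    intro i
    obtain ⟨C1, h1, H1⟩ := exists_bound_closedBall (G.smooth_X 1 i).continuous x₀ R
    obtain ⟨C2, h2, H2⟩ := exists_bound_closedBall (contDiff_dvg (G.smooth_X 1 i)).continuous x₀ R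
    exact ⟨max C1 C2, lt_max_of_lt_left h1, fun x hx =>
      ⟨(H1 x hx).trans (le_max_left _ _), (H2 x hx).trans (le_max_right _ _)⟩⟩
  choose B hB0 hB using hb
  set b : ℝ := 2 * (∑ i, B i) + 1 with hbdef
  have hBb : ∀ i, B i + B i ≤ b := fun i => by
    have := Finset.single_le_sum (f := B) (fun i _ => (hB0 i).le) (Finset.mem_univ i)
    linarith
  have hb1 : 1 ≤ b := by
    have : 0 ≤ ∑ i, B i := Finset.sum_nonneg fun i _ => (hB0 i).le
    linarith
  set a : ℝ := 2 * (∑ α, ∑ β, ∑ i, ∑ j, |A α β i j|) + 1 with ha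
  have hasum : 0 ≤ ∑ α, ∑ β, ∑ i, ∑ j, |A α β i j| :=
    Finset.sum_nonneg fun α _ => Finset.sum_nonneg fun β _ => Finset.sum_nonneg fun i _ =>
      Finset.sum_nonneg fun j _ => abs_nonneg _
  have ha0 : 0 ≤ a := by linarith
  set M : ℝ := ((Finset.univ : Finset (Fin N × Fin (G.m 1))).card : ℝ) + 1 with hMdef
  have hM : 0 < M := by positivity
  refine ⟨(M * a / lam * 2 + 1) * b, by positivity,
    fun s K ζ hs hK hζ hζ0 hζ1 hsupp hout hDζ w hw => ?_⟩
  have hin : ∀ x, x ∈ Metric.ball x₀ s → ‖x - x₀‖ ≤ R := fun x hx => by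
    rw [← dist_eq_norm]
    exact (Metric.mem_ball.1 hx).le.trans hs
  have hζz : ∀ x, x ∉ Metric.ball x₀ s → ζ x = 0 := fun x hx => by
    by_contra h
    exact hx (hsupp x h)
  have hζc : HasCompactSupport ζ :=
    HasCompactSupport.of_support_subset_isCompact (isCompact_closedBall x₀ s)
      fun x hx => Metric.ball_subset_closedBall (hsupp x hx)
  set v : Fin N → CSpace n → ℝ := fun α x => ζ x * w α x with hv
  have hvs : ∀ α, ContDiff ℝ (⊤ : ℕ∞) (v α) := fun α => hζ.mul (hw α)
  have hvc : ∀ α, HasCompactSupport (v α) := fun α => hζc.mul_right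
  set F : Fin N → Fin (G.m 1) → CSpace n → ℝ := fun α i => Dvf (G.X 1 i) (v α) with hF
  have hFs : ∀ α i, ContDiff ℝ (⊤ : ℕ∞) (F α i) := fun α i => contDiff_dvf (G.smooth_X 1 i) (hvs α)
  have hFm : ∀ α i, MemLp (F α i) 2 volume := fun α i =>
    (hFs α i).continuous.memLp_of_hasCompactSupport (hasCompactSupport_dvf (hvc α))
  -- the zeroth order errors
  set g : Fin (G.m 1) → CSpace n → ℝ := fun i => Dvf (G.X 1 i) ζ with hg
  have hgs : ∀ i, ContDiff ℝ (⊤ : ℕ∞) (g i) := fun i => contDiff_dvf (G.smooth_X 1 i) hζ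
  set e : Fin N → Fin (G.m 1) → CSpace n → ℝ := fun β j x =>
    (dvg (G.X 1 j) x * ζ x - g j x) * w β x with he
  have hes : ∀ β j, ContDiff ℝ (⊤ : ℕ∞) (e β j) := fun β j =>
    (((contDiff_dvg (G.smooth_X 1 j)).mul hζ).sub (hgs j)).mul (hw β)
  have hgc : ∀ j, HasCompactSupport (g j) := fun j => hasCompactSupport_dvf hζc
  have hgB : ∀ j x, |g j x| ≤ K * B j ∨ x ∉ Metric.ball x₀ s := by
    intro j x
    by_cases hx : x ∈ Metric.ball x₀ s
    · left
      exact ((fderiv ℝ ζ x).le_opNorm _).trans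
        (mul_le_mul (hDζ x) (hB j x (hin x hx)).1 (norm_nonneg _) (by linarith))
    · exact Or.inr hx
  have hg0 : ∀ j x, x ∉ Metric.ball x₀ s → g j x = 0 := fun j x hx => by
    simp [hg, Dvf, hout x hx]
  have hec : ∀ β j, HasCompactSupport (e β j) := fun β j =>
    HasCompactSupport.of_support_subset_isCompact (isCompact_closedBall x₀ s) fun x hx => by
      by_contra h
      have hx' : x ∉ Metric.ball x₀ s := fun h' => h (Metric.ball_subset_closedBall h')
      exact hx (by simp [he, hζz x hx', hg0 j x hx'])
  have hem : ∀ β j, MemLp (e β j) 2 volume := fun β j =>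
    (hes β j).continuous.memLp_of_hasCompactSupport (hec β j)
  set U : ℝ := ∑ β, nB x₀ s (w β) with hU
  set Dd : ℝ := ∑ β, nB x₀ s (Lop G A w β) with hDd
  set S : ℝ := ∑ α, ∑ i, nrm volume (F α i) with hS
  have hU0 : 0 ≤ U := Finset.sum_nonneg fun _ _ => nB_nonneg
  have hD0 : 0 ≤ Dd := Finset.sum_nonneg fun _ _ => nB_nonneg
  have hS0 : 0 ≤ S := Finset.sum_nonneg fun _ _ => Finset.sum_nonneg fun _ _ => nrm_nonneg
  have hwU : ∀ β, nB x₀ s (w β) ≤ U := fun β =>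
    Finset.single_le_sum (f := fun β => nB x₀ s (w β)) (fun _ _ => nB_nonneg) (Finset.mem_univ β)
  have hLD : ∀ β, nB x₀ s (Lop G A w β) ≤ Dd := fun β =>
    Finset.single_le_sum (f := fun β => nB x₀ s (Lop G A w β)) (fun _ _ => nB_nonneg)
      (Finset.mem_univ β)
  have hFS : ∀ α i, nrm volume (F α i) ≤ S := fun α i =>
    (Finset.single_le_sum (f := fun i => nrm volume (F α i)) (fun _ _ => nrm_nonneg)
      (Finset.mem_univ i)).trans
    (Finset.single_le_sum (f := fun α => ∑ i, nrm volume (F α i))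
      (fun _ _ => Finset.sum_nonneg fun _ _ => nrm_nonneg) (Finset.mem_univ α))
  set P : ℝ := b * (K * U + Dd) with hP
  have hKU : 0 ≤ K * U := mul_nonneg (by linarith) hU0
  have hP0 : 0 ≤ P := mul_nonneg (by linarith) (by linarith)
  have hKUP : b * K * U ≤ P := by
    rw [hP]
    nlinarith
  have hgw : ∀ α i, nrm volume (fun x => g i x * w α x) ≤ P := by
    intro α i
    refine (nrm_le_nB (x₀ := x₀) (s := s) (c := b * K) (by positivity) (hw α).continuous (fun x hx => ?_)
      fun x hx => ?_).trans ?_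
    · simp [hg0 i x hx]
    · rw [abs_mul]
      have h1 := (hgB i x).resolve_right (not_not.2 hx)
      have h2 : K * B i ≤ b * K := by
        have := hBb i
        have := (hB0 i).le
        nlinarith
      gcongr
      exact h1.trans h2
    · refine le_trans ?_ hKUP
      have := hwU α
      gcongr
  have hen : ∀ β j, nrm volume (e β j) ≤ P := by
    intro β j
    refine (nrm_le_nB (x₀ := x₀) (s := s) (c := b * K) (by positivity) (hw β).continuous (fun x hx => ?_)
      fun x hx => ?_).trans ?_
    · simp [he, hζz x hx, hg0 j x hx]
    · simp only [he]
      rw [abs_mul]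
      have h1 := (hgB j x).resolve_right (not_not.2 hx)
      have h3 : |dvg (G.X 1 j) x * ζ x| ≤ K * B j := by
        rw [abs_mul, abs_of_nonneg (hζ0 x)]
        calc |dvg (G.X 1 j) x| * ζ x ≤ B j * 1 :=
              mul_le_mul (hB j x (hin x hx)).2 (hζ1 x) (hζ0 x) (hB0 j).le
          _ ≤ K * B j := by nlinarith [hB0 j]
      have h2 : K * B j + K * B j ≤ b * K := by
        have := hBb j
        nlinarith
      gcongr
      exact (abs_sub _ _).trans (by linarith)
    · refine le_trans ?_ hKUP
      have := hwU β
      gcongr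
  -- the pointwise identity
  have hid : ∀ α β i j x, F α i x * F β j x =
      adj (G.X 1 j) (w β) x * Dvf (G.X 1 i) (fun y => ζ y * v α y) x
        - (g i x * w α x) * F β j x - (g i x * w α x) * e β j x - F α i x * e β j x := by
    intro α β i j x
    have d1 : Dvf (G.X 1 i) (fun y => ζ y * v α y) x = g i x * v α x + ζ x * F α i x :=
      dvf_mul (differentiableAt_of_smooth hζ x) (differentiableAt_of_smooth (hvs α) x)
    have d2 : F β j x = g j x * w β x + ζ x * Dvf (G.X 1 j) (w β) x :=
      dvf_mul (differentiableAt_of_smooth hζ x) (differentiableAt_of_smooth (hw β) x)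
    rw [d1, d2]
    simp only [he, hv, adj]
    ring
  have hgwm : ∀ α i, MemLp (fun x => g i x * w α x) 2 volume := fun α i =>
    ((hgs i).mul (hw α)).continuous.memLp_of_hasCompactSupport (hgc i).mul_right
  have hInt : ∀ α β i j, |(∫ x, F α i x * F β j x) +
      ∫ x, adj (G.X 1 i) (adj (G.X 1 j) (w β)) x * (ζ x * v α x)| ≤ 2 * (P * S + P ^ 2) := by
    intro α β i j
    have hζv : ContDiff ℝ (⊤ : ℕ∞) (fun y => ζ y * v α y) := hζ.mul (hvs α)
    have hζvc : HasCompactSupport (fun y => ζ y * v α y) := hζc.mul_right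
    have i0 : Integrable (fun x => adj (G.X 1 j) (w β) x * Dvf (G.X 1 i)
        (fun y => ζ y * v α y) x) :=
      ((contDiff_adj (G.smooth_X 1 j) (hw β)).mul
        (contDiff_dvf (G.smooth_X 1 i) hζv)).continuous.integrable_of_hasCompactSupport
        (hasCompactSupport_dvf hζvc).mul_left
    have i1 : Integrable (fun x => (g i x * w α x) * F β j x) :=
      (hgwm α i).integrable_mul (hFm β j)
    have i2 : Integrable (fun x => (g i x * w α x) * e β j x) :=
      (hgwm α i).integrable_mul (hem β j)
    have i3 : Integrable (fun x => F α i x * e β j x) := (hFm α i).integrable_mul (hem β j)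
    have i01 : Integrable (fun x => adj (G.X 1 j) (w β) x * Dvf (G.X 1 i)
        (fun y => ζ y * v α y) x - (g i x * w α x) * F β j x) := i0.sub i1
    have i012 : Integrable (fun x => adj (G.X 1 j) (w β) x * Dvf (G.X 1 i)
        (fun y => ζ y * v α y) x - (g i x * w α x) * F β j x - (g i x * w α x) * e β j x) :=
      i01.sub i2
    simp_rw [hid α β i j]
    rw [integral_sub i012 i3, integral_sub i01 i2, integral_sub i0 i1,
      integral_adj (G.smooth_X 1 i) (contDiff_adj (G.smooth_X 1 j) (hw β)) hζv hζvc]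
    have b1 := abs_integral_mul_le (hgwm α i) (hFm β j)
    have b2 := abs_integral_mul_le (hgwm α i) (hem β j)
    have b3 := abs_integral_mul_le (hFm α i) (hem β j)
    have c1 : nrm volume (fun x => g i x * w α x) * nrm volume (F β j) ≤ P * S :=
      mul_le_mul (hgw α i) (hFS β j) nrm_nonneg hP0
    have c2 : nrm volume (fun x => g i x * w α x) * nrm volume (e β j) ≤ P * P :=
      mul_le_mul (hgw α i) (hen β j) nrm_nonneg hP0
    have c3 : nrm volume (F α i) * nrm volume (e β j) ≤ S * P :=
      mul_le_mul (hFS α i) (hen β j) nrm_nonneg hS0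
    have hPP : 0 ≤ P * P := mul_nonneg hP0 hP0
    rw [abs_le] at b1 b2 b3 ⊢
    constructor <;> nlinarith
  have hmain : ∑ α, ∑ β, ∑ i, ∑ j, A α β i j *
      ∫ x, adj (G.X 1 i) (adj (G.X 1 j) (w β)) x * (ζ x * v α x) =
      ∑ α, ∫ x, (ζ x * Lop G A w α x) * v α x := by
    refine Finset.sum_congr rfl fun α _ => ?_
    have hi : ∀ β i j, Integrable (fun x => A α β i j *
        adj (G.X 1 i) (adj (G.X 1 j) (w β)) x * (ζ x * v α x)) := fun β i j =>
      ((contDiff_const.mul (contDiff_adj (G.smooth_X 1 i)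
        (contDiff_adj (G.smooth_X 1 j) (hw β)))).mul
        (hζ.mul (hvs α))).continuous.integrable_of_hasCompactSupport hζc.mul_right.mul_left
    have e1 : ∀ x, (ζ x * Lop G A w α x) * v α x = ∑ β, ∑ i, ∑ j, A α β i j *
        adj (G.X 1 i) (adj (G.X 1 j) (w β)) x * (ζ x * v α x) := by
      intro x
      simp only [Lop, ← Finset.sum_mul]
      ring
    simp_rw [e1]
    rw [integral_finsetSum _ fun β _ =>
      integrable_finsetSum _ fun i _ => integrable_finsetSum _ fun j _ => hi β i j]
    refine Finset.sum_congr rfl fun β _ => ?_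
    rw [integral_finsetSum _ fun i _ => integrable_finsetSum _ fun j _ => hi β i j]
    refine Finset.sum_congr rfl fun i _ => ?_
    rw [integral_finsetSum _ fun j _ => hi β i j]
    refine Finset.sum_congr rfl fun j _ => ?_
    rw [← integral_const_mul]
    simp only [mul_assoc]
  have hLU : |∑ α, ∫ x, (ζ x * Lop G A w α x) * v α x| ≤ P ^ 2 := by
    have hb1' : ∀ α, |∫ x, (ζ x * Lop G A w α x) * v α x| ≤ Dd * nB x₀ s (w α) := by
      intro α
      have hl := (hζ.mul (contDiff_Lop (A := A) G hw α)).continuous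
      have m1 : MemLp (fun x => ζ x * Lop G A w α x) 2 volume :=
        hl.memLp_of_hasCompactSupport hζc.mul_right
      have m2 : MemLp (v α) 2 volume := (hvs α).continuous.memLp_of_hasCompactSupport (hvc α)
      have b1 := abs_integral_mul_le m1 m2
      have hζa : ∀ x (y : ℝ), |ζ x * y| ≤ 1 * |y| := fun x y => by
        rw [abs_mul, abs_of_nonneg (hζ0 x)]
        exact mul_le_mul_of_nonneg_right (hζ1 x) (abs_nonneg _)
      have c1 : nrm volume (fun x => ζ x * Lop G A w α x) ≤ 1 * nB x₀ s (Lop G A w α) :=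
        nrm_le_nB zero_le_one (contDiff_Lop G hw α).continuous
          (fun x hx => by simp [hζz x hx]) fun x _ => hζa x _
      have c2 : nrm volume (v α) ≤ 1 * nB x₀ s (w α) :=
        nrm_le_nB zero_le_one (hw α).continuous
          (fun x hx => by simp [hv, hζz x hx]) fun x _ => hζa x _
      refine b1.trans (mul_le_mul (c1.trans ?_) (c2.trans ?_) nrm_nonneg hD0)
      · rw [one_mul]; exact hLD α
      · rw [one_mul]
    calc |∑ α, ∫ x, (ζ x * Lop G A w α x) * v α x|
        ≤ ∑ α, |∫ x, (ζ x * Lop G A w α x) * v α x| := Finset.abs_sum_le_sum_abs _ _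
      _ ≤ ∑ α, Dd * nB x₀ s (w α) := Finset.sum_le_sum fun α _ => hb1' α
      _ = Dd * U := by rw [← Finset.mul_sum]
      _ ≤ P * P := by
        have h1 : Dd ≤ P := by rw [hP]; nlinarith
        have h2 : U ≤ P := by
          refine le_trans ?_ hKUP
          have : 1 ≤ b * K := one_le_mul_of_one_le_of_one_le hb1 hK
          nlinarith
        exact mul_le_mul h1 h2 hU0 hP0
      _ = P ^ 2 := by ring
  have hE := sum_nrm_sq_le_integral G hco hFm
  have hT : ∑ α, ∑ β, ∑ i, ∑ j, A α β i j * ∫ x, F α i x * F β j x ≤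
      a * (P * S + P ^ 2) := by
    have e1 : ∑ α, ∑ β, ∑ i, ∑ j, A α β i j * ∫ x, F α i x * F β j x =
        (∑ α, ∑ β, ∑ i, ∑ j, A α β i j * ((∫ x, F α i x * F β j x) +
          ∫ x, adj (G.X 1 i) (adj (G.X 1 j) (w β)) x * (ζ x * v α x))) -
        ∑ α, ∫ x, (ζ x * Lop G A w α x) * v α x := by
      rw [← hmain]
      simp only [mul_add, Finset.sum_add_distrib]
      ring
    have e2 : ∑ α, ∑ β, ∑ i, ∑ j, A α β i j * ((∫ x, F α i x * F β j x) +
          ∫ x, adj (G.X 1 i) (adj (G.X 1 j) (w β)) x * (ζ x * v α x)) ≤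
        ∑ α, ∑ β, ∑ i, ∑ j, |A α β i j| * (2 * (P * S + P ^ 2)) := by
      refine Finset.sum_le_sum fun α _ => Finset.sum_le_sum fun β _ => Finset.sum_le_sum
        fun i _ => Finset.sum_le_sum fun j _ => (le_abs_self _).trans ?_
      rw [abs_mul]
      exact mul_le_mul_of_nonneg_left (hInt α β i j) (abs_nonneg _)
    simp only [← Finset.sum_mul] at e2
    rw [e1]
    have h3 := (abs_le.1 hLU).1
    have hPS : 0 ≤ P * S := mul_nonneg hP0 hS0
    rw [ha]
    nlinarith
  have hcs : S ^ 2 ≤ M * ∑ α, ∑ i, nrm volume (F α i) ^ 2 := by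
    have h1 := sq_sum_le_card_mul_sum_sq (s := (Finset.univ : Finset (Fin N × Fin (G.m 1))))
      (f := fun z => nrm volume (F z.1 z.2))
    rw [Fintype.sum_prod_type, Fintype.sum_prod_type] at h1
    refine h1.trans ?_
    have h2 : 0 ≤ ∑ α, ∑ i, nrm volume (F α i) ^ 2 :=
      Finset.sum_nonneg fun _ _ => Finset.sum_nonneg fun _ _ => sq_nonneg _
    rw [hMdef]
    nlinarith
  have hfin : lam * S ^ 2 ≤ M * (a * (P * S + P ^ 2)) := by
    calc lam * S ^ 2 ≤ lam * (M * ∑ α, ∑ i, nrm volume (F α i) ^ 2) := by gcongr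
      _ = M * (lam * ∑ α, ∑ i, nrm volume (F α i) ^ 2) := by ring
      _ ≤ M * (a * (P * S + P ^ 2)) := by
        have := hE.trans hT
        gcongr
  have := le_mul_of_sq_le hlam hM ha0 hS0 hP0 hfin
  rw [hP, ← mul_assoc] at this
  exact this

end Caccioppoli

/-! ### Absorbing iteration -/

/-- An iteration lemma: terms on larger balls with a small factor can be absorbed. -/
lemma exists_absorb {ρ ρ₁ κ₀ A : ℝ} (K : ℕ) (hρ : ρ < ρ₁) (hκ : 0 < κ₀) (hA : 0 ≤ A) :
    ∃ C : ℝ, 0 ≤ C ∧ ∀ (Φ : ℝ → ℝ) (M D U : ℝ), 0 ≤ D → 0 ≤ U →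
      (∀ s, s ≤ ρ₁ → 0 ≤ Φ s ∧ Φ s ≤ M) →
      (∀ κ t s, 0 < κ → κ ≤ κ₀ → ρ ≤ t → t < s → s ≤ ρ₁ →
        Φ t ≤ A * κ * Φ s + A * D + A * κ⁻¹ ^ K * (s - t)⁻¹ ^ (K + 1) * U) →
      Φ ρ ≤ C * (D + U) := by
  set δ₀ := ρ₁ - ρ with hδ₀
  have hδ : 0 < δ₀ := sub_pos.2 hρ
  set L : ℝ := 2 ^ (K + 1) with hL
  have hL0 : 0 < L := by positivity
  have hL1 : 1 ≤ L := one_le_pow₀ (by norm_num)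
  set θ : ℝ := (2 * L)⁻¹ with hθ
  have hθ0 : 0 < θ := by positivity
  have hθL : θ * L = 1 / 2 := by
    rw [hθ]
    field_simp
  have hθ1 : θ ≤ 1 / 2 := by nlinarith
  set κ : ℝ := min κ₀ (θ / (A + 1)) with hκd
  have hκ0 : 0 < κ := lt_min hκ (by positivity)
  have hAκ : A * κ ≤ θ := by
    have h1 : κ ≤ θ / (A + 1) := min_le_right _ _
    have h2 : κ * (A + 1) ≤ θ := (le_div_iff₀ (by positivity)).1 h1
    nlinarith
  set B : ℝ := A + A * κ⁻¹ ^ K * (δ₀ / 2)⁻¹ ^ (K + 1) with hB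
  have hB0 : 0 ≤ B := by positivity
  refine ⟨2 * B, by positivity, fun Φ M D U hD hU hM h => ?_⟩
  set t : ℕ → ℝ := fun j => ρ₁ - δ₀ * (1 / 2) ^ j with ht
  have ht0 : t 0 = ρ := by simp [ht, hδ₀]
  have htle : ∀ j, t j ≤ ρ₁ := fun j => by
    have : 0 ≤ δ₀ * (1 / 2) ^ j := by positivity
    simp only [ht]
    linarith
  have htge : ∀ j, ρ ≤ t j := fun j => by
    have : (1 / 2 : ℝ) ^ j ≤ 1 := pow_le_one₀ (by norm_num) (by norm_num)
    simp only [ht]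
    nlinarith
  have hstep : ∀ j, Φ (t j) ≤ θ * Φ (t (j + 1)) + B * (D + U) * L ^ j := by
    intro j
    have e : t (j + 1) - t j = δ₀ / 2 * (1 / 2) ^ j := by
      simp only [ht, pow_succ]
      ring
    have hlt : t j < t (j + 1) := by
      rw [← sub_pos, e]
      positivity
    have h1 := h κ (t j) (t (j + 1)) hκ0 (min_le_left _ _) (htge j) hlt (htle _)
    have e2 : (t (j + 1) - t j)⁻¹ ^ (K + 1) = (δ₀ / 2)⁻¹ ^ (K + 1) * L ^ j := by
      rw [e, mul_inv, mul_pow, hL, ← pow_mul, one_div, ← inv_pow, inv_inv, ← pow_mul, mul_comm j]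
    rw [e2] at h1
    have hΦ := (hM _ (htle (j + 1))).1
    have hLj : 1 ≤ L ^ j := one_le_pow₀ hL1
    have h3 : A * κ * Φ (t (j + 1)) ≤ θ * Φ (t (j + 1)) := by gcongr
    have h4 : A * D ≤ A * D * L ^ j := le_mul_of_one_le_right (by positivity) hLj
    have h5 : 0 ≤ A * U * L ^ j := by positivity
    have h6 : 0 ≤ A * κ⁻¹ ^ K * (δ₀ / 2)⁻¹ ^ (K + 1) * D * L ^ j := by positivity
    rw [hB]
    nlinarith
  have hind : ∀ j, Φ ρ ≤ θ ^ j * Φ (t j) + B * (D + U) * (2 - 2 * (1 / 2) ^ j) := by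
    intro j
    induction j with
    | zero => simp [ht0]
    | succ j ih =>
      have h1 := mul_le_mul_of_nonneg_left (hstep j) (pow_nonneg hθ0.le j)
      have e : θ ^ j * (θ * Φ (t (j + 1)) + B * (D + U) * L ^ j) =
          θ ^ (j + 1) * Φ (t (j + 1)) + B * (D + U) * (θ * L) ^ j := by
        rw [mul_pow]
        ring
      rw [e, hθL] at h1
      have e3 : (1 / 2 : ℝ) ^ (j + 1) = (1 / 2) ^ j / 2 := by rw [pow_succ]; ring
      rw [e3]
      linarith
  have hlim : Tendsto (fun j : ℕ => (1 / 2 : ℝ) ^ j * M + 2 * B * (D + U)) atTop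
      (𝓝 (0 * M + 2 * B * (D + U))) :=
    ((_root_.tendsto_pow_atTop_nhds_zero_of_lt_one (by norm_num) (by norm_num)).mul_const M).add_const _
  rw [zero_mul, zero_add] at hlim
  refine ge_of_tendsto' hlim fun j => (hind j).trans ?_
  have h1 : θ ^ j * Φ (t j) ≤ (1 / 2) ^ j * M := by
    have := (hM _ (htle j)).1
    have := (hM _ (htle j)).2
    gcongr
  have h2 : 0 ≤ B * (D + U) * (2 * (1 / 2) ^ j) := by positivity
  nlinarith

lemma combine_bounds {C₁ C₂ C₄ c s₀ κ δ K₀ Φ D U m : ℝ} (K : ℕ) (hC₁ : 0 ≤ C₁) (hC₂ : 0 ≤ C₂)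
    (hC₄ : 0 ≤ C₄) (hc : 0 ≤ c) (hm : 0 ≤ m) (hκ : 0 < κ) (hδ : 0 < δ) (hK₀1 : 1 ≤ K₀)
    (hK₀ : K₀ = C₄ / δ) (hσs : κ * δ ≤ s₀) (hΦ : 0 ≤ Φ) (hD : 0 ≤ D) (hU : 0 ≤ U) :
    C₁ * (κ * δ) * (Φ + C₂ * (K₀ * Φ + D)) +
      C₁ * (κ * δ)⁻¹ ^ K * ((c + 1) * K₀ * U) * m ≤
    (C₁ * (1 + C₂) * C₄ + C₁ * C₂ * s₀ + C₁ * (c + 1) * C₄ * m) * κ * Φ +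
    (C₁ * (1 + C₂) * C₄ + C₁ * C₂ * s₀ + C₁ * (c + 1) * C₄ * m) * D +
    (C₁ * (1 + C₂) * C₄ + C₁ * C₂ * s₀ + C₁ * (c + 1) * C₄ * m) * κ⁻¹ ^ K * δ⁻¹ ^ (K + 1) * U := by
  have hσ : 0 < κ * δ := mul_pos hκ hδ
  have hs₀ : 0 ≤ s₀ := hσ.le.trans hσs
  have e1 : κ * δ * K₀ = κ * C₄ := by
    rw [hK₀]
    field_simp
  have e2 : (κ * δ)⁻¹ ^ K * K₀ = C₄ * (κ⁻¹ ^ K * δ⁻¹ ^ (K + 1)) := by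
    rw [hK₀, mul_inv, mul_pow, pow_succ, div_eq_mul_inv]
    ring
  have h1 : κ * δ * Φ ≤ κ * C₄ * Φ := by
    rw [← e1]
    exact mul_le_mul_of_nonneg_right (le_mul_of_one_le_right hσ.le hK₀1) hΦ
  have h2 : C₁ * (κ * δ) * (Φ + C₂ * (K₀ * Φ + D)) ≤
      C₁ * (1 + C₂) * C₄ * κ * Φ + C₁ * C₂ * s₀ * D := by
    calc C₁ * (κ * δ) * (Φ + C₂ * (K₀ * Φ + D))
        = C₁ * (κ * δ * Φ) + C₁ * C₂ * (κ * δ * K₀) * Φ + C₁ * C₂ * (κ * δ) * D := by ring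
      _ ≤ C₁ * (κ * C₄ * Φ) + C₁ * C₂ * (κ * C₄) * Φ + C₁ * C₂ * s₀ * D := by
          rw [e1]
          gcongr
      _ = _ := by ring
  have h3 : C₁ * (κ * δ)⁻¹ ^ K * ((c + 1) * K₀ * U) * m =
      (C₁ * (c + 1) * C₄ * m) * κ⁻¹ ^ K * δ⁻¹ ^ (K + 1) * U := by
    calc C₁ * (κ * δ)⁻¹ ^ K * ((c + 1) * K₀ * U) * m =
          C₁ * (c + 1) * m * ((κ * δ)⁻¹ ^ K * K₀) * U := by ring
      _ = _ := by rw [e2]; ring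
  rw [h3]
  have a1 : 0 ≤ C₁ * (1 + C₂) * C₄ := by positivity
  have a2 : 0 ≤ C₁ * C₂ * s₀ := by positivity
  have a3 : 0 ≤ C₁ * (c + 1) * C₄ * m := by positivity
  set T := C₁ * (1 + C₂) * C₄ + C₁ * C₂ * s₀ + C₁ * (c + 1) * C₄ * m with hT
  have t1 : C₁ * (1 + C₂) * C₄ ≤ T := by linarith
  have t2 : C₁ * C₂ * s₀ ≤ T := by linarith
  have t3 : C₁ * (c + 1) * C₄ * m ≤ T := by linarith
  refine (add_le_add_left h2 _).trans ?_
  gcongr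

/-! ### The a priori estimate -/

section Apriori

variable {r n N : ℕ} (G : CarnotGroup r n)

lemma exists_rfield_bound (R : ℝ) : ∃ (K : ℕ) (C s₀ : ℝ), 0 ≤ C ∧ 0 < s₀ ∧ s₀ ≤ 1 ∧
    ∀ b σ, 0 < σ → σ ≤ s₀ → ∀ v ω₀ ω₁ : CSpace n → ℝ, TF R v → TF R ω₀ → TF R ω₁ →
      (∀ p, v p = ω₀ p + Dvf (rfield G b) ω₁ p) →
      nrm volume v ≤ C * σ * hnorm G v + C * σ⁻¹ ^ K * (nrm volume ω₀ + nrm volume ω₁) := by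
  choose K C s₀ hC hs0 hs1 H using fun b : Fin n =>
    exists_vector_field_bound G R (contDiff_rfield G b)
  have hev : ∀ᶠ σ in 𝓝[>] (0 : ℝ), ∀ b, σ ≤ s₀ b :=
    eventually_all.2 fun b => (eventually_le_nhds (hs0 b)).filter_mono nhdsWithin_le_nhds
  have hev2 : ∀ᶠ σ in 𝓝[>] (0 : ℝ), σ ≤ 1 :=
    (eventually_le_nhds one_pos).filter_mono nhdsWithin_le_nhds
  obtain ⟨σ₀, ⟨h1, h2⟩, h3⟩ := ((hev.and hev2).and self_mem_nhdsWithin).exists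
  refine ⟨∑ b, K b, ∑ b, C b, σ₀, Finset.sum_nonneg fun b _ => hC b, h3, h2,
    fun b σ hσ hσ' v ω₀ ω₁ hv h0 h1' hid => ?_⟩
  have hCb : C b ≤ ∑ b, C b := Finset.single_le_sum (fun b _ => hC b) (Finset.mem_univ b)
  have hKb : K b ≤ ∑ b, K b := Finset.single_le_sum (fun b _ => Nat.zero_le _) (Finset.mem_univ b)
  refine (H b σ hσ (hσ'.trans (h1 b)) v ω₀ ω₁ hv h0 h1' hid).trans ?_
  have hn1 := hnorm_nonneg G v
  have hn2 : 0 ≤ nrm volume ω₀ := nrm_nonneg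
  have hn3 : 0 ≤ nrm volume ω₁ := nrm_nonneg
  have hσ1 : 1 ≤ σ⁻¹ := (one_le_inv₀ hσ).2 (hσ'.trans h2)
  have := hC b
  have hC0 : 0 ≤ ∑ b, C b := Finset.sum_nonneg fun b _ => hC b
  gcongr

set_option maxHeartbeats 2000000 in
/-- Interior a priori estimate for derivatives along right-invariant fields. -/
lemma exists_apriori {A : Fin N → Fin N → Fin (G.m 1) → Fin (G.m 1) → ℝ} {lam : ℝ}
    (hlam : 0 < lam) (hco : G.Coercive lam A) (x₀ : CSpace n) {ρ ρ₁ : ℝ} (hρ0 : 0 < ρ)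
    (hρ : ρ < ρ₁) :
    ∃ C : ℝ, 0 ≤ C ∧ ∀ u : Fin N → CSpace n → ℝ, (∀ α, ContDiff ℝ (⊤ : ℕ∞) (u α)) →
      ∑ b, ∑ α, nB x₀ ρ (adj (rfield G b) (u α)) ≤
        C * ((∑ b, ∑ α, nB x₀ ρ₁ (adj (rfield G b) (Lop G A u α))) + ∑ α, nB x₀ ρ₁ (u α)) := by
  obtain ⟨K, C₁, s₀, hC₁, hs₀, hs₁, H1⟩ := exists_rfield_bound G (‖x₀‖ + ρ₁)
  obtain ⟨C₂, hC₂, H2⟩ := exists_caccioppoli G hlam hco x₀ ρ₁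
  obtain ⟨C₃, hC₃, H3⟩ := exists_cutoff x₀
  have hρ₁ : 0 < ρ₁ := hρ0.trans hρ
  have hb : ∀ b : Fin n, ∃ C : ℝ, 0 < C ∧ ∀ x, ‖x - x₀‖ ≤ ρ₁ →
      ‖rfield G b x‖ ≤ C ∧ |dvg (rfield G b) x| ≤ C := by
    intro b
    obtain ⟨C1, h1, H1⟩ := exists_bound_closedBall (contDiff_rfield G b).continuous x₀ ρ₁
    obtain ⟨C2, h2, H2⟩ := exists_bound_closedBall
      (contDiff_dvg (contDiff_rfield G b)).continuous x₀ ρ₁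
    exact ⟨max C1 C2, lt_max_of_lt_left h1, fun x hx =>
      ⟨(H1 x hx).trans (le_max_left _ _), (H2 x hx).trans (le_max_right _ _)⟩⟩
  choose B hB0 hB using hb
  set c : ℝ := 2 * (∑ i, B i) + 1 with hcdef
  have hc0 : 0 ≤ ∑ i, B i := Finset.sum_nonneg fun i _ => (hB0 i).le
  have hBb : ∀ i, B i + B i ≤ c := fun i => by
    have := Finset.single_le_sum (f := B) (fun i _ => (hB0 i).le) (Finset.mem_univ i)
    linarith
  set C₄ : ℝ := max C₃ ρ₁ with hC₄
  have hC₄0 : 0 < C₄ := lt_max_of_lt_left hC₃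
  set T : ℝ := C₁ * (1 + C₂) * C₄ + C₁ * C₂ * s₀ + C₁ * (c + 1) * C₄ * n with hT
  have hT0 : 0 ≤ T := by positivity
  obtain ⟨C, hC, HC⟩ := exists_absorb (A := T) (κ₀ := s₀ / ρ₁) K hρ (by positivity) hT0
  refine ⟨C, hC, fun u hu => ?_⟩
  set Φ : ℝ → ℝ := fun s => ∑ b, ∑ α, nB x₀ s (adj (rfield G b) (u α)) with hΦ
  set D : ℝ := ∑ b, ∑ α, nB x₀ ρ₁ (adj (rfield G b) (Lop G A u α)) with hD
  set U : ℝ := ∑ α, nB x₀ ρ₁ (u α) with hU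
  have hRu : ∀ b α, ContDiff ℝ (⊤ : ℕ∞) (adj (rfield G b) (u α)) := fun b α =>
    contDiff_adj (contDiff_rfield G b) (hu α)
  have hΦ0 : ∀ s, 0 ≤ Φ s := fun s =>
    Finset.sum_nonneg fun _ _ => Finset.sum_nonneg fun _ _ => nB_nonneg
  have hD0 : 0 ≤ D := Finset.sum_nonneg fun _ _ => Finset.sum_nonneg fun _ _ => nB_nonneg
  have hU0 : 0 ≤ U := Finset.sum_nonneg fun _ _ => nB_nonneg
  refine HC Φ (Φ ρ₁) D U hD0 hU0 (fun s hs => ⟨hΦ0 s, ?_⟩) fun κ t s hκ hκ' ht hts hs => ?_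
  · exact Finset.sum_le_sum fun b _ => Finset.sum_le_sum fun α _ =>
      nB_mono_radius hs (hRu b α).continuous
  set δ := s - t with hδd
  have hδ : 0 < δ := sub_pos.2 hts
  have ht0 : 0 < t := hρ0.trans_le ht
  have hδρ : δ ≤ ρ₁ := by linarith
  obtain ⟨ζ, hζ, hζ0, hζ1, hζin, hsupp, hout, hDζ⟩ := H3 t s ht0 hts
  set K₀ := C₄ / δ with hK₀
  have hK₀1 : 1 ≤ K₀ := by
    rw [hK₀, one_le_div hδ]
    exact hδρ.trans (le_max_right _ _)
  have hDζ' : ∀ x, ‖fderiv ℝ ζ x‖ ≤ K₀ := fun x => (hDζ x).trans (by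
    rw [hK₀]
    gcongr
    exact le_max_left _ _)
  have hζz : ∀ x, x ∉ Metric.ball x₀ s → ζ x = 0 := fun x hx => by
    by_contra h
    exact hx (hsupp x h)
  have hin : ∀ x, x ∈ Metric.ball x₀ s → ‖x - x₀‖ ≤ ρ₁ := fun x hx => by
    rw [← dist_eq_norm]
    exact (Metric.mem_ball.1 hx).le.trans hs
  have hTFs : ∀ f : CSpace n → ℝ, ContDiff ℝ (⊤ : ℕ∞) f → (∀ x, x ∉ Metric.ball x₀ s → f x = 0) →
      TF (‖x₀‖ + ρ₁) f := fun f hf h => ⟨hf, fun x hx => by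
    by_contra h'
    refine hx (h x fun hx' => h' ?_)
    have h1 := hin x hx'
    have h2 := norm_sub_norm_le x x₀
    linarith⟩
  set σ := κ * δ with hσd
  have hσ : 0 < σ := mul_pos hκ hδ
  have hσs : σ ≤ s₀ := by
    calc σ ≤ s₀ / ρ₁ * ρ₁ := by rw [hσd]; gcongr
      _ = s₀ := div_mul_cancel₀ _ hρ₁.ne'
  have hcomp : ∀ b α, nB x₀ t (adj (rfield G b) (u α)) ≤
      C₁ * σ * (nB x₀ s (adj (rfield G b) (u α)) +
        ∑ i, nrm volume (G.D 1 i fun x => ζ x * adj (rfield G b) (u α) x)) +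
      C₁ * σ⁻¹ ^ K * ((c + 1) * K₀ * nB x₀ ρ₁ (u α)) := by
    intro b α
    set v : CSpace n → ℝ := fun x => ζ x * adj (rfield G b) (u α) x with hv
    set ω₁ : CSpace n → ℝ := fun x => ζ x * u α x with hω₁
    set ω₀ : CSpace n → ℝ := fun x =>
      (dvg (rfield G b) x * ζ x - Dvf (rfield G b) ζ x) * u α x with hω₀
    have hvT : TF (‖x₀‖ + ρ₁) v := hTFs _ (hζ.mul (hRu b α)) fun x hx => by simp [hv, hζz x hx]
    have hω₁T : TF (‖x₀‖ + ρ₁) ω₁ := hTFs _ (hζ.mul (hu α)) fun x hx => by simp [hω₁, hζz x hx]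
    have hω₀T : TF (‖x₀‖ + ρ₁) ω₀ := hTFs _
      ((((contDiff_dvg (contDiff_rfield G b)).mul hζ).sub
        (contDiff_dvf (contDiff_rfield G b) hζ)).mul (hu α)) fun x hx => by
          simp [hω₀, hζz x hx, Dvf, hout x hx]
    have hid : ∀ p, v p = ω₀ p + Dvf (rfield G b) ω₁ p := fun p => by
      have : Dvf (rfield G b) ω₁ p = Dvf (rfield G b) ζ p * u α p + ζ p * Dvf (rfield G b) (u α) p :=
        dvf_mul (differentiableAt_of_smooth hζ p) (differentiableAt_of_smooth (hu α) p)
      rw [this]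
      simp only [hv, hω₀, adj]
      ring
    have h1 := H1 b σ hσ hσs v ω₀ ω₁ hvT hω₀T hω₁T hid
    have h2 : nB x₀ t (adj (rfield G b) (u α)) ≤ nrm volume v :=
      nB_le_nrm hvT.memLp fun x hx => by simp [hv, hζin x hx]
    have hnv : nrm volume v ≤ 1 * nB x₀ s (adj (rfield G b) (u α)) :=
      nrm_le_nB zero_le_one (hRu b α).continuous (fun x hx => by simp [hv, hζz x hx]) fun x _ => by
        simp only [hv]
        rw [abs_mul, abs_of_nonneg (hζ0 x)]
        exact mul_le_mul_of_nonneg_right (hζ1 x) (abs_nonneg _)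
    have hu1 : nB x₀ s (u α) ≤ nB x₀ ρ₁ (u α) := nB_mono_radius hs (hu α).continuous
    have hn1 : nrm volume ω₁ ≤ 1 * nB x₀ s (u α) :=
      nrm_le_nB zero_le_one (hu α).continuous (fun x hx => by simp [hω₁, hζz x hx]) fun x _ => by
        simp only [hω₁]
        rw [abs_mul, abs_of_nonneg (hζ0 x)]
        exact mul_le_mul_of_nonneg_right (hζ1 x) (abs_nonneg _)
    have hn0 : nrm volume ω₀ ≤ (c * K₀) * nB x₀ s (u α) := by
      refine nrm_le_nB (by positivity) (hu α).continuous (fun x hx => ?_) fun x hx => ?_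
      · simp [hω₀, hζz x hx, Dvf, hout x hx]
      · simp only [hω₀]
        rw [abs_mul]
        have h3 : |dvg (rfield G b) x * ζ x| ≤ K₀ * B b := by
          rw [abs_mul, abs_of_nonneg (hζ0 x)]
          calc |dvg (rfield G b) x| * ζ x ≤ B b * 1 :=
                mul_le_mul (hB b x (hin x hx)).2 (hζ1 x) (hζ0 x) (hB0 b).le
            _ ≤ K₀ * B b := by nlinarith [hB0 b]
        have h4 : |Dvf (rfield G b) ζ x| ≤ K₀ * B b :=
          ((fderiv ℝ ζ x).le_opNorm _).trans
            (mul_le_mul (hDζ' x) (hB b x (hin x hx)).1 (norm_nonneg _) (by linarith))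
        have h5 : K₀ * B b + K₀ * B b ≤ c * K₀ := by
          have := hBb b
          nlinarith
        gcongr
        exact (abs_sub _ _).trans (by linarith)
    refine h2.trans (h1.trans ?_)
    have hω : nrm volume ω₀ + nrm volume ω₁ ≤ (c + 1) * K₀ * nB x₀ ρ₁ (u α) := by
      have hnn : 0 ≤ nB x₀ s (u α) := nB_nonneg
      have : c * K₀ * nB x₀ s (u α) ≤ c * K₀ * nB x₀ ρ₁ (u α) := by gcongr
      nlinarith
    have hh : hnorm G v ≤ nB x₀ s (adj (rfield G b) (u α)) + ∑ i, nrm volume (G.D 1 i v) := by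
      unfold hnorm
      linarith
    gcongr
  -- summation over components
  have hcacc : ∀ b, ∑ α, ∑ i, nrm volume (G.D 1 i fun x => ζ x * adj (rfield G b) (u α) x) ≤
      C₂ * (K₀ * ∑ α, nB x₀ s (adj (rfield G b) (u α)) +
        ∑ α, nB x₀ ρ₁ (adj (rfield G b) (Lop G A u α))) := by
    intro b
    refine (H2 s K₀ ζ hs hK₀1 hζ hζ0 hζ1 hsupp hout hDζ' _ (hRu b)).trans ?_
    gcongr with α
    rw [← adj_Lop G hu]
    exact nB_mono_radius hs (contDiff_adj (contDiff_rfield G b) (contDiff_Lop G hu α)).continuous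
  have hsum : Φ t ≤ C₁ * σ * (Φ s + C₂ * (K₀ * Φ s + D)) +
      C₁ * σ⁻¹ ^ K * ((c + 1) * K₀ * U) * n := by
    calc Φ t ≤ ∑ b, ∑ α, (C₁ * σ * (nB x₀ s (adj (rfield G b) (u α)) +
            ∑ i, nrm volume (G.D 1 i fun x => ζ x * adj (rfield G b) (u α) x)) +
            C₁ * σ⁻¹ ^ K * ((c + 1) * K₀ * nB x₀ ρ₁ (u α))) :=
          Finset.sum_le_sum fun b _ => Finset.sum_le_sum fun α _ => hcomp b α
      _ = C₁ * σ * (Φ s + ∑ b, ∑ α, ∑ i,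
            nrm volume (G.D 1 i fun x => ζ x * adj (rfield G b) (u α) x)) +
            C₁ * σ⁻¹ ^ K * ((c + 1) * K₀ * U) * n := by
          simp only [Finset.sum_add_distrib, ← Finset.mul_sum, hΦ, hU, Finset.sum_const,
            Finset.card_univ, Fintype.card_fin, nsmul_eq_mul]
          ring
      _ ≤ C₁ * σ * (Φ s + ∑ b, C₂ * (K₀ * ∑ α, nB x₀ s (adj (rfield G b) (u α)) +
            ∑ α, nB x₀ ρ₁ (adj (rfield G b) (Lop G A u α)))) +
            C₁ * σ⁻¹ ^ K * ((c + 1) * K₀ * U) * n := by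
          refine add_le_add (mul_le_mul_of_nonneg_left (add_le_add le_rfl
            (Finset.sum_le_sum fun b _ => hcacc b)) (by positivity)) le_rfl
      _ = _ := by
          simp only [Finset.sum_add_distrib, ← Finset.mul_sum, hΦ, hD]
  exact hsum.trans (combine_bounds K hC₁ hC₂.le hC₄0.le (by positivity) (Nat.cast_nonneg n) hκ hδ
    hK₀1 rfl hσs (hΦ0 s) hD0 hU0)

end Apriori

/-! ### Sequences with bounded derivatives -/

section Bounded

variable {r n N : ℕ} (G : CarnotGroup r n) (x₀ : CSpace n) (ρ₁ : ℝ)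

/-- The sequence `w` and its right-invariant derivatives of order at most `m` are bounded in
`L²` on balls of radius smaller than `ρ₁` about `x₀`. -/
def BddSeq : ℕ → (ℕ → CSpace n → ℝ) → Prop
  | 0, w => ∀ ρ, 0 < ρ → ρ < ρ₁ → ∃ C, ∀ k, nB x₀ ρ (w k) ≤ C
  | m + 1, w => (∀ ρ, 0 < ρ → ρ < ρ₁ → ∃ C, ∀ k, nB x₀ ρ (w k) ≤ C) ∧
      ∀ b, BddSeq m fun k => adj (rfield G b) (w k)

variable {G x₀ ρ₁} {m : ℕ} {w v : ℕ → CSpace n → ℝ}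

lemma BddSeq.zero (h : BddSeq G x₀ ρ₁ m w) : BddSeq G x₀ ρ₁ 0 w := by
  cases m with
  | zero => exact h
  | succ m => exact h.1

lemma BddSeq.pred (h : BddSeq G x₀ ρ₁ (m + 1) w) : BddSeq G x₀ ρ₁ m w := by
  induction m generalizing w with
  | zero => exact h.zero
  | succ m ih => exact ⟨h.1, fun b => ih (h.2 b)⟩

lemma nB_add_le {ρ : ℝ} {f g : CSpace n → ℝ} (hf : Continuous f) (hg : Continuous g) :
    nB x₀ ρ (fun x => f x + g x) ≤ nB x₀ ρ f + nB x₀ ρ g :=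
  nrm_add_le (memLp_ball hf) (memLp_ball hg)

lemma BddSeq.add (hw : BddSeq G x₀ ρ₁ m w) (hv : BddSeq G x₀ ρ₁ m v)
    (hws : ∀ k, ContDiff ℝ (⊤ : ℕ∞) (w k)) (hvs : ∀ k, ContDiff ℝ (⊤ : ℕ∞) (v k)) :
    BddSeq G x₀ ρ₁ m fun k x => w k x + v k x := by
  have h0 : ∀ ρ, 0 < ρ → ρ < ρ₁ → ∃ C, ∀ k, nB x₀ ρ (fun x => w k x + v k x) ≤ C := by
    intro ρ h1 h2
    obtain ⟨C, hC⟩ := hw.zero ρ h1 h2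
    obtain ⟨C', hC'⟩ := hv.zero ρ h1 h2
    exact ⟨C + C', fun k => (nB_add_le (hws k).continuous (hvs k).continuous).trans
      (add_le_add (hC k) (hC' k))⟩
  induction m generalizing w v with
  | zero => exact h0
  | succ m ih =>
    refine ⟨h0, fun b => ?_⟩
    have e : (fun k => adj (rfield G b) fun x => w k x + v k x) =
        fun k x => adj (rfield G b) (w k) x + adj (rfield G b) (v k) x := by
      funext k x
      exact adj_add (hws k) (hvs k) x
    rw [e]
    have s1 := fun k => contDiff_adj (contDiff_rfield G b) (hws k)
    have s2 := fun k => contDiff_adj (contDiff_rfield G b) (hvs k)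
    refine ih (hw.2 b) (hv.2 b) s1 s2 fun ρ h1 h2 => ?_
    obtain ⟨C, hC⟩ := (hw.2 b).zero ρ h1 h2
    obtain ⟨C', hC'⟩ := (hv.2 b).zero ρ h1 h2
    exact ⟨C + C', fun k => (nB_add_le (s1 k).continuous (s2 k).continuous).trans
      (add_le_add (hC k) (hC' k))⟩

lemma nB_mul_le {a : CSpace n → ℝ} (ha : Continuous a) (ρ : ℝ) :
    ∃ C : ℝ, 0 < C ∧ ∀ f : CSpace n → ℝ, Continuous f →
      nB x₀ ρ (fun x => a x * f x) ≤ C * nB x₀ ρ f := by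
  obtain ⟨C, hC, h⟩ := exists_bound_closedBall ha x₀ ρ
  refine ⟨C, hC, fun f hf => nrm_le_mul (memLp_ball hf) hC.le ?_⟩
  refine (ae_restrict_iff' measurableSet_ball).2 (Eventually.of_forall fun x hx => ?_)
  rw [abs_mul]
  refine mul_le_mul_of_nonneg_right (h x ?_) (abs_nonneg _)
  rw [← dist_eq_norm]
  exact (Metric.mem_ball.1 hx).le

lemma BddSeq.mul {a : CSpace n → ℝ} (ha : ContDiff ℝ (⊤ : ℕ∞) a)
    (hw : BddSeq G x₀ ρ₁ m w) (hws : ∀ k, ContDiff ℝ (⊤ : ℕ∞) (w k)) :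
    BddSeq G x₀ ρ₁ m fun k x => a x * w k x := by
  have h0 : ∀ ρ, 0 < ρ → ρ < ρ₁ → ∃ C, ∀ k, nB x₀ ρ (fun x => a x * w k x) ≤ C := by
    intro ρ h1 h2
    obtain ⟨C, hC⟩ := hw.zero ρ h1 h2
    obtain ⟨C', hC'0, hC'⟩ := nB_mul_le (x₀ := x₀) ha.continuous ρ
    exact ⟨C' * C, fun k => (hC' _ (hws k).continuous).trans
      (mul_le_mul_of_nonneg_left (hC k) hC'0.le)⟩
  induction m generalizing w a with
  | zero => exact h0
  | succ m ih =>
    refine ⟨h0, fun b => ?_⟩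
    have e : (fun k => adj (rfield G b) fun x => a x * w k x) =
        fun k x => a x * adj (rfield G b) (w k) x + Dvf (rfield G b) a x * w k x := by
      funext k x
      exact adj_mul ha (hws k) x
    rw [e]
    have s1 := fun k => contDiff_adj (contDiff_rfield G b) (hws k)
    have s2 := contDiff_dvf (contDiff_rfield G b) ha
    refine BddSeq.add (ih ha (hw.2 b) s1 ?_) (ih s2 hw.pred hws ?_) (fun k => ha.mul (s1 k))
      fun k => s2.mul (hws k)
    · intro ρ h1 h2
      obtain ⟨C, hC⟩ := (hw.2 b).zero ρ h1 h2
      obtain ⟨C', hC'0, hC'⟩ := nB_mul_le (x₀ := x₀) ha.continuous ρ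
      exact ⟨C' * C, fun k => (hC' _ (s1 k).continuous).trans
        (mul_le_mul_of_nonneg_left (hC k) hC'0.le)⟩
    · intro ρ h1 h2
      obtain ⟨C, hC⟩ := hw.zero ρ h1 h2
      obtain ⟨C', hC'0, hC'⟩ := nB_mul_le (x₀ := x₀) s2.continuous ρ
      exact ⟨C' * C, fun k => (hC' _ (hws k).continuous).trans
        (mul_le_mul_of_nonneg_left (hC k) hC'0.le)⟩

lemma BddSeq.sum {ι : Type*} (s : Finset ι) {W : ι → ℕ → CSpace n → ℝ}
    (hW : ∀ i, BddSeq G x₀ ρ₁ m (W i)) (hs : ∀ i k, ContDiff ℝ (⊤ : ℕ∞) (W i k)) :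
    BddSeq G x₀ ρ₁ m fun k x => ∑ i ∈ s, W i k x := by
  classical
  induction s using Finset.induction_on with
  | empty =>
    simp only [Finset.sum_empty]
    have h0 : ∀ m, BddSeq G x₀ ρ₁ m fun _ _ => (0 : ℝ) := by
      have h : ∀ ρ, 0 < ρ → ρ < ρ₁ → ∃ C, ∀ _ : ℕ, nB x₀ ρ (fun _ => (0 : ℝ)) ≤ C :=
        fun ρ _ _ => ⟨_, fun _ => le_rfl⟩
      intro m
      induction m with
      | zero => exact h
      | succ m ih =>
        refine ⟨h, fun b => ?_⟩
        have e : adj (rfield G b) (fun _ => (0 : ℝ)) = fun _ => 0 := by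
          funext x
          simp [adj, Dvf]
        simpa only [e] using ih
    exact h0 m
  | insert a s ha ih =>
    simp only [Finset.sum_insert ha]
    exact (hW a).add ih (hs a) fun k => ContDiff.sum fun i _ => hs i k

lemma BddSeq.dvf (hw : BddSeq G x₀ ρ₁ (m + 1) w) (hws : ∀ k, ContDiff ℝ (⊤ : ℕ∞) (w k))
    (b : Fin n) : BddSeq G x₀ ρ₁ m fun k => Dvf (rfield G b) (w k) := by
  have hd : ContDiff ℝ (⊤ : ℕ∞) (fun x => -dvg (rfield G b) x) :=
    (contDiff_dvg (contDiff_rfield G b)).neg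
  have e : (fun k => Dvf (rfield G b) (w k)) =
      fun k x => adj (rfield G b) (w k) x + (-dvg (rfield G b) x) * w k x := by
    funext k x
    simp only [adj]
    ring
  rw [e]
  exact (hw.2 b).add (hw.pred.mul hd hws) (fun k => contDiff_adj (contDiff_rfield G b) (hws k))
    fun k => hd.mul (hws k)

/-- Coordinate derivatives of bounded sequences. -/
lemma BddSeq.fderiv_single (hw : BddSeq G x₀ ρ₁ (m + 1) w)
    (hws : ∀ k, ContDiff ℝ (⊤ : ℕ∞) (w k)) (j : Fin n) :
    BddSeq G x₀ ρ₁ m fun k x => fderiv ℝ (w k) x (EuclideanSpace.single j 1) := by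
  obtain ⟨c, hc, h⟩ := exists_frame G j
  simp_rw [h]
  exact BddSeq.sum _ (fun b => (hw.dvf hws b).mul (hc b)
    fun k => contDiff_dvf (contDiff_rfield G b) (hws k)) fun b k =>
      (hc b).mul (contDiff_dvf (contDiff_rfield G b) (hws k))

lemma BddSeq.congr (hw : BddSeq G x₀ ρ₁ m w)
    (h : ∀ k x, x ∈ Metric.ball x₀ ρ₁ → v k x = w k x) : BddSeq G x₀ ρ₁ m v := by
  have hnB : ∀ {w v : ℕ → CSpace n → ℝ}, BddSeq G x₀ ρ₁ 0 w →
      (∀ k x, x ∈ Metric.ball x₀ ρ₁ → v k x = w k x) → BddSeq G x₀ ρ₁ 0 v := by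
    intro w v hw h ρ h1 h2
    obtain ⟨C, hC⟩ := hw ρ h1 h2
    refine ⟨C, fun k => le_trans (le_of_eq ?_) (hC k)⟩
    unfold nB nrm
    rw [eLpNorm_congr_ae]
    exact (ae_restrict_iff' measurableSet_ball).2 (Eventually.of_forall fun x hx =>
      h k x (Metric.ball_subset_ball h2.le hx))
  induction m generalizing w v with
  | zero => exact hnB hw h
  | succ m ih =>
    refine ⟨hnB hw.zero h, fun b => ih (hw.2 b) fun k x hx => ?_⟩
    have he : v k =ᶠ[𝓝 x] w k :=
      (Metric.isOpen_ball.eventually_mem hx).mono fun y hy => h k y hy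
    simp only [adj, Dvf]
    rw [he.fderiv_eq, he.eq_of_nhds]

/-- Bounded solutions with data bounded to all orders are bounded to all orders. -/
lemma bddSeq_of_Lop {A : Fin N → Fin N → Fin (G.m 1) → Fin (G.m 1) → ℝ} {lam : ℝ}
    (hlam : 0 < lam) (hco : G.Coercive lam A) (m : ℕ) {u : ℕ → Fin N → CSpace n → ℝ}
    (hu : ∀ k α, ContDiff ℝ (⊤ : ℕ∞) (u k α)) (h0 : ∀ α, BddSeq G x₀ ρ₁ 0 fun k => u k α)
    (hL : ∀ m α, BddSeq G x₀ ρ₁ m fun k => Lop G A (u k) α) (α : Fin N) :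
    BddSeq G x₀ ρ₁ m fun k => u k α := by
  induction m generalizing u α with
  | zero => exact h0 α
  | succ m ih =>
    refine ⟨h0 α, fun b => ?_⟩
    refine ih (u := fun k β => adj (rfield G b) (u k β))
      (fun k β => contDiff_adj (contDiff_rfield G b) (hu k β)) (fun β ρ hρ hρ' => ?_)
      (fun m β => ?_) α
    · obtain ⟨ρ', h1, h2⟩ := exists_between hρ'
      obtain ⟨C, hC, H⟩ := exists_apriori G hlam hco x₀ hρ h1
      choose C₁ hC₁ using fun (b : Fin n) (α : Fin N) =>
        ((hL 1 α).2 b : BddSeq G x₀ ρ₁ 0 _) ρ' (hρ.trans h1) h2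
      choose C₂ hC₂ using fun α : Fin N => h0 α ρ' (hρ.trans h1) h2
      refine ⟨C * ((∑ b, ∑ α, C₁ b α) + ∑ α, C₂ α), fun k => ?_⟩
      calc nB x₀ ρ (adj (rfield G b) (u k β))
          ≤ ∑ α, nB x₀ ρ (adj (rfield G b) (u k α)) :=
            Finset.single_le_sum (f := fun α => nB x₀ ρ (adj (rfield G b) (u k α)))
              (fun _ _ => nB_nonneg) (Finset.mem_univ β)
        _ ≤ ∑ b, ∑ α, nB x₀ ρ (adj (rfield G b) (u k α)) :=
            Finset.single_le_sum (f := fun b => ∑ α, nB x₀ ρ (adj (rfield G b) (u k α)))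
              (fun _ _ => Finset.sum_nonneg fun _ _ => nB_nonneg) (Finset.mem_univ b)
        _ ≤ _ := H (u k) (hu k)
        _ ≤ _ := by
            refine mul_le_mul_of_nonneg_left (add_le_add ?_ ?_) hC
            · exact Finset.sum_le_sum fun b _ => Finset.sum_le_sum fun α _ => hC₁ b α k
            · exact Finset.sum_le_sum fun α _ => hC₂ α k
    · have e : (fun k => Lop G A (fun β => adj (rfield G b) (u k β)) β) =
          fun k => adj (rfield G b) (Lop G A (u k) β) := by
        funext k
        rw [adj_Lop G (hu k)]
      rw [e]
      exact (hL (m + 1) β).2 b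

end Bounded

/-! ### Integrals depending on a parameter -/

section Param

variable {n : ℕ} {k : CSpace n → ℝ} {R : ℝ}

lemma integrable_smul_of_continuous {F : Type} [NormedAddCommGroup F] [NormedSpace ℝ F]
    (hk : Integrable k) (hk0 : ∀ g, k g ≠ 0 → ‖g‖ ≤ R) {f : CSpace n → F} (hf : Continuous f) :
    Integrable fun g => k g • f g := by
  have h1 : IntegrableOn (fun g => k g • f g) (Metric.closedBall 0 R) :=
    hk.integrableOn.smul_continuousOn hf.continuousOn (isCompact_closedBall 0 R)
  refine (integrableOn_iff_integrable_of_support_subset fun g hg => ?_).1 h1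
  have : k g ≠ 0 := fun h => hg (by simp [h])
  simpa using hk0 g this

lemma contDiff_partial {F : Type} [NormedAddCommGroup F] [NormedSpace ℝ F]
    {H : CSpace n × CSpace n → F} (hH : ContDiff ℝ (⊤ : ℕ∞) H) :
    ContDiff ℝ (⊤ : ℕ∞) fun z : CSpace n × CSpace n => fderiv ℝ (fun q => H (z.1, q)) z.2 :=
  ContDiff.fderiv (m := (⊤ : ℕ∞)) (n := (⊤ : ℕ∞))
    (f := fun (z : CSpace n × CSpace n) q => H (z.1, q))
    (hH.comp ((contDiff_fst.comp contDiff_fst).prodMk contDiff_snd)) contDiff_snd (by simp)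

lemma hasFDerivAt_integral_smul {F : Type} [NormedAddCommGroup F] [NormedSpace ℝ F]
    (hk : Integrable k) (hk0 : ∀ g, k g ≠ 0 → ‖g‖ ≤ R)
    {H : CSpace n × CSpace n → F} (hH : ContDiff ℝ (⊤ : ℕ∞) H) (p : CSpace n) :
    HasFDerivAt (fun p => ∫ g, k g • H (g, p))
      (∫ g, k g • fderiv ℝ (fun q => H (g, q)) p) p := by
  have hp : ∀ q, Continuous fun g => H (g, q) := fun q =>
    hH.continuous.comp (continuous_id.prodMk continuous_const)
  have hD := (contDiff_partial hH).continuous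
  obtain ⟨C, hC⟩ := ((isCompact_closedBall (0 : CSpace n) R).prod
    (isCompact_closedBall p 1)).exists_bound_of_continuousOn hD.continuousOn
  refine hasFDerivAt_integral_of_dominated_of_fderiv_le (bound := fun g => |k g| * C)
    (F' := fun q g => k g • fderiv ℝ (fun q => H (g, q)) q) (Metric.ball_mem_nhds p one_pos)
    (Eventually.of_forall fun q => (integrable_smul_of_continuous hk hk0 (hp q)).1)
    (integrable_smul_of_continuous hk hk0 (hp p))
    (integrable_smul_of_continuous hk hk0
      (hD.comp (continuous_id.prodMk continuous_const))).1
    (Eventually.of_forall fun g q hq => ?_) (hk.abs.mul_const C)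
    (Eventually.of_forall fun g q _ => ?_)
  · by_cases h : k g = 0
    · simp [h]
    · rw [norm_smul, Real.norm_eq_abs]
      gcongr
      exact hC (g, q) ⟨by simpa using hk0 g h, Metric.ball_subset_closedBall hq⟩
  · have : ContDiff ℝ (⊤ : ℕ∞) fun q => H (g, q) := hH.comp (contDiff_const.prodMk contDiff_id)
    exact (this.differentiable top_ne_zero q).hasFDerivAt.const_smul (k g)

lemma contDiff_integral_smul {F : Type} [NormedAddCommGroup F] [NormedSpace ℝ F]
    (hk : Integrable k) (hk0 : ∀ g, k g ≠ 0 → ‖g‖ ≤ R)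
    {H : CSpace n × CSpace n → F} (hH : ContDiff ℝ (⊤ : ℕ∞) H) :
    ContDiff ℝ (⊤ : ℕ∞) fun p => ∫ g, k g • H (g, p) := by
  rw [contDiff_infty]
  intro m
  induction m generalizing F with
  | zero =>
    refine contDiff_zero.2 (continuous_iff_continuousAt.2 fun p => ?_)
    exact (hasFDerivAt_integral_smul hk hk0 hH p).continuousAt
  | succ m ih =>
    rw [Nat.cast_add, Nat.cast_one, contDiff_succ_iff_fderiv]
    refine ⟨fun p => (hasFDerivAt_integral_smul hk hk0 hH p).differentiableAt, by simp, ?_⟩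
    have : (fderiv ℝ fun p => ∫ g, k g • H (g, p)) =
        fun p => ∫ g, k g • fderiv ℝ (fun q => H (g, q)) p :=
      funext fun p => (hasFDerivAt_integral_smul hk hk0 hH p).fderiv
    rw [this]
    exact ih (contDiff_partial hH)

lemma contDiff_integral_mul (hk : Integrable k) (hk0 : ∀ g, k g ≠ 0 → ‖g‖ ≤ R)
    {H : CSpace n × CSpace n → ℝ} (hH : ContDiff ℝ (⊤ : ℕ∞) H) :
    ContDiff ℝ (⊤ : ℕ∞) fun p => ∫ g, k g * H (g, p) :=
  contDiff_integral_smul hk hk0 hH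

lemma dvf_integral_mul (hk : Integrable k) (hk0 : ∀ g, k g ≠ 0 → ‖g‖ ≤ R)
    {H : CSpace n × CSpace n → ℝ} (hH : ContDiff ℝ (⊤ : ℕ∞) H) (Z : CSpace n → CSpace n)
    (p : CSpace n) : Dvf Z (fun p => ∫ g, k g * H (g, p)) p =
      ∫ g, k g * Dvf Z (fun q => H (g, q)) p := by
  have h := hasFDerivAt_integral_smul hk hk0 hH p
  have h' : fderiv ℝ (fun p => ∫ g, k g * H (g, p)) p = _ := h.fderiv
  have hi : Integrable fun g => k g • fderiv ℝ (fun q => H (g, q)) p :=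
    integrable_smul_of_continuous hk hk0
      ((contDiff_partial hH).continuous.comp (continuous_id.prodMk continuous_const))
  simp only [Dvf]
  rw [h', ContinuousLinearMap.integral_apply hi]
  rfl

end Param

/-! ### Mollification on the group -/

section Mollification

variable {r n N : ℕ} (G : CarnotGroup r n)

/-- Left translations near the identity almost preserve supports and `L²` norms. -/
lemma exists_left_translation_bound (ρ : ℝ) {δ : ℝ} (hδ : 0 < δ) : ∃ a : ℝ, 0 < a ∧ a ≤ 1 ∧
    ∀ g, ‖g - G.one‖ ≤ a → (∀ q, ‖q‖ ≤ ρ → ‖G.mul (G.inv g) q - q‖ ≤ δ) ∧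
      ∀ w, TF ρ w → TF (ρ + δ) (fun p => w (G.mul g p)) ∧
        nrm volume (fun p => w (G.mul g p)) ≤ 2 * nrm volume w := by
  obtain ⟨C1, hC1, h1⟩ := exists_lipschitz_fst
    (f := fun z : CSpace n × CSpace n => G.mul (G.inv z.1) z.2)
    (contDiff_mul G (contDiff_inv G contDiff_fst) contDiff_snd) G.one 1 ρ
  have hdet : ContDiff ℝ (⊤ : ℕ∞) (fun z : CSpace n × CSpace n =>
      (fderiv ℝ (fun q => G.mul (G.inv z.1) q) z.2).det) :=
    contDiff_det ((contDiff_fderiv_left G).comp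
      ((contDiff_inv G contDiff_fst).prodMk contDiff_snd))
  obtain ⟨C2, hC2, h2⟩ := exists_lipschitz_fst hdet G.one 1 ρ
  refine ⟨min 1 (min (δ / C1) (1 / C2)), by positivity, min_le_left _ _, ?_⟩
  intro g hg
  have hg1 : ‖g - G.one‖ ≤ 1 := hg.trans (min_le_left _ _)
  have hg2 : C1 * ‖g - G.one‖ ≤ δ := by
    have := hg.trans ((min_le_right _ _).trans (min_le_left _ _))
    rw [le_div_iff₀ hC1] at this; linarith
  have hg3 : C2 * ‖g - G.one‖ ≤ 1 := by
    have := hg.trans ((min_le_right _ _).trans (min_le_right _ _))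
    rw [le_div_iff₀ hC2] at this; linarith
  have hq : ∀ q, ‖q‖ ≤ ρ → ‖G.mul (G.inv g) q - q‖ ≤ δ := by
    intro q hq
    have h4 := h1 g q hg1 hq
    simp only [inv_one', G.one_mul'] at h4
    exact h4.trans hg2
  refine ⟨hq, fun w hw => ?_⟩
  have hT : TF (ρ + δ) (fun p => w (G.mul g p)) := by
    refine ⟨hw.1.comp (contDiff_mul G contDiff_const contDiff_id), fun p hp => ?_⟩
    have h3 := hw.2 _ hp
    have h4 := hq _ h3
    rw [inv_mul_cancel_left'] at h4
    have h5 : ‖p‖ ≤ ‖p - G.mul g p‖ + ‖G.mul g p‖ := by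
      simpa using norm_add_le (p - G.mul g p) (G.mul g p)
    linarith
  refine ⟨hT, ?_⟩
  refine nrm_comp_le (φ := fun q => G.mul (G.inv g) q) (ψ := fun p => G.mul g p)
    (contDiff_mul G contDiff_const contDiff_id) (fun x => mul_inv_cancel_left' G _ _)
    (fun x => inv_mul_cancel_left' G _ _) hw hT fun x hx => ?_
  have h3 := h2 g x hg1 hx
  have h4 : (fderiv ℝ (fun q => G.mul (G.inv G.one) q) x).det = 1 := by
    simp only [inv_one', G.one_mul', fderiv_fun_id]
    exact LinearMap.det_id
  rw [h4, Real.norm_eq_abs] at h3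
  have h5 := abs_le.1 (h3.trans hg3)
  rw [abs_le]
  constructor <;> linarith [h5.1, h5.2]

lemma det_fderiv_ne_zero {φ ψ : CSpace n → CSpace n} (hφ : ContDiff ℝ (⊤ : ℕ∞) φ)
    (hψ : ContDiff ℝ (⊤ : ℕ∞) ψ) (h : ∀ x, ψ (φ x) = x) (x : CSpace n) :
    (fderiv ℝ φ x).det ≠ 0 := by
  have h1 := (hψ.differentiable top_ne_zero (φ x)).hasFDerivAt.comp x
    (hφ.differentiable top_ne_zero x).hasFDerivAt
  have h2 : ψ ∘ φ = id := funext h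
  rw [h2] at h1
  have h3 := h1.unique (hasFDerivAt_id x)
  intro h0
  have h4 : ((fderiv ℝ ψ (φ x)).comp (fderiv ℝ φ x)).det = 1 := by
    rw [h3]; exact LinearMap.det_id
  have h5 : ((fderiv ℝ ψ (φ x)).comp (fderiv ℝ φ x)).det =
      (fderiv ℝ ψ (φ x)).det * (fderiv ℝ φ x).det := LinearMap.det_comp _ _
  rw [h5, h0, mul_zero] at h4
  exact zero_ne_one h4

lemma contDiff_abs_of_ne_zero {F : Type*} [NormedAddCommGroup F] [NormedSpace ℝ F] {f : F → ℝ}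
    (hf : ContDiff ℝ (⊤ : ℕ∞) f) (h0 : ∀ x, f x ≠ 0) : ContDiff ℝ (⊤ : ℕ∞) fun x => |f x| :=
  contDiff_iff_contDiffAt.2 fun x => (contDiffAt_abs (h0 x)).comp x hf.contDiffAt

/-- Jacobian of the left translation by `g⁻¹` at `p`, for `z = (g, p)`. -/
def jacL (z : CSpace n × CSpace n) : ℝ := |(fderiv ℝ (fun x => G.mul (G.inv z.1) x) z.2).det|

/-- Jacobian of the right translation by `q⁻¹` at `p`, for `z = (q, p)`. -/
def jacR (z : CSpace n × CSpace n) : ℝ := |(fderiv ℝ (fun x => G.mul x (G.inv z.1)) z.2).det|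

lemma contDiff_jacL : ContDiff ℝ (⊤ : ℕ∞) (jacL G) :=
  contDiff_abs_of_ne_zero (contDiff_det ((contDiff_fderiv_left G).comp
    ((contDiff_inv G contDiff_fst).prodMk contDiff_snd))) fun z =>
      det_fderiv_ne_zero (φ := fun x => G.mul (G.inv z.1) x) (ψ := fun x => G.mul z.1 x)
        (contDiff_mul G contDiff_const contDiff_id) (contDiff_mul G contDiff_const contDiff_id)
        (fun _ => mul_inv_cancel_left' G _ _) z.2

lemma contDiff_jacR : ContDiff ℝ (⊤ : ℕ∞) (jacR G) :=
  contDiff_abs_of_ne_zero (contDiff_det ((contDiff_fderiv_right G).comp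
    ((contDiff_inv G contDiff_fst).prodMk contDiff_snd))) fun z =>
      det_fderiv_ne_zero (φ := fun x => G.mul x (G.inv z.1)) (ψ := fun x => G.mul x z.1)
        (contDiff_mul G contDiff_id contDiff_const) (contDiff_mul G contDiff_id contDiff_const)
        (fun _ => inv_mul_cancel_right' G _ _) z.2

/-- The average of left translates of `φ` with weight `k`. -/
def lavg (k φ : CSpace n → ℝ) (q : CSpace n) : ℝ := ∫ g, k g * φ (G.mul g q)

/-- The transpose of `lavg`, acting on integrable functions. -/
def lavgT (k u : CSpace n → ℝ) (p : CSpace n) : ℝ :=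
  ∫ q, u q * (k (G.mul p (G.inv q)) * jacR G (q, p))

/-- The transpose of `lavg`, acting on smooth functions. -/
def lavgS (k : CSpace n → ℝ) (H : CSpace n × CSpace n → ℝ) (p : CSpace n) : ℝ :=
  ∫ g, k g * H (g, p)

variable {k φ u : CSpace n → ℝ} {R ρ : ℝ}

lemma contDiff_lavg (hk : TF R k) (hφ : ContDiff ℝ (⊤ : ℕ∞) φ) :
    ContDiff ℝ (⊤ : ℕ∞) (lavg G k φ) :=
  contDiff_integral_mul hk.integrable hk.2 (H := fun z => φ (G.mul z.1 z.2))
    (hφ.comp G.smooth_mul)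

lemma dvf_lavg (hk : TF R k) (hφ : ContDiff ℝ (⊤ : ℕ∞) φ) (l : ℕ) (i : Fin (G.m l)) :
    Dvf (G.X l i) (lavg G k φ) = lavg G k (Dvf (G.X l i) φ) := by
  funext q
  have h := dvf_integral_mul hk.integrable hk.2 (H := fun z => φ (G.mul z.1 z.2))
    (hφ.comp G.smooth_mul) (G.X l i) q
  refine h.trans (integral_congr_ae (Eventually.of_forall fun g => ?_))
  have h1 : HasFDerivAt (fun q => φ (G.mul g q)) _ q :=
    (hφ.differentiable top_ne_zero (G.mul g q)).hasFDerivAt.comp q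
      ((contDiff_mul G contDiff_const contDiff_id).differentiable top_ne_zero q).hasFDerivAt
  simp only [Dvf]
  rw [h1.fderiv, G.left_invariant_X]
  rfl

lemma contDiff_lavgT (hk : TF R k) (hu : Integrable u) (hu0 : ∀ g, u g ≠ 0 → ‖g‖ ≤ ρ) :
    ContDiff ℝ (⊤ : ℕ∞) (lavgT G k u) :=
  contDiff_integral_mul hu hu0 (H := fun z => k (G.mul z.2 (G.inv z.1)) * jacR G z)
    ((hk.1.comp (contDiff_mul G contDiff_snd (contDiff_inv G contDiff_fst))).mul
      (contDiff_jacR G))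

lemma contDiff_lavgS (hk : TF R k) {H : CSpace n × CSpace n → ℝ} (hH : ContDiff ℝ (⊤ : ℕ∞) H) :
    ContDiff ℝ (⊤ : ℕ∞) (lavgS k H) :=
  contDiff_integral_mul hk.integrable hk.2 hH

lemma adj_lavgS (hk : TF R k) {H : CSpace n × CSpace n → ℝ} (hH : ContDiff ℝ (⊤ : ℕ∞) H)
    (Z : CSpace n → CSpace n) :
    adj Z (lavgS k H) = lavgS k fun z => adj Z (fun q => H (z.1, q)) z.2 := by
  funext p
  have hc1 : Continuous fun g => Dvf Z (fun q => H (g, q)) p :=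
    ((contDiff_partial hH).continuous.comp (continuous_id.prodMk continuous_const)).clm_apply
      continuous_const
  have hc2 : Continuous fun g => dvg Z p * H (g, p) :=
    continuous_const.mul (hH.continuous.comp (continuous_id.prodMk continuous_const))
  have i1 : Integrable fun g => k g * Dvf Z (fun q => H (g, q)) p :=
    integrable_smul_of_continuous hk.integrable hk.2 hc1
  have i2 : Integrable fun g => k g * (dvg Z p * H (g, p)) :=
    integrable_smul_of_continuous hk.integrable hk.2 hc2
  have h : Dvf Z (lavgS k H) p = _ := dvf_integral_mul hk.integrable hk.2 hH Z p
  simp only [adj]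
  rw [h, lavgS, lavgS, ← integral_const_mul]
  simp_rw [mul_add]
  rw [integral_add i1 i2]
  congr 1
  refine integral_congr_ae (Eventually.of_forall fun g => ?_)
  ring

lemma contDiff_adj_partial {H : CSpace n × CSpace n → ℝ} (hH : ContDiff ℝ (⊤ : ℕ∞) H)
    {Z : CSpace n → CSpace n} (hZ : ContDiff ℝ (⊤ : ℕ∞) Z) :
    ContDiff ℝ (⊤ : ℕ∞) fun z : CSpace n × CSpace n => adj Z (fun q => H (z.1, q)) z.2 :=
  ((contDiff_partial hH).clm_apply (hZ.comp contDiff_snd)).add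
    (((contDiff_dvg hZ).comp contDiff_snd).mul hH)

/-- Integrability on a product with compactly supported factors. -/
lemma integrable_prod_mul (hu : Integrable u) (hu0 : ∀ g, u g ≠ 0 → ‖g‖ ≤ R)
    (hφ : Integrable φ) (hφ0 : ∀ g, φ g ≠ 0 → ‖g‖ ≤ ρ) {K : CSpace n × CSpace n → ℝ}
    (hK : Continuous K) :
    Integrable (fun z : CSpace n × CSpace n => u z.1 * φ z.2 * K z) (volume.prod volume) := by
  have h1 := hu.mul_prod hφ
  have hc : IsCompact (Metric.closedBall (0 : CSpace n) R ×ˢ Metric.closedBall (0 : CSpace n) ρ) :=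
    (isCompact_closedBall _ _).prod (isCompact_closedBall _ _)
  have h2 := h1.integrableOn.mul_continuousOn hK.continuousOn hc
  refine (integrableOn_iff_integrable_of_support_subset fun z hz => ?_).1 h2
  have h3 : u z.1 ≠ 0 := fun h => hz (by simp [h])
  have h4 : φ z.2 ≠ 0 := fun h => hz (by simp [h])
  exact ⟨by simpa using hu0 _ h3, by simpa using hφ0 _ h4⟩

lemma integral_lavgT_mul (hk : TF R k) (hu : Integrable u) (hu0 : ∀ g, u g ≠ 0 → ‖g‖ ≤ ρ)
    {ρ' : ℝ} (hφ : TF ρ' φ) : ∫ p, lavgT G k u p * φ p = ∫ q, u q * lavg G k φ q := by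
  have hK : Continuous fun z : CSpace n × CSpace n => k (G.mul z.2 (G.inv z.1)) * jacR G z :=
    ((hk.1.comp (contDiff_mul G contDiff_snd (contDiff_inv G contDiff_fst))).mul
      (contDiff_jacR G)).continuous
  have hi := integrable_prod_mul hu hu0 hφ.integrable hφ.2 hK
  have hs := integral_integral_swap
    (f := fun q p => u q * φ p * (k (G.mul p (G.inv q)) * jacR G (q, p))) hi
  calc ∫ p, lavgT G k u p * φ p
      = ∫ p, ∫ q, u q * φ p * (k (G.mul p (G.inv q)) * jacR G (q, p)) := by
        refine integral_congr_ae (Eventually.of_forall fun p => ?_)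
        simp only [lavgT]
        rw [← integral_mul_const]
        exact integral_congr_ae (Eventually.of_forall fun q => by ring)
    _ = ∫ q, ∫ p, u q * φ p * (k (G.mul p (G.inv q)) * jacR G (q, p)) := hs.symm
    _ = ∫ q, u q * lavg G k φ q := by
        refine integral_congr_ae (Eventually.of_forall fun q => ?_)
        simp only [lavg]
        have e := integral_comp_diffeo (φ := fun p => G.mul p (G.inv q))
          (ψ := fun p => G.mul p q) (contDiff_mul G contDiff_id contDiff_const)
          (fun x => inv_mul_cancel_right' G _ _) (fun x => mul_inv_cancel_right' G _ _)
          (fun g => k g * φ (G.mul g q))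
        rw [e, ← integral_const_mul]
        refine integral_congr_ae (Eventually.of_forall fun p => ?_)
        simp only [inv_mul_cancel_right', jacR]
        ring

lemma integral_mul_lavg (hk : TF R k) {F : CSpace n → ℝ} (hF : ContDiff ℝ (⊤ : ℕ∞) F)
    (hφ : TF ρ φ) : ∫ q, F q * lavg G k φ q =
      ∫ p, lavgS k (fun z => F (G.mul (G.inv z.1) z.2) * jacL G z) p * φ p := by
  have hm : Continuous fun z : CSpace n × CSpace n => G.mul (G.inv z.1) z.2 :=
    (contDiff_mul G (contDiff_inv G contDiff_fst) contDiff_snd).continuous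
  have hm' : Continuous fun z : CSpace n × CSpace n => G.mul z.1 z.2 := G.smooth_mul.continuous
  obtain ⟨R', hR'⟩ := ((isCompact_closedBall (0 : CSpace n) R).prod
    (isCompact_closedBall (0 : CSpace n) ρ)).exists_bound_of_continuousOn hm.continuousOn
  have hi : Integrable (fun z : CSpace n × CSpace n => F z.1 * (k z.2 * φ (G.mul z.2 z.1)))
      (volume.prod volume) := by
    refine Continuous.integrable_of_hasCompactSupport ?_ ?_
    · exact (hF.continuous.comp continuous_fst).mul ((hk.1.continuous.comp continuous_snd).mul
        (hφ.1.continuous.comp (hm'.comp (continuous_snd.prodMk continuous_fst))))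
    · refine HasCompactSupport.of_support_subset_isCompact
        ((isCompact_closedBall (0 : CSpace n) R').prod (isCompact_closedBall (0 : CSpace n) R))
        fun z hz => ?_
      have h3 : k z.2 ≠ 0 := fun h => hz (by simp [h])
      have h4 : φ (G.mul z.2 z.1) ≠ 0 := fun h => hz (by simp [h])
      refine ⟨?_, by simpa using hk.2 _ h3⟩
      have := hR' (z.2, G.mul z.2 z.1) ⟨by simpa using hk.2 _ h3, by simpa using hφ.2 _ h4⟩
      simpa [inv_mul_cancel_left'] using this
  have hi' : Integrable (fun z : CSpace n × CSpace n =>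
      k z.1 * φ z.2 * (F (G.mul (G.inv z.1) z.2) * jacL G z)) (volume.prod volume) :=
    integrable_prod_mul hk.integrable hk.2 hφ.integrable hφ.2
      ((hF.continuous.comp hm).mul (contDiff_jacL G).continuous)
  have hs := integral_integral_swap (f := fun q g => F q * (k g * φ (G.mul g q))) hi
  have hs' := integral_integral_swap
    (f := fun g p => k g * φ p * (F (G.mul (G.inv g) p) * jacL G (g, p))) hi'
  calc ∫ q, F q * lavg G k φ q = ∫ q, ∫ g, F q * (k g * φ (G.mul g q)) := by
        refine integral_congr_ae (Eventually.of_forall fun q => ?_)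
        exact (integral_const_mul _ _).symm
    _ = ∫ g, ∫ q, F q * (k g * φ (G.mul g q)) := hs
    _ = ∫ g, ∫ p, k g * φ p * (F (G.mul (G.inv g) p) * jacL G (g, p)) := by
        refine integral_congr_ae (Eventually.of_forall fun g => ?_)
        beta_reduce
        rw [integral_comp_diffeo (φ := fun p => G.mul (G.inv g) p) (ψ := fun p => G.mul g p)
          (contDiff_mul G contDiff_const contDiff_id) (fun x => mul_inv_cancel_left' G _ _)
          (fun x => inv_mul_cancel_left' G _ _)]
        refine integral_congr_ae (Eventually.of_forall fun p => ?_)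
        simp only [mul_inv_cancel_left', jacL]
        ring
    _ = ∫ p, ∫ g, k g * φ p * (F (G.mul (G.inv g) p) * jacL G (g, p)) := hs'
    _ = _ := by
        refine integral_congr_ae (Eventually.of_forall fun p => ?_)
        simp only [lavgS]
        rw [← integral_mul_const]
        exact integral_congr_ae (Eventually.of_forall fun q => by ring)

end Mollification

/-! ### Approximate identities -/

section Kernel

variable {r n N : ℕ} (G : CarnotGroup r n)

/-- A smooth probability density concentrated within distance `a` of the identity. -/
structure IsKernel (a : ℝ) (k : CSpace n → ℝ) : Prop where
  smooth : ContDiff ℝ (⊤ : ℕ∞) k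
  nonneg : ∀ g, 0 ≤ k g
  integral_eq : ∫ g, k g = 1
  support : ∀ g, k g ≠ 0 → ‖g - G.one‖ ≤ a

variable {G} {a : ℝ} {k : CSpace n → ℝ}

lemma IsKernel.tf (hk : IsKernel G a k) : TF (‖G.one‖ + a) k := by
  refine ⟨hk.smooth, fun g hg => ?_⟩
  have := norm_add_le G.one (g - G.one)
  rw [add_sub_cancel] at this
  linarith [hk.support g hg]

lemma IsKernel.mono {a' : ℝ} (hk : IsKernel G a k) (h : a ≤ a') : IsKernel G a' k :=
  ⟨hk.smooth, hk.nonneg, hk.integral_eq, fun g hg => (hk.support g hg).trans h⟩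

variable (G) in
lemma exists_kernels (ha : 0 < a) : ∃ K : ℕ → CSpace n → ℝ, (∀ j, IsKernel G a (K j)) ∧
    ∀ b, 0 < b → ∀ᶠ j in atTop, IsKernel G b (K j) := by
  obtain ⟨χ, h1, h2, h3, h4⟩ := exists_mollifier n
  have hτ : ∀ j : ℕ, 0 < a / (j + 1) := fun j => by positivity
  have hK : ∀ j : ℕ, IsKernel G (a / (j + 1)) (moll χ G.one (a / (j + 1))) := fun j =>
    ⟨contDiff_moll h1, fun g => mul_nonneg (by have := hτ j; positivity) (h2 _),
      integral_moll (hτ j) h4, fun g hg => moll_support (hτ j) h3 hg⟩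
  refine ⟨fun j => moll χ G.one (a / (j + 1)), fun j => (hK j).mono ?_, fun b hb => ?_⟩
  · exact div_le_self ha.le (by linarith [(Nat.cast_nonneg j : (0 : ℝ) ≤ j)])
  · have ht : Tendsto (fun j : ℕ => a * (1 / ((j : ℝ) + 1))) atTop (𝓝 (a * 0)) :=
      tendsto_one_div_add_atTop_nhds_zero_nat.const_mul a
    rw [mul_zero] at ht
    filter_upwards [ht.eventually_lt_const hb] with j hj
    exact (hK j).mono (by rw [mul_one_div] at hj; exact hj.le)

/-- Averaging against a kernel is monotone. -/
lemma IsKernel.abs_integral_mul_le (hk : IsKernel G a k) {f : CSpace n → ℝ} {C : ℝ} (hC : ∀ g, ‖g - G.one‖ ≤ a → |f g| ≤ C) : |∫ g, k g * f g| ≤ C := by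
  have h1 : ∫ g, k g * C = C := by rw [integral_mul_const, hk.integral_eq, one_mul]
  have h2 := norm_integral_le_of_norm_le (hk.tf.integrable.mul_const C)
    (f := fun g => k g * f g) (Eventually.of_forall fun g => ?_)
  · rwa [h1] at h2
  · by_cases h : k g = 0
    · simp [h]
    · rw [norm_mul, Real.norm_of_nonneg (hk.nonneg g)]
      exact mul_le_mul_of_nonneg_left (hC g (hk.support g h)) (hk.nonneg g)

lemma IsKernel.nrm_lavg_le (hk : IsKernel G a k) {ρ ρ' : ℝ}
    (ha : ∀ g, ‖g - G.one‖ ≤ a → ∀ w, TF ρ w → TF ρ' (fun p => w (G.mul g p)) ∧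
        nrm volume (fun p => w (G.mul g p)) ≤ 2 * nrm volume w) {φ : CSpace n → ℝ}
    (hφ : TF ρ φ) : nrm volume (lavg G k φ) ≤ 2 * nrm volume φ := by
  have hs := isCompact_closedBall G.one a
  have hms : ∀ g, g ∈ Metric.closedBall G.one a → ‖g - G.one‖ ≤ a := fun g hg => by
    simpa [dist_eq_norm] using hg
  have hc : Continuous (Function.uncurry fun g p => φ (G.mul g p)) :=
    hφ.1.continuous.comp G.smooth_mul.continuous
  have h0 : ∀ g, g ∉ Metric.closedBall G.one a → k g = 0 := by
    intro g hg
    by_contra h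
    exact hg (by simpa [dist_eq_norm] using hk.support g h)
  have h1 := nrm_setIntegral_le hs hk.smooth.continuous (w := fun g p => φ (G.mul g p)) hc
    (ρ := ρ') (M := 2 * nrm volume φ) (by have := nrm_nonneg (μ := volume) (f := φ); positivity)
    (fun g hg => (ha g (hms g hg) φ hφ).1.2) (fun g hg _ => (ha g (hms g hg) φ hφ).2)
  have h2 : ∫ g in Metric.closedBall G.one a, |k g| = 1 := by
    rw [setIntegral_eq_integral_of_forall_compl_eq_zero fun g hg => by simp [h0 g hg],
      ← hk.integral_eq]
    exact integral_congr_ae (Eventually.of_forall fun g => abs_of_nonneg (hk.nonneg g))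
  have h3 : lavg G k φ = fun p => ∫ g in Metric.closedBall G.one a, k g * φ (G.mul g p) := by
    funext p
    exact (setIntegral_eq_integral_of_forall_compl_eq_zero fun g hg => by simp [h0 g hg]).symm
  rw [h2, one_mul, ← h3] at h1
  exact h1

lemma IsKernel.lavg_support (hk : IsKernel G a k) {φ : CSpace n → ℝ} {s : Set (CSpace n)}
    (hs : ∀ g q, ‖g - G.one‖ ≤ a → φ (G.mul g q) ≠ 0 → q ∈ s) {q : CSpace n}
    (hq : lavg G k φ q ≠ 0) : q ∈ s := by
  by_contra h
  refine hq (integral_eq_zero_of_ae (Eventually.of_forall fun g => ?_))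
  by_cases h1 : k g = 0
  · simp [h1]
  · by_cases h2 : φ (G.mul g q) = 0
    · simp [h2]
    · exact absurd (hs g q (hk.support g h1) h2) h

lemma IsKernel.nrm_mul_lavgT_le (hk : IsKernel G a k) {ρ δ R : ℝ}
    (ha : ∀ g, ‖g - G.one‖ ≤ a → ∀ w, TF ρ w → TF (ρ + δ) (fun p => w (G.mul g p)) ∧
        nrm volume (fun p => w (G.mul g p)) ≤ 2 * nrm volume w) {u ζ : CSpace n → ℝ}
    (hu : Integrable u) (hu0 : ∀ g, u g ≠ 0 → ‖g‖ ≤ R) (hu2 : MemLp u 2) (hζ : TF ρ ζ)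
    (hζ1 : ∀ x, |ζ x| ≤ 1) :
    nrm volume (fun p => ζ p * lavgT G k u p) ≤ 2 * nrm volume u := by
  have hh := contDiff_lavgT G hk.tf hu hu0
  set h := lavgT G k u with hdef
  have t1 : TF ρ (fun p => ζ p * h p) := by
    simpa only [mul_comm] using hζ.mul_left hh
  have t2 : TF ρ (fun p => ζ p * (ζ p * h p)) := t1.mul_left hζ.1
  have e := integral_lavgT_mul G hk.tf hu hu0 t2
  have hl : MemLp (lavg G k fun p => ζ p * (ζ p * h p)) 2 := by
    refine (contDiff_lavg G hk.tf t2.1).continuous.memLp_of_hasCompactSupport ?_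
    refine HasCompactSupport.of_support_subset_isCompact
      (isCompact_closedBall (0 : CSpace n) (ρ + δ)) fun q hq => ?_
    refine hk.lavg_support (s := Metric.closedBall 0 (ρ + δ)) (fun g q hg hq => ?_) hq
    simpa using (ha g hg _ t2).1.2 q hq
  have h1 : nrm volume (fun p => ζ p * h p) ^ 2 = ∫ p, h p * (ζ p * (ζ p * h p)) := by
    rw [nrm_sq t1.memLp]
    exact integral_congr_ae (Eventually.of_forall fun p => by ring)
  have h2 : nrm volume (fun p => ζ p * (ζ p * h p)) ≤ nrm volume (fun p => ζ p * h p) := by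
    refine nrm_mono t1.memLp (Eventually.of_forall fun p => ?_)
    rw [abs_mul]
    exact mul_le_of_le_one_left (abs_nonneg _) (hζ1 p)
  have h3 := Hypoelliptic.abs_integral_mul_le hu2 hl
  have h4 := hk.nrm_lavg_le ha t2
  rw [← e, ← h1, abs_of_nonneg (sq_nonneg _)] at h3
  have n1 := nrm_nonneg (μ := volume) (f := fun p => ζ p * h p)
  have n2 := nrm_nonneg (μ := volume) (f := u)
  rcases n1.eq_or_lt with h0 | h0
  · rw [← h0]; positivity
  · have : nrm volume (fun p => ζ p * h p) * nrm volume (fun p => ζ p * h p) ≤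
        2 * nrm volume u * nrm volume (fun p => ζ p * h p) := by
      calc _ = nrm volume (fun p => ζ p * h p) ^ 2 := (sq _).symm
        _ ≤ nrm volume u * nrm volume (lavg G k fun p => ζ p * (ζ p * h p)) := h3
        _ ≤ nrm volume u * (2 * nrm volume (fun p => ζ p * h p)) := by
          gcongr
          exact h4.trans (by gcongr)
        _ = _ := by ring
    exact le_of_mul_le_mul_right this h0

lemma bddSeq_lavgS (ha : a ≤ 1) {K : ℕ → CSpace n → ℝ} (hK : ∀ j, IsKernel G a (K j))
    (x₀ : CSpace n) (ρ₁ : ℝ) (m : ℕ) {H : CSpace n × CSpace n → ℝ}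
    (hH : ContDiff ℝ (⊤ : ℕ∞) H) : BddSeq G x₀ ρ₁ m fun j => lavgS (K j) H := by
  have h0 : ∀ {H : CSpace n × CSpace n → ℝ} (_ : ContDiff ℝ (⊤ : ℕ∞) H),
      BddSeq G x₀ ρ₁ 0 fun j => lavgS (K j) H := by
    intro H hH ρ _ _
    obtain ⟨C, hC⟩ := ((isCompact_closedBall G.one 1).prod
      (isCompact_closedBall x₀ ρ)).exists_bound_of_continuousOn hH.continuous.continuousOn
    refine ⟨nB x₀ ρ fun _ => C, fun j => ?_⟩
    refine nrm_mono (memLp_ball continuous_const)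
      ((ae_restrict_iff' measurableSet_ball).2 (Eventually.of_forall fun p hp => ?_))
    refine ((hK j).abs_integral_mul_le fun g hg =>
        hC (g, p) ⟨?_, Metric.ball_subset_closedBall hp⟩).trans (le_abs_self C)
    simpa [dist_eq_norm] using hg.trans ha
  induction m generalizing H with
  | zero => exact h0 hH
  | succ m ih =>
    refine ⟨h0 hH, fun b => ?_⟩
    have e : (fun j => adj (rfield G b) (lavgS (K j) H)) = fun j =>
        lavgS (K j) fun z => adj (rfield G b) (fun q => H (z.1, q)) z.2 :=
      funext fun j => adj_lavgS (hK j).tf hH _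
    rw [e]
    exact ih (contDiff_adj_partial hH (contDiff_rfield G b))

/-- Mollifications converge weakly. -/
lemma tendsto_integral_lavgT {K : ℕ → CSpace n → ℝ}
    (hK : ∀ j, IsKernel G a (K j)) (hK' : ∀ b, 0 < b → ∀ᶠ j in atTop, IsKernel G b (K j))
    {u φ : CSpace n → ℝ} {R ρ : ℝ} (hu : Integrable u) (hu0 : ∀ g, u g ≠ 0 → ‖g‖ ≤ R)
    (hφ : TF ρ φ) :
    Tendsto (fun j => ∫ p, lavgT G (K j) u p * φ p) atTop (𝓝 (∫ p, u p * φ p)) := by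
  have e : ∀ j, ∫ p, lavgT G (K j) u p * φ p = ∫ q, u q * lavg G (K j) φ q := fun j =>
    integral_lavgT_mul G (hK j).tf hu hu0 hφ
  simp_rw [e]
  have hc : ∀ q, Continuous fun g => φ (G.mul g q) := fun q =>
    hφ.1.continuous.comp (contDiff_mul G contDiff_id contDiff_const).continuous
  obtain ⟨C, hC⟩ := hφ.1.continuous.bounded_above_of_compact_support hφ.hasCompactSupport
  refine tendsto_integral_of_dominated_convergence (fun q => |u q| * C) (fun j => ?_)
    (hu.abs.mul_const C) (fun j => Eventually.of_forall fun q => ?_)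
    (Eventually.of_forall fun q => ?_)
  · exact hu.1.mul (contDiff_lavg G (hK j).tf hφ.1).continuous.aestronglyMeasurable
  · rw [norm_mul]
    exact mul_le_mul_of_nonneg_left ((hK j).abs_integral_mul_le fun g _ => hC _)
      (abs_nonneg _)
  · refine Tendsto.const_mul _ (Metric.tendsto_atTop'.2 fun ε hε => ?_)
    obtain ⟨b, hb, h⟩ := Metric.continuous_iff.1 (hc q) G.one (ε / 2) (half_pos hε)
    obtain ⟨j₀, hj₀⟩ := eventually_atTop.1 (hK' (b / 2) (half_pos hb))
    refine ⟨j₀, fun j hj => ?_⟩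
    have hk := hj₀ j hj.le
    have i1 : Integrable fun g => K j g * φ (G.mul g q) :=
      integrable_smul_of_continuous hk.tf.integrable hk.tf.2 (hc q)
    have i2 : Integrable fun g => K j g * φ q := hk.tf.integrable.mul_const _
    have h1 : lavg G (K j) φ q - φ q = ∫ g, K j g * (φ (G.mul g q) - φ q) := by
      simp_rw [mul_sub]
      rw [integral_sub i1 i2, integral_mul_const, hk.integral_eq, one_mul]
      rfl
    rw [Real.dist_eq, h1]
    refine (hk.abs_integral_mul_le fun g hg => ?_).trans_lt
      (half_lt_self hε)
    have := h g (by rw [dist_eq_norm]; linarith)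
    rw [G.one_mul', Real.dist_eq] at this
    exact this.le

lemma integral_Lop_mul {A : Fin N → Fin N → Fin (G.m 1) → Fin (G.m 1) → ℝ}
    {u : Fin N → CSpace n → ℝ} (hu : ∀ β, ContDiff ℝ (⊤ : ℕ∞) (u β)) {φ : CSpace n → ℝ} {ρ : ℝ}
    (hφ : TF ρ φ) (α : Fin N) : ∫ p, Lop G A u α p * φ p =
      ∑ β, ∑ i, ∑ j, A α β i j * ∫ p, u β p * Dvf (G.X 1 j) (Dvf (G.X 1 i) φ) p := by
  have hs : ∀ β i j, ContDiff ℝ (⊤ : ℕ∞) (adj (G.X 1 i) (adj (G.X 1 j) (u β))) := fun β i j =>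
    contDiff_adj (G.smooth_X 1 i) (contDiff_adj (G.smooth_X 1 j) (hu β))
  have hi : ∀ β i j, Integrable fun p =>
      A α β i j * adj (G.X 1 i) (adj (G.X 1 j) (u β)) p * φ p := fun β i j => by
    have := (hφ.mul_left (hs β i j)).integrable.const_mul (A α β i j)
    simpa only [mul_assoc] using this
  unfold Lop
  simp_rw [Finset.sum_mul]
  rw [integral_finsetSum _ fun β _ => integrable_finsetSum _ fun i _ =>
    integrable_finsetSum _ fun j _ => hi β i j]
  refine Finset.sum_congr rfl fun β _ => ?_
  rw [integral_finsetSum _ fun i _ => integrable_finsetSum _ fun j _ => hi β i j]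
  refine Finset.sum_congr rfl fun i _ => ?_
  rw [integral_finsetSum _ fun j _ => hi β i j]
  refine Finset.sum_congr rfl fun j _ => ?_
  simp_rw [mul_assoc]
  rw [integral_const_mul]
  congr 1
  have hφ' := hφ.dvf (G.smooth_X 1 i)
  rw [integral_adj (G.smooth_X 1 i) (contDiff_adj (G.smooth_X 1 j) (hu β)) hφ.1
    hφ.hasCompactSupport]
  rw [← neg_eq_iff_eq_neg.2 (integral_adj (G.smooth_X 1 j) (hu β) hφ'.1 hφ'.hasCompactSupport)]

/-- Mollified weak solutions solve the mollified system. -/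
lemma IsKernel.Lop_lavgT_eq (hk : IsKernel G a k) {x₀ : CSpace n} {ρ₁ R₁ R : ℝ}
    (ha : ∀ g q, ‖g - G.one‖ ≤ a → ‖G.mul g q - x₀‖ ≤ ρ₁ → ‖q - x₀‖ ≤ R₁)
    {A : Fin N → Fin N → Fin (G.m 1) → Fin (G.m 1) → ℝ} {u : Fin N → CSpace n → ℝ}
    (hu : ∀ β, Integrable (u β)) (hu0 : ∀ β g, u β g ≠ 0 → ‖g‖ ≤ R) {F : CSpace n → ℝ}
    (hF : ContDiff ℝ (⊤ : ℕ∞) F) {α : Fin N}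
    (hd : ∀ φ : CSpace n → ℝ, ContDiff ℝ (⊤ : ℕ∞) φ → (∀ p, φ p ≠ 0 → ‖p - x₀‖ ≤ R₁) →
      ∑ β, ∑ i, ∑ j, A α β i j * ∫ p, u β p * Dvf (G.X 1 j) (Dvf (G.X 1 i) φ) p =
        ∫ p, F p * φ p) {p : CSpace n} (hp : p ∈ Metric.ball x₀ ρ₁) :
    Lop G A (fun β => lavgT G k (u β)) α p =
      lavgS k (fun z => F (G.mul (G.inv z.1) z.2) * jacL G z) p := by
  have hs : ∀ β, ContDiff ℝ (⊤ : ℕ∞) (lavgT G k (u β)) := fun β =>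
    contDiff_lavgT G hk.tf (hu β) (hu0 β)
  have c1 : Continuous (Lop G A (fun β => lavgT G k (u β)) α) := (contDiff_Lop G hs α).continuous
  have c2 : Continuous (lavgS k fun z => F (G.mul (G.inv z.1) z.2) * jacL G z) :=
    (contDiff_lavgS hk.tf ((hF.comp (contDiff_mul G (contDiff_inv G contDiff_fst)
      contDiff_snd)).mul (contDiff_jacL G))).continuous
  have hInt : ∀ φ : CSpace n → ℝ, ContDiff ℝ (⊤ : ℕ∞) φ →
      (∀ p, φ p ≠ 0 → ‖p - x₀‖ ≤ ρ₁) →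
      ∫ p, Lop G A (fun β => lavgT G k (u β)) α p * φ p =
        ∫ p, lavgS k (fun z => F (G.mul (G.inv z.1) z.2) * jacL G z) p * φ p := by
    intro φ hφ hφ0
    have ht : TF (‖x₀‖ + ρ₁) φ := ⟨hφ, fun p hp => by
      have := norm_add_le x₀ (p - x₀)
      rw [add_sub_cancel] at this
      linarith [hφ0 p hp]⟩
    rw [integral_Lop_mul hs ht, ← integral_mul_lavg G hk.tf hF ht,
      ← hd (lavg G k φ) (contDiff_lavg G hk.tf hφ) fun q hq => ?_]
    · refine Finset.sum_congr rfl fun β _ => Finset.sum_congr rfl fun i _ =>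
        Finset.sum_congr rfl fun j _ => ?_
      have hi := ht.dvf (G.smooth_X 1 i)
      rw [integral_lavgT_mul G hk.tf (hu β) (hu0 β) (hi.dvf (G.smooth_X 1 j)),
        dvf_lavg G hk.tf hφ, dvf_lavg G hk.tf hi.1]
    · exact hk.lavg_support (s := {q | ‖q - x₀‖ ≤ R₁})
        (fun g q hg h => ha g q hg (hφ0 _ h)) hq
  have hae := Metric.isOpen_ball.ae_eq_zero_of_integral_contDiff_smul_eq_zero (μ := volume)
    (U := Metric.ball x₀ ρ₁) (f := fun p => Lop G A (fun β => lavgT G k (u β)) α p -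
      lavgS k (fun z => F (G.mul (G.inv z.1) z.2) * jacL G z) p)
    ((c1.sub c2).locallyIntegrable.locallyIntegrableOn _) fun φ hφ hc hts => ?_
  · refine Measure.eqOn_open_of_ae_eq (μ := volume) ?_ Metric.isOpen_ball c1.continuousOn
      c2.continuousOn hp
    refine (ae_restrict_iff' measurableSet_ball).2 (hae.mono fun x hx hx' => ?_)
    exact sub_eq_zero.1 (hx hx')
  · have h0 : ∀ p, φ p ≠ 0 → ‖p - x₀‖ ≤ ρ₁ := fun p hp => by
      have := hts (subset_tsupport _ hp)
      rw [Metric.mem_ball, dist_eq_norm] at this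
      exact this.le
    have i1 : Integrable fun p => Lop G A (fun β => lavgT G k (u β)) α p * φ p :=
      (c1.mul hφ.continuous).integrable_of_hasCompactSupport hc.mul_left
    have i2 : Integrable fun p =>
        lavgS k (fun z => F (G.mul (G.inv z.1) z.2) * jacL G z) p * φ p :=
      (c2.mul hφ.continuous).integrable_of_hasCompactSupport hc.mul_left
    have h1 := hInt φ hφ h0
    rw [← sub_eq_zero, ← integral_sub i1 i2] at h1
    rw [← h1]
    refine integral_congr_ae (Eventually.of_forall fun p => ?_)
    simp only [smul_eq_mul]
    ring

/-- Approximation of a weak solution by smooth functions bounded to all orders. -/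
lemma exists_approx {A : Fin N → Fin N → Fin (G.m 1) → Fin (G.m 1) → ℝ} {lam : ℝ}
    (hlam : 0 < lam) (hco : G.Coercive lam A) {x₀ : CSpace n} {ρ₁ R₁ R : ℝ}
    (h01 : ρ₁ < R₁) {u : Fin N → CSpace n → ℝ}
    (hu : ∀ β, Integrable (u β)) (hu0 : ∀ β g, u β g ≠ 0 → ‖g‖ ≤ R) (hu2 : ∀ β, MemLp (u β) 2)
    {F : Fin N → CSpace n → ℝ} (hF : ∀ α, ContDiff ℝ (⊤ : ℕ∞) (F α))
    (hd : ∀ α, ∀ φ : CSpace n → ℝ, ContDiff ℝ (⊤ : ℕ∞) φ → (∀ p, φ p ≠ 0 → ‖p - x₀‖ ≤ R₁) →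
      ∑ β, ∑ i, ∑ j, A α β i j * ∫ p, u β p * Dvf (G.X 1 j) (Dvf (G.X 1 i) φ) p =
        ∫ p, F α p * φ p) :
    ∃ w : ℕ → Fin N → CSpace n → ℝ, (∀ j α, ContDiff ℝ (⊤ : ℕ∞) (w j α)) ∧
      (∀ m α, BddSeq G x₀ ρ₁ m fun j => w j α) ∧
      ∀ α φ ρ, TF ρ φ →
        Tendsto (fun j => ∫ p, w j α p * φ p) atTop (𝓝 (∫ p, u α p * φ p)) := by
  obtain ⟨a, ha0, ha1, ha⟩ := exists_left_translation_bound G (‖x₀‖ + ρ₁) (sub_pos.2 h01)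
  obtain ⟨K, hK, hK'⟩ := exists_kernels G ha0
  have hs : ∀ j α, ContDiff ℝ (⊤ : ℕ∞) (lavgT G (K j) (u α)) := fun j α =>
    contDiff_lavgT G (hK j).tf (hu α) (hu0 α)
  have htr : ∀ {p : CSpace n}, ‖p - x₀‖ ≤ ρ₁ → ‖p‖ ≤ ‖x₀‖ + ρ₁ := fun {p} hp => by
    have := norm_add_le x₀ (p - x₀)
    rw [add_sub_cancel] at this
    linarith
  refine ⟨fun j α => lavgT G (K j) (u α), hs, fun m α => ?_, fun α φ ρ hφ =>
    tendsto_integral_lavgT hK hK' (hu α) (hu0 α) hφ⟩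
  refine bddSeq_of_Lop hlam hco m hs (fun α ρ hρ hρ' => ?_) (fun m α => ?_) α
  · obtain ⟨C, -, hC⟩ := exists_cutoff x₀
    obtain ⟨ζ, z1, z2, z3, z4, z5, -⟩ := hC ρ ρ₁ hρ hρ'
    refine ⟨2 * nrm volume (u α), fun j => ?_⟩
    have hζ : TF (‖x₀‖ + ρ₁) ζ := ⟨z1, fun x hx => htr (by
      rw [← dist_eq_norm]; exact (Metric.mem_ball.1 (z5 x hx)).le)⟩
    refine le_trans ?_ ((hK j).nrm_mul_lavgT_le (fun g hg => (ha g hg).2) (hu α) (hu0 α) (hu2 α)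
      hζ fun x => by rw [abs_of_nonneg (z2 x)]; exact z3 x)
    have t : TF (‖x₀‖ + ρ₁) fun p => ζ p * lavgT G (K j) (u α) p := by
      simpa only [mul_comm] using hζ.mul_left (hs j α)
    exact nB_le_nrm t.memLp fun x hx => by rw [z4 x hx, one_mul]
  · refine BddSeq.congr (bddSeq_lavgS ha1 hK x₀ ρ₁ m
      (H := fun z => F α (G.mul (G.inv z.1) z.2) * jacL G z)
      (((hF α).comp (contDiff_mul G (contDiff_inv G contDiff_fst)
      contDiff_snd)).mul (contDiff_jacL G))) fun j x hx => ?_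
    refine (hK j).Lop_lavgT_eq (fun g q hg hq => ?_) hu hu0 (hF α) (hd α) hx
    have := (ha g hg).1 _ (htr hq)
    rw [inv_mul_cancel_left'] at this
    calc ‖q - x₀‖ = ‖(q - G.mul g q) + (G.mul g q - x₀)‖ := by rw [sub_add_sub_cancel]
      _ ≤ R₁ := by linarith [norm_add_le (q - G.mul g q) (G.mul g q - x₀)]

end Kernel

/-! ### The Fourier transform and smoothness -/

section Fourier

open scoped FourierTransform RealInnerProductSpace

variable {n : ℕ}

/-- The Fourier transform of a real-valued function. -/
def rfourier (f : CSpace n → ℝ) : CSpace n → ℂ := 𝓕 fun x => (f x : ℂ)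

lemma norm_rfourier_le (f : CSpace n → ℝ) (ξ : CSpace n) : ‖rfourier f ξ‖ ≤ ∫ x, |f x| := by
  refine (VectorFourier.norm_fourierIntegral_le_integral_norm _ _ _ _ _).trans (le_of_eq ?_)
  simp

/-- The partial derivative along the `i`-th coordinate. -/
def pd (i : Fin n) (f : CSpace n → ℝ) : CSpace n → ℝ :=
  fun x => fderiv ℝ f x (EuclideanSpace.single i 1)

lemma contDiff_pd {f : CSpace n → ℝ} (hf : ContDiff ℝ (⊤ : ℕ∞) f) (i : Fin n) :
    ContDiff ℝ (⊤ : ℕ∞) (pd i f) :=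
  (hf.fderiv_right (m := (⊤ : ℕ∞)) (by simp)).clm_apply contDiff_const

lemma TF.pd {ρ : ℝ} {f : CSpace n → ℝ} (hf : TF ρ f) (i : Fin n) : TF ρ (pd i f) :=
  hf.dvf (Z := fun _ => EuclideanSpace.single i 1) contDiff_const

lemma norm_rfourier_pd {ρ : ℝ} {f : CSpace n → ℝ} (hf : TF ρ f) (i : Fin n) (ξ : CSpace n) :
    ‖rfourier (pd i f) ξ‖ = 2 * Real.pi * |ξ i| * ‖rfourier f ξ‖ := by
  have hd : ∀ x, HasFDerivAt (fun x => (f x : ℂ)) (Complex.ofRealCLM.comp (fderiv ℝ f x)) x :=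
    fun x => Complex.ofRealCLM.hasFDerivAt.comp (f := f) x
      (hf.1.differentiable (by simp) x).hasFDerivAt
  have hfd : fderiv ℝ (fun x => (f x : ℂ)) = fun x => Complex.ofRealCLM.comp (fderiv ℝ f x) :=
    funext fun x => (hd x).fderiv
  have hc : Continuous (fderiv ℝ f) := hf.1.continuous_fderiv (by simp)
  have hi : Integrable (fderiv ℝ fun x => (f x : ℂ)) := by
    refine Continuous.integrable_of_hasCompactSupport ?_ ?_
    · rw [hfd]
      exact continuous_const.clm_comp hc
    · rw [hfd]
      exact (hf.hasCompactSupport.fderiv ℝ).comp_left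
        (g := fun L => Complex.ofRealCLM.comp L) (by simp)
  have hI : Integrable fun x => (f x : ℂ) := hf.integrable.ofReal
  have key := congrFun (Real.fourier_fderiv hI
    (fun x => (hd x).differentiableAt) hi) ξ
  have key2 := congrArg (fun L : CSpace n →L[ℝ] ℂ => L (EuclideanSpace.single i 1)) key
  have e1 : (𝓕 (fderiv ℝ fun x => (f x : ℂ)) ξ) (EuclideanSpace.single i 1) =
      rfourier (pd i f) ξ := by
    rw [rfourier, Real.fourier_eq, Real.fourier_eq, ContinuousLinearMap.integral_apply]
    · simp only [hfd]
      rfl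
    · exact (Real.fourierIntegral_convergent_iff ξ).2 hi
  beta_reduce at key2
  rw [e1] at key2
  have e2 : innerSL ℝ ξ (EuclideanSpace.single i 1) = ξ i := by
    rw [innerSL_apply_apply, EuclideanSpace.inner_single_right]
    simp
  rw [key2, VectorFourier.fourierSMulRight_apply]
  simp only [neg_apply, e2, rfourier]
  simp [abs_of_pos Real.pi_pos]
  ring

lemma TF.pd_iterate {ρ : ℝ} {f : CSpace n → ℝ} (hf : TF ρ f) (i : Fin n) (m : ℕ) :
    TF ρ ((Hypoelliptic.pd i)^[m] f) := by
  induction m with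
  | zero => exact hf
  | succ m ih =>
    rw [Function.iterate_succ_apply']
    exact ih.pd i

lemma norm_rfourier_pd_iterate {ρ : ℝ} {f : CSpace n → ℝ} (hf : TF ρ f) (i : Fin n) (m : ℕ)
    (ξ : CSpace n) :
    ‖rfourier ((pd i)^[m] f) ξ‖ = (2 * Real.pi * |ξ i|) ^ m * ‖rfourier f ξ‖ := by
  induction m with
  | zero => simp
  | succ m ih =>
    rw [Function.iterate_succ_apply', norm_rfourier_pd (hf.pd_iterate i m), ih]
    ring

lemma norm_le_sum_abs (ξ : CSpace n) : ‖ξ‖ ≤ ∑ i, |ξ i| := by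
  have h : ξ = ∑ i, EuclideanSpace.single i (ξ i) := by
    ext j
    simp [Pi.single_apply]
  calc ‖ξ‖ = ‖∑ i, EuclideanSpace.single i (ξ i)‖ := by rw [← h]
    _ ≤ ∑ i, ‖EuclideanSpace.single i (ξ i)‖ := norm_sum_le _ _
    _ = ∑ i, |ξ i| := by simp

lemma one_add_norm_pow_le (ξ : CSpace n) (m : ℕ) :
    (1 + ‖ξ‖) ^ (m + 1) ≤ 2 ^ m * (1 + (n : ℝ) ^ m * ∑ i, |ξ i| ^ (m + 1)) := by
  have h1 : (∑ i, |ξ i|) ^ (m + 1) ≤ (n : ℝ) ^ m * ∑ i, |ξ i| ^ (m + 1) := by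
    simpa using pow_sum_le_card_mul_sum_pow (s := Finset.univ) (f := fun i => |ξ i|)
      (fun i _ => abs_nonneg _) m
  have h2 := add_pow_le zero_le_one (norm_nonneg ξ) (m + 1)
  simp only [one_pow, Nat.add_sub_cancel] at h2
  refine h2.trans ?_
  gcongr
  exact (pow_le_pow_left₀ (norm_nonneg ξ) (norm_le_sum_abs ξ) _).trans h1

lemma exists_rfourier_decay {ρ : ℝ} {w : ℕ → CSpace n → ℝ} (hw : ∀ j, TF ρ (w j))
    (hb : ∀ i m, ∃ C, ∀ j, ∫ x, |(pd i)^[m] (w j) x| ≤ C) (hb0 : ∃ C, ∀ j, ∫ x, |w j x| ≤ C)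
    (m : ℕ) : ∃ C, ∀ j ξ, (1 + ‖ξ‖) ^ (m + 1) * ‖rfourier (w j) ξ‖ ≤ C := by
  choose C hC using fun i => hb i (m + 1)
  obtain ⟨C0, hC0⟩ := hb0
  refine ⟨2 ^ m * (C0 + (n : ℝ) ^ m * ∑ i, C i), fun j ξ => ?_⟩
  have h1 : ∀ i, |ξ i| ^ (m + 1) * ‖rfourier (w j) ξ‖ ≤ C i := by
    intro i
    refine le_trans ?_ ((norm_rfourier_le _ ξ).trans (hC i j))
    rw [norm_rfourier_pd_iterate (hw j)]
    gcongr
    nlinarith [Real.pi_gt_three, abs_nonneg (ξ i)]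
  calc (1 + ‖ξ‖) ^ (m + 1) * ‖rfourier (w j) ξ‖
      ≤ 2 ^ m * (1 + (n : ℝ) ^ m * ∑ i, |ξ i| ^ (m + 1)) * ‖rfourier (w j) ξ‖ := by
        gcongr
        exact one_add_norm_pow_le ξ m
    _ = 2 ^ m * (‖rfourier (w j) ξ‖ +
          (n : ℝ) ^ m * ∑ i, |ξ i| ^ (m + 1) * ‖rfourier (w j) ξ‖) := by
        rw [← Finset.sum_mul]
        ring
    _ ≤ _ := by
        gcongr
        · exact (norm_rfourier_le _ ξ).trans (hC0 j)
        · exact h1 _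

lemma rfourier_eq {f : CSpace n → ℝ} (hf : Integrable f) (ξ : CSpace n) :
    rfourier f ξ = ((∫ x, f x * Real.cos (-2 * Real.pi * ⟪x, ξ⟫) : ℝ) : ℂ) +
      ((∫ x, f x * Real.sin (-2 * Real.pi * ⟪x, ξ⟫) : ℝ) : ℂ) * Complex.I := by
  have i1 : Integrable fun x => f x * Real.cos (-2 * Real.pi * ⟪x, ξ⟫) :=
    hf.mul_bdd (c := 1) (Continuous.aestronglyMeasurable (by fun_prop))
      (Eventually.of_forall fun x => Real.abs_cos_le_one _)
  have i2 : Integrable fun x => f x * Real.sin (-2 * Real.pi * ⟪x, ξ⟫) :=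
    hf.mul_bdd (c := 1) (Continuous.aestronglyMeasurable (by fun_prop))
      (Eventually.of_forall fun x => Real.abs_sin_le_one _)
  have j1 : Integrable fun x => ((f x * Real.cos (-2 * Real.pi * ⟪x, ξ⟫) : ℝ) : ℂ) := i1.ofReal
  have j2 : Integrable fun x => ((f x * Real.sin (-2 * Real.pi * ⟪x, ξ⟫) : ℝ) : ℂ) * Complex.I :=
    Integrable.mul_const (f := fun x => ((f x * Real.sin (-2 * Real.pi * ⟪x, ξ⟫) : ℝ) : ℂ))
      i2.ofReal Complex.I
  rw [rfourier, Real.fourier_eq', ← integral_complex_ofReal, ← integral_complex_ofReal,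
    ← integral_mul_const, ← integral_add j1 j2]
  congr 1
  funext x
  rw [Complex.exp_mul_I]
  push_cast
  simp only [smul_eq_mul]
  ring

lemma tendsto_rfourier {ρ : ℝ} {w : ℕ → CSpace n → ℝ} (hw : ∀ j, TF ρ (w j))
    {u : CSpace n → ℝ} (hu : Integrable u)
    (hconv : ∀ φ, ContDiff ℝ (⊤ : ℕ∞) φ →
      Tendsto (fun j => ∫ x, w j x * φ x) atTop (𝓝 (∫ x, u x * φ x))) (ξ : CSpace n) :
    Tendsto (fun j => rfourier (w j) ξ) atTop (𝓝 (rfourier u ξ)) := by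
  have hl : ContDiff ℝ (⊤ : ℕ∞) fun x : CSpace n => -2 * Real.pi * ⟪x, ξ⟫ :=
    contDiff_const.mul (contDiff_id.inner ℝ contDiff_const)
  simp_rw [fun j => rfourier_eq (hw j).integrable ξ, rfourier_eq hu ξ]
  exact ((Complex.continuous_ofReal.tendsto _).comp (hconv _ hl.cos)).add
    (((Complex.continuous_ofReal.tendsto _).comp (hconv _ hl.sin)).mul_const _)

lemma continuous_rfourier {f : CSpace n → ℝ} (hf : Integrable f) : Continuous (rfourier f) :=
  VectorFourier.fourierIntegral_continuous Real.continuous_fourierChar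
    (by exact continuous_inner) hf.ofReal

lemma integrable_pow_of_decay {g : CSpace n → ℂ} (hg : Continuous g)
    (hd : ∀ m : ℕ, ∃ C, ∀ ξ, (1 + ‖ξ‖) ^ (m + 1) * ‖g ξ‖ ≤ C) (k : ℕ) :
    Integrable fun ξ => ‖ξ‖ ^ k * ‖g ξ‖ := by
  obtain ⟨C, hC⟩ := hd (k + n)
  have hi : Integrable fun ξ : CSpace n => C * (1 + ‖ξ‖) ^ (-((n : ℝ) + 1)) :=
    (integrable_one_add_norm (by simp)).const_mul C
  refine hi.mono' (by fun_prop) (Eventually.of_forall fun ξ => ?_)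
  have h0 : (0 : ℝ) < 1 + ‖ξ‖ := by positivity
  rw [Real.norm_of_nonneg (by positivity), Real.rpow_neg h0.le, ← div_eq_mul_inv,
    le_div_iff₀ (by positivity)]
  have e : (1 + ‖ξ‖) ^ ((n : ℝ) + 1) = (1 + ‖ξ‖) ^ (n + 1) := by
    rw [← Real.rpow_natCast]
    push_cast
    rfl
  rw [e]
  refine le_trans ?_ (hC ξ)
  have h1 : ‖ξ‖ ^ k ≤ (1 + ‖ξ‖) ^ k := by gcongr; linarith
  calc ‖ξ‖ ^ k * ‖g ξ‖ * (1 + ‖ξ‖) ^ (n + 1)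
      ≤ (1 + ‖ξ‖) ^ k * ‖g ξ‖ * (1 + ‖ξ‖) ^ (n + 1) := by gcongr
    _ = _ := by ring

lemma contDiff_fourierInv_re {g : CSpace n → ℂ} (hg : Continuous g)
    (hd : ∀ m : ℕ, ∃ C, ∀ ξ, (1 + ‖ξ‖) ^ (m + 1) * ‖g ξ‖ ≤ C) :
    ContDiff ℝ (⊤ : ℕ∞) fun x => (𝓕⁻ g x).re := by
  have h : ContDiff ℝ (⊤ : ℕ∞) (𝓕 g) :=
    Real.contDiff_fourier fun k _ => integrable_pow_of_decay hg hd k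
  have h2 : ContDiff ℝ (⊤ : ℕ∞) fun x : CSpace n => 𝓕 g (-x) := h.comp contDiff_neg
  simp_rw [Real.fourierInv_eq_fourier_neg]
  exact Complex.reCLM.contDiff.comp h2

lemma exists_smooth_of_bounded {ρ : ℝ} {w : ℕ → CSpace n → ℝ} (hw : ∀ j, TF ρ (w j))
    {u : CSpace n → ℝ} (hu : Integrable u)
    (hb : ∀ i m, ∃ C, ∀ j, ∫ x, |(pd i)^[m] (w j) x| ≤ C) (hb0 : ∃ C, ∀ j, ∫ x, |w j x| ≤ C)
    (hconv : ∀ φ, ContDiff ℝ (⊤ : ℕ∞) φ →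
      Tendsto (fun j => ∫ x, w j x * φ x) atTop (𝓝 (∫ x, u x * φ x))) :
    ∃ v : CSpace n → ℝ, ContDiff ℝ (⊤ : ℕ∞) v ∧ u =ᵐ[volume] v := by
  have hlim := tendsto_rfourier hw hu hconv
  have hdec := exists_rfourier_decay hw hb hb0
  have hdu : ∀ m : ℕ, ∃ C, ∀ ξ, (1 + ‖ξ‖) ^ (m + 1) * ‖rfourier u ξ‖ ≤ C := by
    intro m
    obtain ⟨C, hC⟩ := hdec m
    exact ⟨C, fun ξ => le_of_tendsto ((hlim ξ).norm.const_mul _)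
      (Eventually.of_forall fun j => hC j ξ)⟩
  have hcu := continuous_rfourier hu
  have hdw : ∀ j, ∀ m : ℕ, ∃ C, ∀ ξ, (1 + ‖ξ‖) ^ (m + 1) * ‖rfourier (w j) ξ‖ ≤ C := by
    intro j m
    obtain ⟨C, hC⟩ := hdec m
    exact ⟨C, hC j⟩
  have hcw := fun j => continuous_rfourier (hw j).integrable
  have hinv : ∀ j x, w j x = (𝓕⁻ (rfourier (w j)) x).re := by
    intro j x
    have hi : Integrable (rfourier (w j)) := by
      have := integrable_pow_of_decay (hcw j) (hdw j) 0
      simp only [pow_zero, one_mul] at this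
      exact (integrable_norm_iff (hcw j).aestronglyMeasurable).1 this
    have hI : Integrable fun x => (w j x : ℂ) := (hw j).integrable.ofReal
    have hc : Continuous fun x => (w j x : ℂ) :=
      Complex.continuous_ofReal.comp (hw j).1.continuous
    have := congrFun (hc.fourierInv_fourier_eq hI hi) x
    rw [rfourier, this, Complex.ofReal_re]
  obtain ⟨C, hC⟩ := hdec n
  have hbd : Integrable fun ξ : CSpace n => C * (1 + ‖ξ‖) ^ (-((n : ℝ) + 1)) :=
    (integrable_one_add_norm (by simp)).const_mul C
  have hle : ∀ j ξ, ‖rfourier (w j) ξ‖ ≤ C * (1 + ‖ξ‖) ^ (-((n : ℝ) + 1)) := by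
    intro j ξ
    have h0 : (0 : ℝ) < 1 + ‖ξ‖ := by positivity
    rw [Real.rpow_neg h0.le, ← div_eq_mul_inv, le_div_iff₀ (by positivity)]
    have e : (1 + ‖ξ‖) ^ ((n : ℝ) + 1) = (1 + ‖ξ‖) ^ (n + 1) := by
      rw [← Real.rpow_natCast]
      push_cast
      rfl
    rw [e, mul_comm]
    exact hC j ξ
  have hpt : ∀ x, Tendsto (fun j => w j x) atTop (𝓝 (𝓕⁻ (rfourier u) x).re) := by
    intro x
    simp_rw [hinv _ x]
    refine (Complex.continuous_re.tendsto _).comp ?_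
    simp_rw [Real.fourierInv_eq']
    refine tendsto_integral_of_dominated_convergence _ (fun j => ?_) hbd
      (fun j => Eventually.of_forall fun ξ => ?_)
      (Eventually.of_forall fun ξ => (hlim ξ).const_smul _)
    · exact Continuous.aestronglyMeasurable (by have := hcw j; fun_prop)
    · rw [norm_smul, Complex.norm_exp_ofReal_mul_I, one_mul]
      exact hle j ξ
  have hwle : ∀ j x, |w j x| ≤ ∫ ξ : CSpace n, C * (1 + ‖ξ‖) ^ (-((n : ℝ) + 1)) := by
    intro j x
    rw [hinv j x]
    refine (Complex.abs_re_le_norm _).trans ?_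
    rw [Real.fourierInv_eq']
    refine norm_integral_le_of_norm_le hbd (Eventually.of_forall fun ξ => ?_)
    rw [norm_smul, Complex.norm_exp_ofReal_mul_I, one_mul]
    exact hle j ξ
  have hv := contDiff_fourierInv_re hcu hdu
  refine ⟨_, hv, ?_⟩
  have hae := ae_eq_of_integral_contDiff_smul_eq hu.locallyIntegrable
    hv.continuous.locallyIntegrable fun φ hφ hφc => ?_
  · exact hae
  · simp only [smul_eq_mul]
    have h1 := hconv φ hφ
    have h2 : Tendsto (fun j => ∫ x, w j x * φ x) atTop
        (𝓝 (∫ x, (𝓕⁻ (rfourier u) x).re * φ x)) := by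
      refine tendsto_integral_of_dominated_convergence
        (fun x => (∫ ξ : CSpace n, C * (1 + ‖ξ‖) ^ (-((n : ℝ) + 1))) * |φ x|) (fun j => ?_) ?_
        (fun j => Eventually.of_forall fun x => ?_)
        (Eventually.of_forall fun x => (hpt x).mul_const _)
      · exact ((hw j).1.continuous.mul hφ.continuous).aestronglyMeasurable
      · exact ((hφ.continuous.integrable_of_hasCompactSupport hφc).abs).const_mul _
      · rw [Real.norm_eq_abs, abs_mul]
        exact mul_le_mul_of_nonneg_right (hwle j x) (abs_nonneg _)
    have := tendsto_nhds_unique h1 h2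
    simpa only [mul_comm] using this

end Fourier

/-! ### Local regularity of weak solutions -/

section Regularity

variable {r n N : ℕ} {G : CarnotGroup r n} {x₀ : CSpace n}

lemma BddSeq.pd_iterate {ρ₁ : ℝ} {w : ℕ → CSpace n → ℝ} (hws : ∀ k, ContDiff ℝ (⊤ : ℕ∞) (w k))
    (hb : ∀ m, BddSeq G x₀ ρ₁ m w) (i : Fin n) (m : ℕ) :
    ∀ l, BddSeq G x₀ ρ₁ l fun j => (pd i)^[m] (w j) := by
  induction m generalizing w with
  | zero => exact hb
  | succ m ih => exact ih (fun k => contDiff_pd (hws k) i) fun l => (hb (l + 1)).fderiv_single hws i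

lemma tsupport_pd_iterate (i : Fin n) (f : CSpace n → ℝ) (m : ℕ) :
    tsupport ((pd i)^[m] f) ⊆ tsupport f := by
  induction m generalizing f with
  | zero => exact subset_rfl
  | succ m ih =>
    refine (ih _).trans (closure_minimal (fun x hx => ?_) (isClosed_tsupport f))
    refine support_fderiv_subset ℝ ?_
    intro h0
    apply hx
    simp [pd, h0]

lemma integral_abs_le_nB {ρ : ℝ} {f : CSpace n → ℝ} (hf : Continuous f)
    (h0 : ∀ x, x ∉ Metric.ball x₀ ρ → f x = 0) :
    ∫ x, |f x| ≤ nB x₀ ρ f * nB x₀ ρ fun _ => 1 := by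
  rw [← setIntegral_eq_integral_of_forall_compl_eq_zero (s := Metric.ball x₀ ρ)
    (fun x hx => by rw [h0 x hx, abs_zero])]
  have h := abs_integral_mul_le (memLp_ball (x₀ := x₀) (s := ρ) hf.abs)
    (memLp_ball (x₀ := x₀) (s := ρ) (continuous_const (y := (1 : ℝ))))
  simp only [mul_one] at h
  refine (le_abs_self _).trans (h.trans ?_)
  refine mul_le_mul_of_nonneg_right ?_ nB_nonneg
  exact nrm_mono (memLp_ball hf) (Eventually.of_forall fun x => (abs_abs _).le)

lemma exists_smooth_ball {ρ ρ₁ : ℝ} (hρ : 0 < ρ) (h1 : ρ < ρ₁) {w : ℕ → CSpace n → ℝ}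
    (hws : ∀ k, ContDiff ℝ (⊤ : ℕ∞) (w k)) (hb : ∀ m, BddSeq G x₀ ρ₁ m w)
    {U : CSpace n → ℝ} (hU : Integrable U)
    (hconv : ∀ φ s, TF s φ →
      Tendsto (fun j => ∫ x, w j x * φ x) atTop (𝓝 (∫ x, U x * φ x))) :
    ∃ v : CSpace n → ℝ, ContDiff ℝ (⊤ : ℕ∞) v ∧ ∀ᵐ x, x ∈ Metric.ball x₀ ρ → U x = v x := by
  obtain ⟨s, hs1, hs2⟩ := exists_between h1
  obtain ⟨t, ht1, ht2⟩ := exists_between hs2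
  obtain ⟨_, -, hζ⟩ := exists_cutoff x₀
  obtain ⟨ζ, hζs, hζ0, hζ1, hζe, hζn, -, -⟩ := hζ ρ s hρ hs1
  have hsm : ∀ k, ContDiff ℝ (⊤ : ℕ∞) fun x => ζ x * w k x := fun k => hζs.mul (hws k)
  have hBd : ∀ m, BddSeq G x₀ ρ₁ m fun k x => ζ x * w k x := fun m => (hb m).mul hζs hws
  have hζT : TF (‖x₀‖ + s) ζ := by
    refine ⟨hζs, fun x hx => ?_⟩
    have := hζn x hx
    rw [mem_ball_iff_norm] at this
    linarith [norm_le_insert' x x₀]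
  have hTF : ∀ k, TF (‖x₀‖ + s) fun x => ζ x * w k x := by
    intro k
    have := hζT.mul_left (hws k)
    simpa only [mul_comm] using this
  have hz : ∀ i m k x, x ∉ Metric.ball x₀ t →
      (pd i)^[m] (fun x => ζ x * w k x) x = 0 := by
    intro i m k x hx
    by_contra hne
    have h2 := tsupport_pd_iterate i _ m (subset_tsupport _ hne)
    have h3 : tsupport (fun x => ζ x * w k x) ⊆ Metric.closedBall x₀ s := by
      refine closure_minimal (fun y hy => ?_) Metric.isClosed_closedBall
      exact Metric.ball_subset_closedBall (hζn y (left_ne_zero_of_mul hy))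
    exact hx (Metric.closedBall_subset_ball ht1 (h3 h2))
  have hz0 : ∀ k x, x ∉ Metric.ball x₀ t → ζ x * w k x = 0 := by
    intro k x hx
    by_contra hne
    exact hx (Metric.ball_subset_ball ht1.le (hζn x (left_ne_zero_of_mul hne)))
  have ht0 : 0 < t := by linarith
  have hUζ : Integrable fun x => ζ x * U x :=
    hU.bdd_mul (c := 1) hζs.continuous.aestronglyMeasurable (Eventually.of_forall fun x => by
      rw [Real.norm_of_nonneg (hζ0 x)]
      exact hζ1 x)
  have hL1 : ∀ i m, ∃ C, ∀ j, ∫ x, |(pd i)^[m] (fun x => ζ x * w j x) x| ≤ C := by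
    intro i m
    obtain ⟨C, hC⟩ := (BddSeq.pd_iterate hsm hBd i m 0).zero t ht0 ht2
    refine ⟨C * nB x₀ t fun _ => 1, fun j => ?_⟩
    refine (integral_abs_le_nB ((hTF j).pd_iterate i m).1.continuous (hz i m j)).trans ?_
    exact mul_le_mul_of_nonneg_right (hC j) nB_nonneg
  have hL0 : ∃ C, ∀ j, ∫ x, |ζ x * w j x| ≤ C := by
    obtain ⟨C, hC⟩ := (hBd 0).zero t ht0 ht2
    refine ⟨C * nB x₀ t fun _ => 1, fun j => ?_⟩
    refine (integral_abs_le_nB (hsm j).continuous (hz0 j)).trans ?_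
    exact mul_le_mul_of_nonneg_right (hC j) nB_nonneg
  have hlim : ∀ φ, ContDiff ℝ (⊤ : ℕ∞) φ →
      Tendsto (fun j => ∫ x, ζ x * w j x * φ x) atTop (𝓝 (∫ x, ζ x * U x * φ x)) := by
    intro φ hφ
    have h := hconv (fun x => φ x * ζ x) _ (hζT.mul_left hφ)
    refine (h.congr fun j => ?_).trans (le_of_eq ?_)
    · congr 1
      funext x
      ring
    · congr 2
      funext x
      ring
  obtain ⟨v, hv, hve⟩ := exists_smooth_of_bounded hTF hUζ hL1 hL0 hlim
  refine ⟨v, hv, ?_⟩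
  filter_upwards [hve] with x hx hxb
  rw [← hx, hζe x hxb, one_mul]

variable {Ω : Set (CSpace n)}

lemma integrable_mul_of_support {K : Set (CSpace n)} (hK : IsCompact K) {g ψ : CSpace n → ℝ}
    (hg : IntegrableOn g K) (hψ : Continuous ψ) (h0 : ∀ p, ψ p ≠ 0 → p ∈ K) :
    Integrable fun p => g p * ψ p := by
  rw [← integrableOn_iff_integrable_of_support_subset (s := K)
    (fun p hp => h0 p (right_ne_zero_of_mul hp))]
  exact hg.mul_continuousOn hψ.continuousOn hK

lemma setIntegral_mul_eq {g ψ : CSpace n → ℝ} (h0 : ∀ p, ψ p ≠ 0 → p ∈ Ω) :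
    ∫ p in Ω, g p * ψ p = ∫ p, g p * ψ p :=
  setIntegral_eq_integral_of_forall_compl_eq_zero fun p hp => by
    rw [not_imp_comm.1 (h0 p) hp, mul_zero]

lemma contDiff_cutoff_mul {η f : CSpace n → ℝ} {R : ℝ} (hΩ : IsOpen Ω)
    (hR : Metric.closedBall x₀ R ⊆ Ω) (hη : ContDiff ℝ (⊤ : ℕ∞) η)
    (hη0 : ∀ x, η x ≠ 0 → x ∈ Metric.ball x₀ R) (hf : ContDiffOn ℝ (⊤ : ℕ∞) f Ω) :
    ContDiff ℝ (⊤ : ℕ∞) fun x => η x * f x := by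
  rw [contDiff_iff_contDiffAt]
  intro x
  by_cases hx : x ∈ Ω
  · exact hη.contDiffAt.mul (hf.contDiffAt (hΩ.mem_nhds hx))
  · have hm : (Metric.closedBall x₀ R)ᶜ ∈ 𝓝 x :=
      Metric.isClosed_closedBall.isOpen_compl.mem_nhds fun h => hx (hR h)
    refine (contDiffAt_const (c := (0 : ℝ))).congr_of_eventuallyEq ?_
    filter_upwards [hm] with y hy
    rw [not_imp_comm.1 (hη0 y) fun h => hy (Metric.ball_subset_closedBall h), zero_mul]

lemma support_dvf_subset {Z : CSpace n → CSpace n} {φ : CSpace n → ℝ} {K : Set (CSpace n)}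
    (hK : IsClosed K) (h0 : ∀ p, φ p ≠ 0 → p ∈ K) (p : CSpace n) (hp : Dvf Z φ p ≠ 0) :
    p ∈ K := by
  have h1 : p ∈ tsupport φ := support_fderiv_subset ℝ fun h => hp (by simp [Dvf, h])
  exact closure_minimal (fun q hq => h0 q hq) hK h1

lemma isTest_of_support {φ : CSpace n → ℝ} {R : ℝ} (hφ : ContDiff ℝ (⊤ : ℕ∞) φ)
    (h0 : ∀ p, φ p ≠ 0 → p ∈ Metric.closedBall x₀ R) (hR : Metric.closedBall x₀ R ⊆ Ω) :
    IsTest Ω φ := by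
  have h1 : tsupport φ ⊆ Metric.closedBall x₀ R :=
    closure_minimal (fun q hq => h0 q hq) Metric.isClosed_closedBall
  exact ⟨hφ, HasCompactSupport.of_support_subset_isCompact (isCompact_closedBall x₀ R)
    fun q hq => h0 q hq, h1.trans hR⟩

lemma memLp_indicator_of_memL2loc {f : CSpace n → ℝ} (hf : MemL2loc Ω f) {R : ℝ}
    (hR : Metric.closedBall x₀ R ⊆ Ω) :
    MemLp ((Metric.closedBall x₀ R).indicator f) 2 ∧
      Integrable ((Metric.closedBall x₀ R).indicator f) ∧
      IntegrableOn f (Metric.closedBall x₀ R) := by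
  have h : MemLp f 2 (volume.restrict (Metric.closedBall x₀ R)) :=
    hf _ hR (isCompact_closedBall x₀ R)
  have : IsFiniteMeasure (volume.restrict (Metric.closedBall x₀ R)) :=
    ⟨by simpa using measure_closedBall_lt_top⟩
  have hi : IntegrableOn f (Metric.closedBall x₀ R) := h.integrable one_le_two
  exact ⟨(memLp_indicator_iff_restrict Metric.isClosed_closedBall.measurableSet).2 h,
    (integrable_indicator_iff Metric.isClosed_closedBall.measurableSet).2 hi, hi⟩

lemma weak_eq {A : Fin N → Fin N → Fin (G.m 1) → Fin (G.m 1) → ℝ}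
    {u : Fin N → CSpace n → ℝ} {Du : Fin N → Fin (G.m 1) → CSpace n → ℝ}
    {f : Fin N → CSpace n → ℝ} {fi : Fin N → Fin (G.m 1) → CSpace n → ℝ}
    (hu : G.MemS12loc Ω u Du) (hsol : G.IsWeakSolution Ω A u Du f fi)
    {F : Fin N → CSpace n → ℝ} {Fi : Fin N → Fin (G.m 1) → CSpace n → ℝ}
    (hF : ∀ α, ContDiff ℝ (⊤ : ℕ∞) (F α)) (hFi : ∀ α i, ContDiff ℝ (⊤ : ℕ∞) (Fi α i))
    {R R₁ : ℝ} (h1 : R₁ < R) (hR : Metric.closedBall x₀ R ⊆ Ω)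
    (hFf : ∀ α, ∀ x ∈ Metric.closedBall x₀ R₁, F α x = f α x)
    (hFfi : ∀ α i, ∀ x ∈ Metric.closedBall x₀ R₁, Fi α i x = fi α i x)
    (α : Fin N) {φ : CSpace n → ℝ} (hφ : ContDiff ℝ (⊤ : ℕ∞) φ)
    (hφ0 : ∀ p, φ p ≠ 0 → p ∈ Metric.closedBall x₀ R₁) :
    ∑ β, ∑ i, ∑ j, A α β i j *
        ∫ p, (Metric.closedBall x₀ R).indicator (u β) p * Dvf (G.X 1 j) (Dvf (G.X 1 i) φ) p =
      ∫ p, (-F α p - ∑ _β : Fin N, ∑ i, ∑ _j : Fin (G.m 1), adj (G.X 1 i) (Fi α i) p) * φ p := by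
  have hcl := Metric.isClosed_closedBall (x := x₀) (ε := R₁)
  have hsub : Metric.closedBall x₀ R₁ ⊆ Metric.closedBall x₀ R :=
    Metric.closedBall_subset_closedBall h1.le
  have hX : ∀ i, ContDiff ℝ (⊤ : ℕ∞) (G.X 1 i) := G.smooth_X 1
  have hdφ : ∀ i, ContDiff ℝ (⊤ : ℕ∞) (Dvf (G.X 1 i) φ) := fun i => contDiff_dvf (hX i) hφ
  have hd0 : ∀ i p, Dvf (G.X 1 i) φ p ≠ 0 → p ∈ Metric.closedBall x₀ R₁ :=
    fun i => support_dvf_subset hcl hφ0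
  have hdd0 : ∀ i j p, Dvf (G.X 1 j) (Dvf (G.X 1 i) φ) p ≠ 0 → p ∈ Metric.closedBall x₀ R₁ :=
    fun i j => support_dvf_subset hcl (hd0 i)
  have hφt : IsTest Ω φ := isTest_of_support hφ hφ0 (hsub.trans hR)
  have hφc : HasCompactSupport φ := hφt.2.1
  have key := hsol α φ hφt
  have hleft : ∀ β i j, ∫ p in Ω, (A α β i j * Du β j p + fi α i p) * G.D 1 i φ p =
      -(A α β i j * ∫ p, (Metric.closedBall x₀ R).indicator (u β) p *
        Dvf (G.X 1 j) (Dvf (G.X 1 i) φ) p) - ∫ p, adj (G.X 1 i) (Fi α i) p * φ p := by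
    intro β i j
    have e1 : ∫ p, Du β j p * Dvf (G.X 1 i) φ p =
        -∫ p, (Metric.closedBall x₀ R).indicator (u β) p *
          Dvf (G.X 1 j) (Dvf (G.X 1 i) φ) p := by
      have h := hu.2.1 β j _ (isTest_of_support (hdφ i) (hd0 i) (hsub.trans hR))
      rw [setIntegral_mul_eq fun p hp => hR (hsub (hd0 i p hp)),
        setIntegral_mul_eq fun p hp => hR (hsub (hdd0 i j p hp))] at h
      rw [h]
      congr 2
      funext p
      by_cases hp : p ∈ Metric.closedBall x₀ R
      · rw [Set.indicator_of_mem hp]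
      · rw [not_imp_comm.1 (hdd0 i j p) fun h => hp (hsub h), mul_zero, mul_zero]
    have e2 : ∫ p, Fi α i p * Dvf (G.X 1 i) φ p = -∫ p, adj (G.X 1 i) (Fi α i) p * φ p := by
      rw [integral_adj (hX i) (hFi α i) hφ hφc, neg_neg]
    have i1 : Integrable fun p => A α β i j * (Du β j p * Dvf (G.X 1 i) φ p) :=
      (integrable_mul_of_support (isCompact_closedBall x₀ R)
        (memLp_indicator_of_memL2loc (hu.2.2 β j) hR).2.2 (hdφ i).continuous
        fun p hp => hsub (hd0 i p hp)).const_mul _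
    have i2 : Integrable fun p => Fi α i p * Dvf (G.X 1 i) φ p :=
      ((hFi α i).continuous.mul (hdφ i).continuous).integrable_of_hasCompactSupport
        (hasCompactSupport_dvf hφc).mul_left
    have e3 : ∫ p in Ω, (A α β i j * Du β j p + fi α i p) * G.D 1 i φ p =
        ∫ p, (A α β i j * (Du β j p * Dvf (G.X 1 i) φ p) + Fi α i p * Dvf (G.X 1 i) φ p) := by
      refine (setIntegral_mul_eq fun p hp => hR (hsub (hd0 i p hp))).trans ?_
      congr 1
      funext p
      by_cases hp : p ∈ Metric.closedBall x₀ R₁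
      · rw [hFfi α i p hp]
        ring
      · rw [not_imp_comm.1 (hd0 i p) hp]
        ring
    rw [e3, integral_add i1 i2, integral_const_mul, e1, e2]
    ring
  have hright : ∫ p in Ω, f α p * φ p = ∫ p, F α p * φ p := by
    rw [setIntegral_mul_eq fun p hp => hR (hsub (hφ0 p hp))]
    congr 1
    funext p
    by_cases hp : p ∈ Metric.closedBall x₀ R₁
    · rw [hFf α p hp]
    · rw [not_imp_comm.1 (hφ0 p) hp, mul_zero, mul_zero]
  rw [hright] at key
  simp only [hleft, Finset.sum_sub_distrib, Finset.sum_neg_distrib] at key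
  have ia : ∀ i, Integrable fun p => adj (G.X 1 i) (Fi α i) p * φ p := fun i =>
    ((contDiff_adj (hX i) (hFi α i)).continuous.mul hφ.continuous).integrable_of_hasCompactSupport
      hφc.mul_left
  have iF : Integrable fun p => -(F α p * φ p) :=
    (((hF α).continuous.mul hφ.continuous).integrable_of_hasCompactSupport hφc.mul_left).neg
  have is3 : ∀ i, Integrable fun p => ∑ _j : Fin (G.m 1), adj (G.X 1 i) (Fi α i) p * φ p :=
    fun i => integrable_finsetSum _ fun _ _ => ia i
  have is2 : Integrable fun p =>
      ∑ i, ∑ _j : Fin (G.m 1), adj (G.X 1 i) (Fi α i) p * φ p :=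
    integrable_finsetSum _ fun i _ => is3 i
  have is1 : Integrable fun p =>
      ∑ _β : Fin N, ∑ i, ∑ _j : Fin (G.m 1), adj (G.X 1 i) (Fi α i) p * φ p :=
    integrable_finsetSum _ fun _ _ => is2
  have e4 : ∫ p, (-F α p - ∑ _β : Fin N, ∑ i, ∑ _j : Fin (G.m 1),
      adj (G.X 1 i) (Fi α i) p) * φ p = -(∫ p, F α p * φ p) -
      ∑ _β : Fin N, ∑ i, ∑ _j : Fin (G.m 1), ∫ p, adj (G.X 1 i) (Fi α i) p * φ p := by
    have e5 : ∀ p, (-F α p - ∑ _β : Fin N, ∑ i, ∑ _j : Fin (G.m 1),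
        adj (G.X 1 i) (Fi α i) p) * φ p = -(F α p * φ p) -
        ∑ _β : Fin N, ∑ i, ∑ _j : Fin (G.m 1), adj (G.X 1 i) (Fi α i) p * φ p := by
      intro p
      simp only [sub_mul, neg_mul, Finset.sum_mul]
    simp only [e5]
    rw [integral_sub iF is1, integral_neg, integral_finsetSum _ fun _ _ => is2]
    congr 1
    refine Finset.sum_congr rfl fun _ _ => ?_
    rw [integral_finsetSum _ fun i _ => is3 i]
    exact Finset.sum_congr rfl fun i _ => integral_finsetSum _ fun _ _ => ia i
  rw [e4, ← key]
  ring

lemma exists_smooth_local {A : Fin N → Fin N → Fin (G.m 1) → Fin (G.m 1) → ℝ} {lam : ℝ}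
    (hlam : 0 < lam) (hco : G.Coercive lam A)
    {u : Fin N → CSpace n → ℝ} {Du : Fin N → Fin (G.m 1) → CSpace n → ℝ}
    {f : Fin N → CSpace n → ℝ} {fi : Fin N → Fin (G.m 1) → CSpace n → ℝ} (hΩ : IsOpen Ω)
    (hf : ∀ α, ContDiffOn ℝ (⊤ : ℕ∞) (f α) Ω) (hfi : ∀ α i, ContDiffOn ℝ (⊤ : ℕ∞) (fi α i) Ω)
    (hu : G.MemS12loc Ω u Du) (hsol : G.IsWeakSolution Ω A u Du f fi) (hx₀ : x₀ ∈ Ω)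
    (β : Fin N) :
    ∃ s > 0, ∃ v : CSpace n → ℝ, Metric.ball x₀ s ⊆ Ω ∧ ContDiff ℝ (⊤ : ℕ∞) v ∧
      ∀ᵐ x, x ∈ Metric.ball x₀ s → u β x = v x := by
  obtain ⟨R, hR0, hR⟩ := Metric.nhds_basis_closedBall.mem_iff.1 (hΩ.mem_nhds hx₀)
  obtain ⟨_, -, hη⟩ := exists_cutoff x₀
  obtain ⟨η, hηs, -, -, hη1, hη0, -, -⟩ := hη (7 * R / 8) R (by positivity) (by linarith)
  have hηe : ∀ x ∈ Metric.closedBall x₀ (3 * R / 4), η x = 1 := fun x hx =>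
    hη1 x (Metric.closedBall_subset_ball (by linarith) hx)
  have hF : ∀ α, ContDiff ℝ (⊤ : ℕ∞) fun x => η x * f α x := fun α =>
    contDiff_cutoff_mul hΩ hR hηs hη0 (hf α)
  have hFi : ∀ α i, ContDiff ℝ (⊤ : ℕ∞) fun x => η x * fi α i x := fun α i =>
    contDiff_cutoff_mul hΩ hR hηs hη0 (hfi α i)
  have hUI : ∀ β, Integrable ((Metric.closedBall x₀ R).indicator (u β)) :=
    fun β => (memLp_indicator_of_memL2loc (hu.1 β) hR).2.1
  obtain ⟨w, hws, hwb, hwc⟩ := exists_approx (G := G) hlam hco (x₀ := x₀) (ρ₁ := R / 2)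
    (R₁ := 3 * R / 4) (R := ‖x₀‖ + R) (by linarith)
    (u := fun β => (Metric.closedBall x₀ R).indicator (u β)) hUI
    (fun β g hg => by
      have h := Set.mem_of_indicator_ne_zero hg
      rw [mem_closedBall_iff_norm] at h
      linarith [norm_le_insert' g x₀])
    (fun β => (memLp_indicator_of_memL2loc (hu.1 β) hR).1)
    (F := fun α p => -(η p * f α p) - ∑ _β : Fin N, ∑ i, ∑ _j : Fin (G.m 1),
      adj (G.X 1 i) (fun x => η x * fi α i x) p)
    (fun α => (hF α).neg.sub (ContDiff.sum fun _ _ => ContDiff.sum fun i _ =>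
      ContDiff.sum fun _ _ => contDiff_adj (G.smooth_X 1 i) (hFi α i)))
    (fun α φ hφ hφ0 => weak_eq hu hsol hF hFi (R := R) (R₁ := 3 * R / 4) (by linarith) hR
      (fun α x hx => by rw [hηe x hx, one_mul]) (fun α i x hx => by rw [hηe x hx, one_mul])
      α hφ fun p hp => by
        rw [mem_closedBall_iff_norm]
        exact hφ0 p hp)
  obtain ⟨v, hv, hve⟩ := exists_smooth_ball (G := G) (x₀ := x₀) (ρ := R / 4) (ρ₁ := R / 2)
    (by positivity) (by linarith) (fun k => hws k β) (fun m => hwb m β) (hUI β)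
    fun φ s hφ => hwc β φ s hφ
  have hsub : Metric.ball x₀ (R / 4) ⊆ Metric.closedBall x₀ R :=
    Metric.ball_subset_closedBall.trans (Metric.closedBall_subset_closedBall (by linarith))
  refine ⟨R / 4, by positivity, v, hsub.trans hR, hv, ?_⟩
  filter_upwards [hve] with x hx hxb
  rw [← hx hxb, Set.indicator_of_mem (hsub hxb)]

/-- Functions that locally agree almost everywhere with smooth functions have a smooth
representative. -/
lemma exists_smooth_of_local (hΩ : IsOpen Ω) {u : CSpace n → ℝ}
    (h : ∀ x₀ ∈ Ω, ∃ s > 0, ∃ v : CSpace n → ℝ, Metric.ball x₀ s ⊆ Ω ∧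
      ContDiff ℝ (⊤ : ℕ∞) v ∧ ∀ᵐ x, x ∈ Metric.ball x₀ s → u x = v x) :
    ∃ v : CSpace n → ℝ, ContDiffOn ℝ (⊤ : ℕ∞) v Ω ∧ u =ᵐ[volume.restrict Ω] v := by
  classical
  choose! s hs v hsub hv hve using h
  have hloc : ∀ x ∈ Ω, ∀ y ∈ Metric.ball x (s x), v y y = v x y := by
    intro x hx y hy
    have hyΩ := hsub x hx hy
    have hopen : IsOpen (Metric.ball x (s x) ∩ Metric.ball y (s y)) :=
      Metric.isOpen_ball.inter Metric.isOpen_ball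
    have hae : v y =ᵐ[volume.restrict (Metric.ball x (s x) ∩ Metric.ball y (s y))] v x := by
      rw [EventuallyEq, ae_restrict_iff' hopen.measurableSet]
      filter_upwards [hve x hx, hve y hyΩ] with z h1 h2 hz
      rw [← h1 hz.1, ← h2 hz.2]
    exact Measure.eqOn_open_of_ae_eq hae hopen (hv y hyΩ).continuous.continuousOn
      (hv x hx).continuous.continuousOn ⟨hy, Metric.mem_ball_self (hs y hyΩ)⟩
  refine ⟨fun x => v x x, fun x hx => ?_, ?_⟩
  · refine ((hv x hx).contDiffAt.congr_of_eventuallyEq ?_).contDiffWithinAt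
    filter_upwards [Metric.ball_mem_nhds x (hs x hx)] with y hy
    exact hloc x hx y hy
  · rw [EventuallyEq, ae_restrict_iff' hΩ.measurableSet]
    have hnull : volume {x | x ∈ Ω ∧ u x ≠ v x x} = 0 := by
      refine measure_null_of_locally_null _ fun x hx => ?_
      refine ⟨_, inter_mem_nhdsWithin _ (Metric.ball_mem_nhds x (hs x hx.1)), ?_⟩
      refine measure_mono_null (fun y hy => ?_) (ae_iff.1 (hve x hx.1))
      intro hc
      exact hy.1.2 ((hc hy.2).trans (hloc x hx.1 y hy.2).symm)
    rw [ae_iff]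
    refine measure_mono_null (fun x hx => ?_) hnull
    simpa using hx

end Regularity

end Hypoelliptic

/-- **Hypoellipticity (Corollary of the Main Theorem).** Let `G` be a Carnot
group of step `r` and `Ω ⊆ G` an open bounded set.  If `u ∈ S^{1,2}_{loc}(Ω; ℝ^N)`
is a weak solution of the constant coefficient system (1.1) and the data
`f^α, f_i^α` are smooth on `Ω`, then `u` is smooth in `Ω` (i.e. it has a `C^∞`
representative). -/
theorem hypoellipticity {r n N : ℕ} (G : CarnotGroup r n) (Ω : Set (CSpace n))
    (hΩ : IsOpen Ω) (hΩb : Bornology.IsBounded Ω)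
    (A : Fin N → Fin N → Fin (G.m 1) → Fin (G.m 1) → ℝ)
    (lam : ℝ) (hlam : 0 < lam) (hco : G.Coercive lam A)
    (u : Fin N → CSpace n → ℝ) (Du : Fin N → Fin (G.m 1) → CSpace n → ℝ)
    (f : Fin N → CSpace n → ℝ) (fi : Fin N → Fin (G.m 1) → CSpace n → ℝ)
    (hf : ∀ α, ContDiffOn ℝ (⊤ : ℕ∞) (f α) Ω)
    (hfi : ∀ α i, ContDiffOn ℝ (⊤ : ℕ∞) (fi α i) Ω)
    (hu : G.MemS12loc Ω u Du)
    (hsol : G.IsWeakSolution Ω A u Du f fi) :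
    ∃ v : Fin N → CSpace n → ℝ,
      (∀ β, ContDiffOn ℝ (⊤ : ℕ∞) (v β) Ω) ∧
      ∀ β, u β =ᵐ[volume.restrict Ω] v β := by
  choose v hv hve using fun β => Hypoelliptic.exists_smooth_of_local hΩ fun x₀ hx₀ =>
    Hypoelliptic.exists_smooth_local (x₀ := x₀) hlam hco hΩ hf hfi hu hsol hx₀ β
  exact ⟨v, hv, hve⟩
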